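/- Let G be a connected subcubic graph on n vertices and m edges with girth at least 5. Then one of the following holds: (a) G is isomorphic to R_1 or R_2, and φ(G) = (1/5)m + 2/5; (b) G belongs to F_{4,4}, or G is obtained from a disjoint union of copies of R and of members of F_{4,3} of girth at least 5 by adding edges such that each added edge is a cut-edge of G, and φ(G) ≤ (1/5)m + 1/5; (c) φ(G) ≤ (1/5)m. -/

import Mathlib

open SimpleGraph

namespace InducedForest

/-- A graph is subcubic if every vertex has at most 3 neighbours. -/
def Subcubic {V : Type} (G : SimpleGraph V) : Prop := ∀ v : V, (G.neighborSet v).ncard ≤ 3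

/-- A graph is cubic if every vertex has exactly 3 neighbours. -/
def Cubic {V : Type} (G : SimpleGraph V) : Prop := ∀ v : V, (G.neighborSet v).ncard = 3

/-- `S` is a feedback vertex set of `G` iff `G - S` is a forest. -/
def IsFVS {V : Type} (G : SimpleGraph V) (S : Set V) : Prop := (G.induce Sᶜ).IsAcyclic

/-- `φ(G)`: the minimum size of a feedback vertex set of `G`. -/
noncomputable def fvs {V : Type} (G : SimpleGraph V) : ℕ :=
  sInf {n : ℕ | ∃ S : Set V, IsFVS G S ∧ S.ncard = n}

/-- `a(G)`: the maximum number of vertices of an induced forest in `G`. -/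
noncomputable def indForestNum {V : Type} (G : SimpleGraph V) : ℕ :=
  sSup {n : ℕ | ∃ S : Set V, (G.induce S).IsAcyclic ∧ S.ncard = n}

/-- `v` is a cut-vertex of `G`: deleting it increases the number of connected components. -/
def IsCutVertex {V : Type} (G : SimpleGraph V) (v : V) : Prop :=
  Nat.card G.ConnectedComponent < Nat.card (G.induce {u | u ≠ v}).ConnectedComponent

/-- `B` is a block of `G`: a maximal set of vertices inducing a connected subgraph
without cut-vertices. -/
def IsBlock {V : Type} (G : SimpleGraph V) (B : Set V) : Prop :=
  ((G.induce B).Connected ∧ ∀ v, ¬ IsCutVertex (G.induce B) v) ∧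
  ∀ B' : Set V, B ⊆ B' →
    ((G.induce B').Connected ∧ ∀ v, ¬ IsCutVertex (G.induce B') v) → B' = B

/-- 2-connectedness: at least 3 vertices and removing fewer than 2 vertices
leaves a connected graph. -/
def TwoConnected {V : Type} (G : SimpleGraph V) : Prop :=
  3 ≤ Nat.card V ∧ ∀ s : Set V, s.ncard < 2 → (G.induce sᶜ).Connected

/-- 3-connectedness: at least 4 vertices and removing fewer than 3 vertices
leaves a connected graph. -/
def ThreeConnected {V : Type} (G : SimpleGraph V) : Prop :=
  4 ≤ Nat.card V ∧ ∀ s : Set V, s.ncard < 3 → (G.induce sᶜ).Connected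

/-- The graph obtained from `H` by subdividing the edge `xy` once;
the subdivision vertex is `none`. -/
def subdivide {V : Type} (H : SimpleGraph V) (x y : V) : SimpleGraph (Option V) :=
  SimpleGraph.fromRel (fun p q =>
    match p, q with
    | some u, some v => H.Adj u v ∧ s(u, v) ≠ s(x, y)
    | some u, none => u = x ∨ u = y
    | _, _ => False)

/-- `G` is obtained from `H` by subdividing one edge once. -/
def IsSubdivisionOfOneEdge {V W : Type} (H : SimpleGraph V) (G : SimpleGraph W) : Prop :=
  ∃ x y : V, H.Adj x y ∧ Nonempty (G ≃g subdivide H x y)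

/-- The graph obtained from `K` by adding one new vertex (`none`)
joined to all vertices of `S`. -/
def addApex {V : Type} (K : SimpleGraph V) (S : Set V) : SimpleGraph (Option V) :=
  SimpleGraph.fromRel (fun p q =>
    match p, q with
    | some u, some v => K.Adj u v
    | some u, none => u ∈ S
    | _, _ => False)

/-- `G` is (isomorphic to) `H ∘ (e1, e2, a)`: subdivide `e1` and `e2` once each
(with `e1` subdivided twice if `e1 = e2`) and add a new vertex adjacent to `a` and to the
two subdivision vertices. -/
def IsCircOp {V W : Type} (H : SimpleGraph V) (e1 e2 : Sym2 V) (a : V)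
    (G : SimpleGraph W) : Prop :=
  (e1 ≠ e2 ∧ ∃ x1 y1 x2 y2 : V, e1 = s(x1, y1) ∧ e2 = s(x2, y2) ∧
    Nonempty (G ≃g addApex (subdivide (subdivide H x1 y1) (some x2) (some y2))
      {some (some a), some none, none})) ∨
  (e1 = e2 ∧ ∃ x y : V, e1 = s(x, y) ∧
    Nonempty (G ≃g addApex (subdivide (subdivide H x y) none (some y))
      {some (some a), some none, none}))

/-- The cycle of length `n` (for `n ≥ 3`). -/
def cyc (n : ℕ) : SimpleGraph (ZMod n) :=
  SimpleGraph.fromRel (fun u v => v = u + 1)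

/-- The families `F_{i,j}` of graphs (closed under isomorphism):
`F_{i,0} = {C_i}` for `i ≥ 3`; `F_{1,1} = {K_4}`; `F_{j,j}` for `j ≥ 2` is obtained from
`F_{j-1,j-1}` by subdividing one edge once and then applying the `∘` operation at the
subdivision vertex; and `F_{i,j}` for `i > j ≥ 1` is obtained from `F_{j,j}` by `i - j`
successive single-edge subdivisions. -/
inductive MemF : ℕ → ℕ → ∀ {V : Type}, SimpleGraph V → Prop
  | cycle {i : ℕ} (hi : 3 ≤ i) {V : Type} {G : SimpleGraph V}
      (h : Nonempty (G ≃g cyc i)) : MemF i 0 G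
  | k4 {V : Type} {G : SimpleGraph V}
      (h : Nonempty (G ≃g (⊤ : SimpleGraph (Fin 4)))) : MemF 1 1 G
  | circ {j : ℕ} (hj : 2 ≤ j) {V : Type} {H : SimpleGraph V}
      (hH : MemF (j - 1) (j - 1) H) {x y : V} (hxy : H.Adj x y)
      {e1 e2 : Sym2 (Option V)} (he1 : e1 ∈ (subdivide H x y).edgeSet)
      (he2 : e2 ∈ (subdivide H x y).edgeSet)
      {W : Type} {G : SimpleGraph W}
      (hG : IsCircOp (subdivide H x y) e1 e2 none G) : MemF j j G
  | subd {i j : ℕ} (hj : 1 ≤ j) {V : Type} {H : SimpleGraph V}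
      (hH : MemF i j H) {x y : V} (hxy : H.Adj x y) {W : Type} {G : SimpleGraph W}
      (hG : Nonempty (G ≃g subdivide H x y)) : MemF (i + 1) j G

/-- `K_4^+`: the graph obtained from `K_4` by subdividing one edge once. -/
def K4plus : SimpleGraph (Option (Fin 4)) :=
  subdivide (⊤ : SimpleGraph (Fin 4)) 0 1

/-- `L`: the graph obtained from `K_4` by subdividing once each edge
of a perfect matching. -/
def Lgraph : SimpleGraph (Option (Option (Fin 4))) :=
  subdivide (subdivide (⊤ : SimpleGraph (Fin 4)) 0 1) (some 2) (some 3)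

/-- The Petersen graph. -/
def petersen : SimpleGraph (ZMod 5 × Fin 2) :=
  SimpleGraph.fromRel (fun u v =>
    (u.2 = 0 ∧ v.2 = 0 ∧ v.1 = u.1 + 1) ∨
    (u.2 = 1 ∧ v.2 = 1 ∧ v.1 = u.1 + 2) ∨
    (u.2 = 0 ∧ v.2 = 1 ∧ u.1 = v.1))

/-- `R`: the Petersen graph minus one edge. -/
def Rgraph : SimpleGraph (ZMod 5 × Fin 2) :=
  petersen.deleteEdges {s(((0 : ZMod 5), (0 : Fin 2)), ((1 : ZMod 5), (0 : Fin 2)))}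

/-- `Q_3`: the 3-dimensional cube graph. -/
def Q3 : SimpleGraph (Fin 2 × Fin 2 × Fin 2) :=
  SimpleGraph.fromRel (fun u v =>
    (u.1 ≠ v.1 ∧ u.2 = v.2) ∨ (u.1 = v.1 ∧ u.2.1 ≠ v.2.1 ∧ u.2.2 = v.2.2) ∨
    (u.1 = v.1 ∧ u.2.1 = v.2.1 ∧ u.2.2 ≠ v.2.2))

/-- `V_8`: the Wagner graph. -/
def V8 : SimpleGraph (ZMod 8) :=
  SimpleGraph.fromRel (fun u v => v = u + 1 ∨ v = u + 4)

/-- The dodecahedron, presented as the generalized Petersen graph `GP(10,2)`. -/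
def dodecahedron : SimpleGraph (ZMod 10 × Fin 2) :=
  SimpleGraph.fromRel (fun u v =>
    (u.2 = 0 ∧ v.2 = 0 ∧ v.1 = u.1 + 1) ∨
    (u.2 = 1 ∧ v.2 = 1 ∧ v.1 = u.1 + 2) ∨
    (u.2 = 0 ∧ v.2 = 1 ∧ u.1 = v.1))

/-- The families `F^g_{i,j,k}`: 2-connected subcubic graphs obtained from the disjoint
union of `k` copies of `L` (when `g = 4`) or of `R` (when `g = 5`) and one member of
`F_{i,j}` by adding `k+1` edges; when `k ≥ 1`, each added edge joins two different
constituent copies. -/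
def MemFG (g i j k : ℕ) {W : Type} (G : SimpleGraph W) : Prop :=
  TwoConnected G ∧ Subcubic G ∧
  ∃ (P : W → Fin (k + 1)) (H : SimpleGraph W),
    H ≤ G ∧ (∀ u v, H.Adj u v → P u = P v) ∧
    MemF i j (H.induce (P ⁻¹' {0})) ∧
    ((g = 4 ∧ ∀ l : Fin (k + 1), l ≠ 0 → Nonempty ((H.induce (P ⁻¹' {l})) ≃g Lgraph)) ∨
     (g = 5 ∧ ∀ l : Fin (k + 1), l ≠ 0 → Nonempty ((H.induce (P ⁻¹' {l})) ≃g Rgraph))) ∧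
    (G.edgeSet \ H.edgeSet).ncard = k + 1 ∧
    (1 ≤ k → ∀ u v, G.Adj u v → ¬ H.Adj u v → P u ≠ P v)

/-- `t_4 = 2/9`, `t_5 = 1/5`. -/
noncomputable def tg (g : ℕ) : ℝ := if g = 4 then 2 / 9 else 1 / 5

/-- The error function `ε_g` on graphs. -/
noncomputable def eps (g : ℕ) {V : Type} (G : SimpleGraph V) : ℝ := by
  classical
  exact
    if h1 : ∃ p : ℕ × ℕ, 1 ≤ p.1 ∧ p.2 ≤ p.1 ∧ MemF p.1 p.2 G then
      max (1 - (h1.choose.2 : ℝ) * (5 * tg g - 1) - (h1.choose.1 : ℝ) * tg g) 0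
    else if h2 : ∃ q : ℕ × ℕ × ℕ, 1 ≤ q.1 ∧ q.2.1 ≤ q.1 ∧ MemFG g q.1 q.2.1 q.2.2 G then
      max (1 - tg g - (h2.choose.2.1 : ℝ) * (5 * tg g - 1) - (h2.choose.1 : ℝ) * tg g) 0
    else if Nonempty (G ≃g (⊤ : SimpleGraph (Fin 2))) then -tg g
    else 0

/-- The error function `r_g(G)`: the sum of `ε_g(B)` over all blocks `B` of `G`. -/
noncomputable def rg (g : ℕ) {V : Type} (G : SimpleGraph V) : ℝ :=
  ∑ᶠ B ∈ {B : Set V | IsBlock G B}, eps g (G.induce B)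

/-- `G` has two vertex-disjoint cycles, each of length less than `g`. -/
def TwoDisjointCyclesLt {V : Type} (G : SimpleGraph V) (g : ℕ) : Prop :=
  ∃ (u v : V) (c1 : G.Walk u u) (c2 : G.Walk v v), c1.IsCycle ∧ c2.IsCycle ∧
    c1.length < g ∧ c2.length < g ∧ ∀ x, x ∈ c1.support → x ∉ c2.support

/-- `G` contains a (not necessarily induced) subgraph isomorphic to `K`. -/
def ContainsSubgraphCopy {U V : Type} (K : SimpleGraph U) (G : SimpleGraph V) : Prop :=
  ∃ f : U → V, Function.Injective f ∧ ∀ u v, K.Adj u v → G.Adj (f u) (f v)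

/-- `G` is obtained from `H` by adding edges, each of which is a cut-edge of `G`. -/
def AddCutEdges {V : Type} (H G : SimpleGraph V) : Prop :=
  H ≤ G ∧ ∀ e ∈ G.edgeSet \ H.edgeSet, G.IsBridge e

/-- The edges of `H` all lie inside the parts of the partition given by `P`. -/
def PartitionedBy {V ι : Type} (H : SimpleGraph V) (P : V → ι) : Prop :=
  ∀ u v, H.Adj u v → P u = P v

/-- `G` is `g`-minimal: a minimum counterexample to the main theorem. -/
def GMinimal (g : ℕ) {V : Type} [Fintype V] (G : SimpleGraph V) : Prop :=
  Subcubic G ∧ ¬ TwoDisjointCyclesLt G g ∧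
  tg g * G.edgeSet.ncard + rg g G < (fvs G : ℝ) ∧
  ∀ (W : Type) [Fintype W] (H : SimpleGraph W), Nat.card W < Nat.card V →
    Subcubic H → ¬ TwoDisjointCyclesLt H g →
    (fvs H : ℝ) ≤ tg g * H.edgeSet.ncard + rg g H


section MatchingForest

open Classical in
/-- A small matroid-union type statement: sparsity relative to marked nodes yields
an assignment of incident edges to marked nodes whose removal leaves a forest. -/
theorem matching_forest {ι E : Type} [DecidableEq ι] (ends : E → Finset ι)
    (I : Finset ι) (O : Finset ι) : ∀ ℰ : Finset E, (∀ e ∈ ℰ, 2 ≤ (ends e).card) →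
    (∀ J ⊆ I, J.Nonempty →
      (ℰ.filter (fun e => ends e ⊆ J)).card + 1 ≤ J.card + (J ∩ O).card) →
    ∃ g : ι → Option E, (∀ o e, g o = some e → o ∈ O ∧ o ∈ ends e) ∧
      ∀ J ⊆ I, J.Nonempty →
        (ℰ.filter (fun e => ends e ⊆ J ∧ ∀ o, g o ≠ some e)).card + 1 ≤ J.card := by
  induction O using Finset.induction_on with
  | empty =>
    intro ℰ _ h
    refine ⟨fun _ => none, by simp, ?_⟩
    intro J hJ hne
    simpa using h J hJ hne
  | insert v O hv ih =>
    intro ℰ hE h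
    have hins : ∀ J : Finset ι, v ∈ J → (J ∩ insert v O).card = (J ∩ O).card + 1 := by
      intro J hJ
      rw [Finset.inter_insert_of_mem hJ, Finset.card_insert_of_notMem]
      simp [hv]
    have hnin : ∀ J : Finset ι, v ∉ J → (J ∩ insert v O) = (J ∩ O) := by
      intro J hJ
      rw [Finset.inter_insert_of_notMem hJ]
    let T : Finset ι → Prop := fun J => J ⊆ I ∧ v ∈ J ∧
      (ℰ.filter (fun e => ends e ⊆ J)).card = J.card + (J ∩ O).card
    by_cases hT : ∃ J, T J
    · obtain ⟨J0, hJ0, hmin⟩ : ∃ J0, T J0 ∧ ∀ K, T K → J0.card ≤ K.card := by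
        classical
        obtain ⟨J, hJ⟩ := hT
        have hne : (I.powerset.filter T).Nonempty := ⟨J, by simp [hJ, hJ.1]⟩
        obtain ⟨J0, h0, h1⟩ := Finset.exists_min_image _ Finset.card hne
        refine ⟨J0, (Finset.mem_filter.1 h0).2, fun K hK => h1 K ?_⟩
        simp [hK, hK.1]
      have hsub : ∀ K, T K → J0 ⊆ K := by
        intro K hK
        have hTi : T (J0 ∩ K) := by
          refine ⟨Finset.inter_subset_left.trans hJ0.1, by simp [hJ0.2.1, hK.2.1], ?_⟩
          have h1 := h (J0 ∩ K) (Finset.inter_subset_left.trans hJ0.1)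
            ⟨v, by simp [hJ0.2.1, hK.2.1]⟩
          have h2 := h (J0 ∪ K) (Finset.union_subset hJ0.1 hK.1) ⟨v, by simp [hJ0.2.1]⟩
          rw [hins _ (by simp [hJ0.2.1, hK.2.1])] at h1
          rw [hins _ (by simp [hJ0.2.1])] at h2
          have h3 := Finset.card_union_add_card_inter J0 K
          have h4 := Finset.card_union_add_card_inter (J0 ∩ O) (K ∩ O)
          have h5 : (J0 ∩ O) ∪ (K ∩ O) = (J0 ∪ K) ∩ O := by
            rw [Finset.union_inter_distrib_right]
          have h6 : (J0 ∩ O) ∩ (K ∩ O) = (J0 ∩ K) ∩ O := by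
            ext x; simp
          rw [h5, h6] at h4
          have h7 := Finset.card_union_add_card_inter
            (ℰ.filter (fun e => ends e ⊆ J0)) (ℰ.filter (fun e => ends e ⊆ K))
          have h8 : (ℰ.filter (fun e => ends e ⊆ J0)) ∩ (ℰ.filter (fun e => ends e ⊆ K))
              = ℰ.filter (fun e => ends e ⊆ J0 ∩ K) := by
            ext x; simp [Finset.subset_inter_iff]; tauto
          have h9 : ((ℰ.filter (fun e => ends e ⊆ J0)) ∪ (ℰ.filter (fun e => ends e ⊆ K))).card
              ≤ (ℰ.filter (fun e => ends e ⊆ J0 ∪ K)).card := by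
            apply Finset.card_le_card
            intro x hx
            simp only [Finset.mem_union, Finset.mem_filter] at hx ⊢
            rcases hx with hx | hx
            · exact ⟨hx.1, hx.2.trans Finset.subset_union_left⟩
            · exact ⟨hx.1, hx.2.trans Finset.subset_union_right⟩
          rw [h8] at h7
          have := hJ0.2.2
          have := hK.2.2
          omega
        have := hmin _ hTi
        have h1 := Finset.eq_of_subset_of_card_le (Finset.inter_subset_left (s₁ := J0) (s₂ := K)) this
        rw [← h1]; exact Finset.inter_subset_right
      obtain ⟨e, heE, hve, heJ⟩ : ∃ e ∈ ℰ, v ∈ ends e ∧ ends e ⊆ J0 := by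
        by_contra hcon
        push Not at hcon
        have heq : ℰ.filter (fun e => ends e ⊆ J0) = ℰ.filter (fun e => ends e ⊆ J0.erase v) := by
          ext x
          simp only [Finset.mem_filter, Finset.subset_erase]
          constructor
          · rintro ⟨a, b⟩; exact ⟨a, b, fun hx => hcon x a hx b⟩
          · rintro ⟨a, b, _⟩; exact ⟨a, b⟩
        have hcard : (J0.erase v).card + 1 = J0.card := Finset.card_erase_add_one hJ0.2.1
        by_cases hemp : (J0.erase v).Nonempty
        · have := h (J0.erase v) ((Finset.erase_subset _ _).trans hJ0.1) hemp
          rw [hnin _ (by simp)] at this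
          have h2 := hJ0.2.2
          have h3 : ((J0.erase v) ∩ O).card ≤ (J0 ∩ O).card :=
            Finset.card_le_card (Finset.inter_subset_inter_right (Finset.erase_subset _ _))
          rw [heq] at h2
          omega
        · rw [Finset.not_nonempty_iff_eq_empty] at hemp
          have h2 := hJ0.2.2
          rw [heq, hemp] at h2
          rw [hemp] at hcard
          have : (ℰ.filter (fun e => ends e ⊆ (∅ : Finset ι))) = ∅ := by
            apply Finset.filter_eq_empty_iff.2
            intro x hx hx'
            have := hE x hx
            rw [Finset.subset_empty.1 hx'] at this
            simp at this
          rw [this] at h2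
          simp at h2
          simp at hcard
          omega
      obtain ⟨g, hg1, hg2⟩ := ih (ℰ.erase e) (fun x hx => hE x (Finset.mem_of_mem_erase hx)) (by
        intro J hJ hne
        have h1 := h J hJ hne
        have hle : ((ℰ.erase e).filter (fun e => ends e ⊆ J)).card ≤
            (ℰ.filter (fun e => ends e ⊆ J)).card :=
          Finset.card_le_card (Finset.filter_subset_filter _ (Finset.erase_subset _ _))
        by_cases hvJ : v ∈ J
        · rw [hins _ hvJ] at h1
          by_cases htJ : T J
          · have : ends e ⊆ J := heJ.trans (hsub J htJ)
            have h2 : (ℰ.erase e).filter (fun e => ends e ⊆ J) =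
                (ℰ.filter (fun e => ends e ⊆ J)).erase e := by
              rw [Finset.filter_erase]
            rw [h2]
            have := Finset.card_erase_add_one (s := ℰ.filter (fun e => ends e ⊆ J)) (a := e)
              (by simp [heE, this])
            omega
          · have : (ℰ.filter (fun e => ends e ⊆ J)).card ≠ J.card + (J ∩ O).card := by
              intro hc; exact htJ ⟨hJ, hvJ, hc⟩
            omega
        · rw [hnin _ hvJ] at h1
          omega)
      refine ⟨Function.update g v (some e), ?_, ?_⟩
      · intro o e' ho
        by_cases hov : o = v
        · subst hov
          simp at ho
          subst ho
          exact ⟨by simp, hve⟩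
        · rw [Function.update_of_ne hov] at ho
          exact ⟨Finset.mem_insert_of_mem (hg1 o e' ho).1, (hg1 o e' ho).2⟩
      · intro J hJ hne
        refine le_trans ?_ (hg2 J hJ hne)
        gcongr 1
        apply Finset.card_le_card
        intro x hx
        simp only [Finset.mem_filter, Finset.mem_erase] at hx ⊢
        obtain ⟨hx1, hx2, hx3⟩ := hx
        refine ⟨⟨?_, hx1⟩, hx2, ?_⟩
        · intro hxe
          exact hx3 v (by simp [hxe])
        · intro o ho
          by_cases hov : o = v
          · subst hov
            exact hv (hg1 _ _ ho).1
          · exact hx3 o (by rw [Function.update_of_ne hov]; exact ho)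
    · obtain ⟨g, hg1, hg2⟩ := ih ℰ hE (by
        intro J hJ hne
        have h1 := h J hJ hne
        by_cases hvJ : v ∈ J
        · rw [hins _ hvJ] at h1
          have : (ℰ.filter (fun e => ends e ⊆ J)).card ≠ J.card + (J ∩ O).card := by
            intro hc; exact hT ⟨J, hJ, hvJ, hc⟩
          omega
        · rw [hnin _ hvJ] at h1
          omega)
      exact ⟨g, fun o e ho => ⟨Finset.mem_insert_of_mem (hg1 o e ho).1, (hg1 o e ho).2⟩, hg2⟩

end MatchingForest

section PartitionBound
open Classical
set_option linter.unusedSectionVars false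

variable {V : Type} [Fintype V]

/-- The edges of `G` with both ends in `X`. -/
noncomputable def inE (G : SimpleGraph V) (X : Finset V) : Finset (Sym2 V) :=
  Finset.univ.filter (fun e => e ∈ G.edgeSet ∧ ∀ v ∈ e, v ∈ X)

/-- The number of edges of `G` with both ends in `X`. -/
noncomputable def ec (G : SimpleGraph V) (X : Finset V) : ℕ := (inE G X).card

/-- The weight of a vertex set. -/
noncomputable def wt (G : SimpleGraph V) (X : Finset V) : ℤ :=
  ((ec G X : ℤ) - X.card + 2) / 2

/-- Every nonempty subset spans fewer edges than vertices. -/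
def Sparse (G : SimpleGraph V) (X : Finset V) : Prop :=
  ∀ Y ⊆ X, Y.Nonempty → ec G Y + 1 ≤ Y.card

theorem mem_inE {G : SimpleGraph V} {X : Finset V} {e : Sym2 V} :
    e ∈ inE G X ↔ e ∈ G.edgeSet ∧ ∀ v ∈ e, v ∈ X := by simp [inE]

theorem inE_mono (G : SimpleGraph V) {X Y : Finset V} (h : X ⊆ Y) : inE G X ⊆ inE G Y := by
  intro e he
  rw [mem_inE] at he ⊢
  exact ⟨he.1, fun v hv => h (he.2 v hv)⟩

/-- Partitions of a finite set into nonempty parts. -/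
structure IsPart (P : Finset (Finset V)) (U : Finset V) : Prop where
  ne : ∀ J ∈ P, J.Nonempty
  sub : ∀ J ∈ P, J ⊆ U
  cov : ∀ v ∈ U, ∃ J ∈ P, v ∈ J
  uniq : ∀ J ∈ P, ∀ K ∈ P, ∀ v, v ∈ J → v ∈ K → J = K

/-- Edges inside `U` lying in no part. -/
noncomputable def crossE (G : SimpleGraph V) (P : Finset (Finset V)) (U : Finset V) :
    Finset (Sym2 V) :=
  (inE G U).filter (fun e => ∀ J ∈ P, ¬ ∀ v ∈ e, v ∈ J)

theorem IsPart.disj {P : Finset (Finset V)} {U : Finset V} (h : IsPart P U) {J K : Finset V}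
    (hJ : J ∈ P) (hK : K ∈ P) (hne : J ≠ K) : Disjoint J K := by
  rw [Finset.disjoint_left]
  intro v hv hv'
  exact hne (h.uniq J hJ K hK v hv hv')

theorem count_edges (G : SimpleGraph V) {P : Finset (Finset V)} {U : Finset V}
    (h : IsPart P U) {Q : Finset (Finset V)} (hQ : Q ⊆ P) {Y : Finset V}
    (hY : Y ⊆ Q.biUnion id) :
    ec G Y = ∑ J ∈ Q, ec G (Y ∩ J) + ((crossE G P U).filter (fun e => ∀ v ∈ e, v ∈ Y)).card := by
  have hYU : Y ⊆ U := by
    intro v hv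
    have := hY hv
    simp only [Finset.mem_biUnion, id] at this
    obtain ⟨J, hJ, hvJ⟩ := this
    exact h.sub J (hQ hJ) hvJ
  have h1 : inE G Y = (Q.biUnion fun J => inE G (Y ∩ J)) ∪
      ((crossE G P U).filter (fun e => ∀ v ∈ e, v ∈ Y)) := by
    ext e
    simp only [Finset.mem_union, Finset.mem_biUnion, mem_inE, crossE, Finset.mem_filter,
      Finset.mem_inter]
    constructor
    · rintro ⟨he, hv⟩
      by_cases hc : ∃ J ∈ P, ∀ v ∈ e, v ∈ J
      · left
        obtain ⟨J, hJ, hJe⟩ := hc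
        refine ⟨J, ?_, he, fun v hve => ⟨hv v hve, hJe v hve⟩⟩
        have hx : ∃ x, x ∈ e := by
          induction e with | _ a b => exact ⟨a, by simp⟩
        obtain ⟨x, hx⟩ := hx
        have := hY (hv x hx)
        simp only [Finset.mem_biUnion, id] at this
        obtain ⟨K, hK, hxK⟩ := this
        rw [h.uniq J hJ K (hQ hK) x (hJe x hx) hxK]
        exact hK
      · right
        push Not at hc
        refine ⟨⟨⟨he, fun v hve => hYU (hv v hve)⟩, ?_⟩, hv⟩
        intro J hJ hcon
        obtain ⟨v, hv1, hv2⟩ := hc J hJ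
        exact hv2 (hcon v hv1)
    · rintro (⟨J, hJ, he, hv⟩ | ⟨⟨⟨he, _⟩, _⟩, hv⟩)
      · exact ⟨he, fun v hve => (hv v hve).1⟩
      · exact ⟨he, hv⟩
  unfold ec
  rw [h1, Finset.card_union_of_disjoint, Finset.card_biUnion]
  · intro J hJ K hK hne
    change Disjoint (inE G (Y ∩ J)) (inE G (Y ∩ K))
    rw [Finset.disjoint_left]
    intro e he he'
    rw [mem_inE] at he he'
    have hx : ∃ x, x ∈ e := by
      induction e with | _ a b => exact ⟨a, by simp⟩
    obtain ⟨x, hx⟩ := hx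
    have a1 := he.2 x hx
    have a2 := he'.2 x hx
    simp only [Finset.mem_inter] at a1 a2
    exact hne (h.uniq J (hQ hJ) K (hQ hK) x a1.2 a2.2)
  · rw [Finset.disjoint_left]
    intro e he he'
    simp only [Finset.mem_biUnion, mem_inE, crossE, Finset.mem_filter, Finset.mem_inter] at he he'
    obtain ⟨J, hJ, _, hv⟩ := he
    exact he'.1.2 J (hQ hJ) (fun v hve => (hv v hve).2)

theorem card_parts {P : Finset (Finset V)} {U : Finset V}
    (h : IsPart P U) {Q : Finset (Finset V)} (hQ : Q ⊆ P) {Y : Finset V}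
    (hY : Y ⊆ Q.biUnion id) : Y.card = ∑ J ∈ Q, (Y ∩ J).card := by
  have : Y = Q.biUnion (fun J => Y ∩ J) := by
    ext v
    simp only [Finset.mem_biUnion, Finset.mem_inter]
    constructor
    · intro hv
      have := hY hv
      simp only [Finset.mem_biUnion, id] at this
      obtain ⟨J, hJ, hvJ⟩ := this
      exact ⟨J, hJ, hv, hvJ⟩
    · rintro ⟨J, _, hv, _⟩; exact hv
  conv_lhs => rw [this]
  rw [Finset.card_biUnion]
  intro J hJ K hK hne
  exact (h.disj (hQ hJ) (hQ hK) hne).mono Finset.inter_subset_right Finset.inter_subset_right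

theorem IsPart.replace {P : Finset (Finset V)} {U : Finset V}
    (h : IsPart P U) {J Q : Finset (Finset V)} (hJ : J ⊆ P) (hQ : IsPart Q (J.biUnion id)) :
    IsPart ((P \ J) ∪ Q) U ∧ Disjoint (P \ J) Q := by
  have key : ∀ K ∈ P \ J, ∀ L ∈ Q, ∀ v, v ∈ K → v ∈ L → False := by
    intro K hK L hL v hvK hvL
    have := hQ.sub L hL hvL
    simp only [Finset.mem_biUnion, id] at this
    obtain ⟨M, hM, hvM⟩ := this
    rw [Finset.mem_sdiff] at hK
    have := h.uniq K hK.1 M (hJ hM) v hvK hvM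
    exact hK.2 (this ▸ hM)
  refine ⟨⟨?_, ?_, ?_, ?_⟩, ?_⟩
  · intro K hK
    rcases Finset.mem_union.1 hK with hK | hK
    · exact h.ne K (Finset.mem_sdiff.1 hK).1
    · exact hQ.ne K hK
  · intro K hK
    rcases Finset.mem_union.1 hK with hK | hK
    · exact h.sub K (Finset.mem_sdiff.1 hK).1
    · refine (hQ.sub K hK).trans ?_
      intro v hv
      simp only [Finset.mem_biUnion, id] at hv
      obtain ⟨M, hM, hvM⟩ := hv
      exact h.sub M (hJ hM) hvM
  · intro v hv
    obtain ⟨K, hK, hvK⟩ := h.cov v hv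
    by_cases hKJ : K ∈ J
    · obtain ⟨L, hL, hvL⟩ := hQ.cov v (by simp only [Finset.mem_biUnion, id]; exact ⟨K, hKJ, hvK⟩)
      exact ⟨L, Finset.mem_union_right _ hL, hvL⟩
    · exact ⟨K, Finset.mem_union_left _ (Finset.mem_sdiff.2 ⟨hK, hKJ⟩), hvK⟩
  · intro K hK L hL v hvK hvL
    rcases Finset.mem_union.1 hK with hK | hK <;> rcases Finset.mem_union.1 hL with hL | hL
    · exact h.uniq K (Finset.mem_sdiff.1 hK).1 L (Finset.mem_sdiff.1 hL).1 v hvK hvL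
    · exact (key K hK L hL v hvK hvL).elim
    · exact (key L hL K hK v hvL hvK).elim
    · exact hQ.uniq K hK L hL v hvK hvL
  · rw [Finset.disjoint_left]
    intro K hK hK'
    obtain ⟨v, hv⟩ := hQ.ne K hK'
    exact key K hK K hK' v hv hv

/-- Optimal partitions. -/
def Opt (G : SimpleGraph V) (P : Finset (Finset V)) (U : Finset V) : Prop :=
  IsPart P U ∧ ∀ Q, IsPart Q U →
    (∑ J ∈ Q, wt G J < ∑ J ∈ P, wt G J) ∨
      (∑ J ∈ Q, wt G J = ∑ J ∈ P, wt G J ∧ Q.card ≤ P.card)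

theorem exists_opt (G : SimpleGraph V) (U : Finset V) : ∃ P, Opt G P U := by
  have hne : (Finset.univ.filter (fun P : Finset (Finset V) => IsPart P U)).Nonempty := by
    refine ⟨U.image (fun v => {v}), ?_⟩
    simp only [Finset.mem_filter, Finset.mem_univ, true_and]
    refine ⟨?_, ?_, ?_, ?_⟩
    · intro J hJ
      obtain ⟨v, _, rfl⟩ := Finset.mem_image.1 hJ
      exact ⟨v, by simp⟩
    · intro J hJ
      obtain ⟨v, hv, rfl⟩ := Finset.mem_image.1 hJ
      simpa using hv
    · intro v hv
      exact ⟨{v}, Finset.mem_image_of_mem _ hv, by simp⟩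
    · intro J hJ K hK v hvJ hvK
      obtain ⟨a, _, rfl⟩ := Finset.mem_image.1 hJ
      obtain ⟨b, _, rfl⟩ := Finset.mem_image.1 hK
      simp at hvJ hvK
      rw [← hvJ, ← hvK]
  obtain ⟨P, hP, hmax⟩ := Finset.exists_max_image _
    (fun P : Finset (Finset V) => (toLex (∑ J ∈ P, wt G J, P.card) : ℤ ×ₗ ℕ)) hne
  refine ⟨P, (Finset.mem_filter.1 hP).2, fun Q hQ => ?_⟩
  have := hmax Q (by simp [hQ])
  rw [Prod.Lex.toLex_le_toLex] at this
  exact this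

theorem Opt.local {G : SimpleGraph V} {P : Finset (Finset V)} {U : Finset V}
    (h : Opt G P U) {J Q : Finset (Finset V)} (hJ : J ⊆ P) (hQ : IsPart Q (J.biUnion id)) :
    (∑ K ∈ Q, wt G K < ∑ K ∈ J, wt G K) ∨
      (∑ K ∈ Q, wt G K = ∑ K ∈ J, wt G K ∧ Q.card ≤ J.card) := by
  obtain ⟨h1, h2⟩ := h.1.replace hJ hQ
  have h3 := h.2 _ h1
  rw [Finset.sum_union h2, Finset.card_union_of_disjoint h2] at h3
  have h4 := Finset.sum_sdiff (f := fun K => wt G K) hJ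
  have h5 := Finset.card_sdiff_add_card_eq_card hJ
  rcases h3 with h3 | ⟨h3, h3'⟩
  · left; linarith
  · right; constructor
    · linarith
    · omega

/-- splitting a part strictly decreases the weight -/
theorem Opt.split {G : SimpleGraph V} {P : Finset (Finset V)} {U : Finset V}
    (h : Opt G P U) {C : Finset V} (hC : C ∈ P) {Q : Finset (Finset V)} (hQ : IsPart Q C)
    (hcard : 2 ≤ Q.card) : ∑ K ∈ Q, wt G K < wt G C := by
  have := h.local (J := {C}) (Q := Q) (by simpa using hC) (by simpa using hQ)
  simp at this
  rcases this with h1 | ⟨_, h1⟩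
  · exact h1
  · omega

theorem Opt.merge {G : SimpleGraph V} {P : Finset (Finset V)} {U : Finset V}
    (h : Opt G P U) {J : Finset (Finset V)} (hJ : J ⊆ P) (hne : J.Nonempty) :
    wt G (J.biUnion id) ≤ ∑ K ∈ J, wt G K := by
  have hp : IsPart {J.biUnion id} (J.biUnion id) := by
    refine ⟨?_, ?_, ?_, ?_⟩
    · intro K hK
      obtain ⟨L, hL⟩ := hne
      obtain ⟨v, hv⟩ := h.1.ne L (hJ hL)
      rw [Finset.mem_singleton.1 hK]
      exact ⟨v, by simp only [Finset.mem_biUnion, id]; exact ⟨L, hL, hv⟩⟩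
    · intro K hK; rw [Finset.mem_singleton.1 hK]
    · intro v hv; exact ⟨_, Finset.mem_singleton_self _, hv⟩
    · intro K hK L hL _ _ _
      rw [Finset.mem_singleton.1 hK, Finset.mem_singleton.1 hL]
  have := h.local hJ hp
  rw [Finset.sum_singleton] at this
  rcases this with h1 | ⟨h1, _⟩
  · exact h1.le
  · exact h1.le

theorem ec_singleton (G : SimpleGraph V) (x : V) : ec G {x} = 0 := by
  unfold ec
  rw [Finset.card_eq_zero, Finset.eq_empty_iff_forall_notMem]
  intro e he
  rw [mem_inE] at he
  induction e with
  | _ a b =>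
    have h1 := he.2 a (by simp)
    have h2 := he.2 b (by simp)
    simp at h1 h2
    have := he.1
    rw [SimpleGraph.mem_edgeSet, h1, h2] at this
    exact G.loopless.irrefl _ this

theorem ec_empty (G : SimpleGraph V) : ec G ∅ = 0 := by
  unfold ec
  rw [Finset.card_eq_zero, Finset.eq_empty_iff_forall_notMem]
  intro e he
  rw [mem_inE] at he
  induction e with
  | _ a b => simpa using he.2 a (by simp)

theorem wt_singleton (G : SimpleGraph V) (x : V) : wt G {x} = 0 := by
  unfold wt; rw [ec_singleton]; simp

theorem Opt.cross {G : SimpleGraph V} {P : Finset (Finset V)} {U : Finset V}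
    (h : Opt G P U) {J : Finset (Finset V)} (hJ : J ⊆ P) (hne : J.Nonempty) :
    ((crossE G P U).filter (fun e => ∀ v ∈ e, v ∈ J.biUnion id)).card + 1 ≤
      J.card + (J ∩ P.filter (fun C => ¬ (2 : ℤ) ∣ ((ec G C : ℤ) - C.card + 1))).card := by
  have h1 := h.merge hJ hne
  have h2 := count_edges G h.1 hJ (Finset.Subset.refl (J.biUnion id))
  have h3 := card_parts h.1 hJ (Finset.Subset.refl (J.biUnion id))
  have h4 : ∀ K ∈ J, J.biUnion id ∩ K = K := by
    intro K hK
    exact Finset.inter_eq_right.2 (Finset.subset_biUnion_of_mem id hK)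
  rw [Finset.sum_congr rfl (fun K hK => by rw [h4 K hK])] at h2 h3
  have h5 : ∀ K ∈ J, 2 * wt G K = ((ec G K : ℤ) - K.card + 1) +
      (if ¬ (2 : ℤ) ∣ ((ec G K : ℤ) - K.card + 1) then 1 else 0) := by
    intro K _
    unfold wt
    split_ifs <;> omega
  have h6 : 2 * ∑ K ∈ J, wt G K = ∑ K ∈ J, (ec G K : ℤ) - ∑ K ∈ J, (K.card : ℤ) + J.card +
      (J ∩ P.filter (fun C => ¬ (2 : ℤ) ∣ ((ec G C : ℤ) - C.card + 1))).card := by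
    rw [Finset.mul_sum, Finset.sum_congr rfl h5, Finset.sum_add_distrib, Finset.sum_add_distrib,
      Finset.sum_sub_distrib]
    simp only [Finset.sum_const, nsmul_eq_mul, mul_one]
    congr 1
    rw [← Finset.sum_filter, Finset.sum_const, nsmul_eq_mul, mul_one]
    congr 2
    ext K
    simp only [Finset.mem_filter, Finset.mem_inter]
    constructor
    · rintro ⟨a, b⟩; exact ⟨a, hJ a, b⟩
    · rintro ⟨a, _, b⟩; exact ⟨a, b⟩
  have h7 : 2 * wt G (J.biUnion id) ≥ (ec G (J.biUnion id) : ℤ) - (J.biUnion id).card + 1 := by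
    unfold wt; omega
  rw [h2, h3] at h7
  push_cast at h7
  have : (((crossE G P U).filter (fun e => ∀ v ∈ e, v ∈ J.biUnion id)).card : ℤ) + 1 ≤
      J.card + (J ∩ P.filter (fun C => ¬ (2 : ℤ) ∣ ((ec G C : ℤ) - C.card + 1))).card := by
    linarith
  exact_mod_cast this

theorem theorem_N (G : SimpleGraph V) : ∀ n : ℕ, ∀ U : Finset V, U.card = n →
    ∀ P, Opt G P U → ∃ S ⊆ U, (S.card : ℤ) ≤ ∑ J ∈ P, wt G J ∧ Sparse G (U \ S) := by
  intro n
  induction n using Nat.strong_induction_on with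
  | _ n ih =>
  intro U hU P hP
  have hA : ∀ C ∈ P, 2 ≤ C.card → ∀ x ∈ C, ∃ S ⊆ C, x ∈ S ∧ (S.card : ℤ) ≤ wt G C ∧
      Sparse G (C \ S) := by
    intro C hC hC2 x hx
    obtain ⟨Q, hQ⟩ := exists_opt G (C.erase x)
    have hlt : (C.erase x).card < n := by
      have := Finset.card_erase_add_one hx
      have := Finset.card_le_card (hP.1.sub C hC)
      omega
    obtain ⟨S, hS, hSc, hSs⟩ := ih _ hlt (C.erase x) rfl Q hQ
    have hxQ : {x} ∉ Q := by
      intro hc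
      have := hQ.1.sub _ hc (Finset.mem_singleton_self x)
      simp at this
    have hpart : IsPart (insert {x} Q) C := by
      refine ⟨?_, ?_, ?_, ?_⟩
      · intro K hK
        rcases Finset.mem_insert.1 hK with rfl | hK
        · exact ⟨x, by simp⟩
        · exact hQ.1.ne K hK
      · intro K hK
        rcases Finset.mem_insert.1 hK with rfl | hK
        · simpa using hx
        · exact (hQ.1.sub K hK).trans (Finset.erase_subset _ _)
      · intro v hv
        by_cases hvx : v = x
        · exact ⟨{x}, by simp, by simp [hvx]⟩
        · obtain ⟨K, hK, hvK⟩ := hQ.1.cov v (Finset.mem_erase.2 ⟨hvx, hv⟩)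
          exact ⟨K, Finset.mem_insert_of_mem hK, hvK⟩
      · intro K hK L hL v hvK hvL
        rcases Finset.mem_insert.1 hK with rfl | hK' <;> rcases Finset.mem_insert.1 hL with rfl | hL'
        · rfl
        · rw [Finset.mem_singleton] at hvK
          subst hvK
          exact absurd (hQ.1.sub L hL' hvL) (by simp)
        · rw [Finset.mem_singleton] at hvL
          subst hvL
          exact absurd (hQ.1.sub K hK' hvK) (by simp)
        · exact hQ.1.uniq K hK' L hL' v hvK hvL
    have hQ1 : 1 ≤ Q.card := by
      have : (C.erase x).Nonempty := by
        rw [← Finset.card_pos]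
        have := Finset.card_erase_add_one hx
        omega
      obtain ⟨y, hy⟩ := this
      obtain ⟨K, hK, _⟩ := hQ.1.cov y hy
      exact Finset.card_pos.2 ⟨K, hK⟩
    have hlt2 := hP.split hC hpart (by rw [Finset.card_insert_of_notMem hxQ]; omega)
    rw [Finset.sum_insert hxQ, wt_singleton, zero_add] at hlt2
    refine ⟨insert x S, ?_, by simp, ?_, ?_⟩
    · intro v hv
      rcases Finset.mem_insert.1 hv with rfl | hv
      · exact hx
      · exact Finset.mem_of_mem_erase (hS hv)
    · have := Finset.card_insert_le x S
      have : ((insert x S).card : ℤ) ≤ S.card + 1 := by exact_mod_cast this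
      linarith
    · intro Y hY hYne
      apply hSs Y _ hYne
      intro v hv
      have := hY hv
      simp only [Finset.mem_sdiff, Finset.mem_insert, not_or, Finset.mem_erase] at this ⊢
      tauto
  obtain ⟨g, hg1, hg2⟩ := matching_forest
    (fun e : Sym2 V => P.filter (fun J => ∃ v ∈ e, v ∈ J)) P
    (P.filter (fun C => ¬ (2 : ℤ) ∣ ((ec G C : ℤ) - C.card + 1))) (crossE G P U) (by
      intro e he
      simp only [crossE, Finset.mem_filter, mem_inE] at he
      induction e with
      | _ a b =>
        obtain ⟨A, hA1, haA⟩ := hP.1.cov a (he.1.2 a (by simp))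
        obtain ⟨B, hB1, hbB⟩ := hP.1.cov b (he.1.2 b (by simp))
        have hAB : A ≠ B := by
          rintro rfl
          apply he.2 A hA1
          intro v hv
          rcases Sym2.mem_iff.1 hv with rfl | rfl <;> assumption
        have : ({A, B} : Finset (Finset V)) ⊆ P.filter (fun J => ∃ v ∈ s(a, b), v ∈ J) := by
          intro K hK
          simp only [Finset.mem_insert, Finset.mem_singleton] at hK
          rcases hK with rfl | rfl
          · exact Finset.mem_filter.2 ⟨hA1, a, by simp, haA⟩
          · exact Finset.mem_filter.2 ⟨hB1, b, by simp, hbB⟩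
        have h2 := Finset.card_le_card this
        rw [Finset.card_pair hAB] at h2
        exact h2) (by
      intro J hJ hJne
      refine le_trans ?_ (hP.cross hJ hJne)
      gcongr 1
      apply Finset.card_le_card
      intro e he
      simp only [Finset.mem_filter] at he ⊢
      refine ⟨he.1, fun v hv => ?_⟩
      have hvU : v ∈ U := by
        have := he.1
        simp only [crossE, Finset.mem_filter, mem_inE] at this
        exact this.1.2 v hv
      obtain ⟨K, hK, hvK⟩ := hP.1.cov v hvU
      simp only [Finset.mem_biUnion, id]
      exact ⟨K, he.2 (Finset.mem_filter.2 ⟨hK, v, hv, hvK⟩), hvK⟩)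
  have hB : ∀ C ∈ P, ∃ S ⊆ C, (S.card : ℤ) ≤ wt G C ∧ Sparse G (C \ S) ∧
      ∀ e, g C = some e → ∃ x ∈ S, x ∈ e := by
    intro C hC
    by_cases hC2 : 2 ≤ C.card
    · cases hgC : g C with
      | none =>
        obtain ⟨x, hx⟩ := hP.1.ne C hC
        obtain ⟨S, h1, _, h3, h4⟩ := hA C hC hC2 x hx
        exact ⟨S, h1, h3, h4, by simp⟩
      | some e =>
        have := (hg1 C e hgC).2
        simp only [Finset.mem_filter] at this
        obtain ⟨_, x, hxe, hx⟩ := this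
        obtain ⟨S, h1, h2, h3, h4⟩ := hA C hC hC2 x hx
        refine ⟨S, h1, h3, h4, ?_⟩
        rintro e' he'
        simp only [Option.some.injEq] at he'
        subst he'
        exact ⟨x, h2, hxe⟩
    · obtain ⟨x, hx⟩ := hP.1.ne C hC
      have hCx : C = {x} := by
        have : C.card ≤ 1 := by omega
        rw [Finset.card_le_one] at this
        ext y
        simp only [Finset.mem_singleton]
        exact ⟨fun hy => this y hy x hx, fun hy => hy ▸ hx⟩
      refine ⟨∅, by simp, ?_, ?_, ?_⟩
      · rw [hCx, wt_singleton]; simp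
      · intro Y hY hYne
        have : Y = {x} := by
          apply Finset.Subset.antisymm
          · rw [← hCx]; exact hY.trans Finset.sdiff_subset
          · obtain ⟨y, hy⟩ := hYne
            have := (hY.trans Finset.sdiff_subset) hy
            rw [hCx, Finset.mem_singleton] at this
            simpa [this] using hy
        rw [this, ec_singleton]; simp
      · intro e he
        have := (hg1 C e he).1
        simp only [Finset.mem_filter] at this
        rw [hCx, ec_singleton] at this
        simp at this
  choose! Sf hSf1 hSf2 hSf3 hSf4 using hB
  refine ⟨P.biUnion Sf, ?_, ?_, ?_⟩
  · intro v hv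
    obtain ⟨C, hC, hvC⟩ := Finset.mem_biUnion.1 hv
    exact hP.1.sub C hC (hSf1 C hC hvC)
  · have h1 : ((P.biUnion Sf).card : ℤ) ≤ ∑ C ∈ P, ((Sf C).card : ℤ) := by
      exact_mod_cast Finset.card_biUnion_le
    exact h1.trans (Finset.sum_le_sum hSf2)
  · intro Y hY hYne
    set J := P.filter (fun C => (Y ∩ C).Nonempty) with hJdef
    have hJP : J ⊆ P := Finset.filter_subset _ _
    have hYJ : Y ⊆ J.biUnion id := by
      intro v hv
      have hvU := (Finset.mem_sdiff.1 (hY hv)).1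
      obtain ⟨C, hC, hvC⟩ := hP.1.cov v hvU
      simp only [Finset.mem_biUnion, id]
      exact ⟨C, Finset.mem_filter.2 ⟨hC, v, Finset.mem_inter.2 ⟨hv, hvC⟩⟩, hvC⟩
    have hJne : J.Nonempty := by
      obtain ⟨y, hy⟩ := hYne
      have := hYJ hy
      simp only [Finset.mem_biUnion, id] at this
      obtain ⟨C, hC, _⟩ := this
      exact ⟨C, hC⟩
    rw [count_edges G hP.1 hJP hYJ, card_parts hP.1 hJP hYJ]
    have h1 : ∑ C ∈ J, (ec G (Y ∩ C) + 1) ≤ ∑ C ∈ J, (Y ∩ C).card := by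
      apply Finset.sum_le_sum
      intro C hC
      have hC' := Finset.mem_filter.1 hC
      apply hSf3 C hC'.1 _ _ hC'.2
      intro v hv
      rw [Finset.mem_inter] at hv
      refine Finset.mem_sdiff.2 ⟨hv.2, fun hvS => ?_⟩
      exact (Finset.mem_sdiff.1 (hY hv.1)).2 (Finset.mem_biUnion.2 ⟨C, hC'.1, hvS⟩)
    rw [Finset.sum_add_distrib] at h1
    simp only [Finset.sum_const, smul_eq_mul, mul_one] at h1
    have h2 := hg2 J hJP hJne
    have h3 : ((crossE G P U).filter (fun e => ∀ v ∈ e, v ∈ Y)).card + 1 ≤ J.card := by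
      refine le_trans ?_ h2
      gcongr 1
      apply Finset.card_le_card
      intro e he
      simp only [Finset.mem_filter] at he ⊢
      refine ⟨he.1, ?_, ?_⟩
      · intro C hC
        obtain ⟨hC, v, hve, hvC⟩ := Finset.mem_filter.1 hC
        exact Finset.mem_filter.2 ⟨hC, v, Finset.mem_inter.2 ⟨he.2 v hve, hvC⟩⟩
      · intro o ho
        have hoP := (Finset.mem_filter.1 (hg1 o e ho).1).1
        obtain ⟨x, hxS, hxe⟩ := hSf4 o hoP e ho
        exact (Finset.mem_sdiff.1 (hY (he.2 x hxe))).2 (Finset.mem_biUnion.2 ⟨o, hoP, hxS⟩)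
    omega

end PartitionBound

section Assembly
open Classical
set_option linter.unusedSectionVars false

variable {V : Type} [Fintype V]

theorem sparse_fvs {G : SimpleGraph V} {S : Finset V} (h : Sparse G (Finset.univ \ S)) :
    IsFVS G (S : Set V) := by
  intro u c0 hc0
  have hinj : Function.Injective (Embedding.induce (G := G) ((S : Set V)ᶜ)).toHom :=
    (Embedding.induce (G := G) ((S : Set V)ᶜ)).injective
  have hc := hc0.map hinj
  set c := c0.map (Embedding.induce (G := G) ((S : Set V)ᶜ)).toHom with hcdef
  have hsup : ∀ v ∈ c.support, v ∉ S := by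
    intro v hv
    rw [hcdef, Walk.support_map, List.mem_map] at hv
    obtain ⟨w, _, rfl⟩ := hv
    exact fun hc => w.2 (Finset.mem_coe.2 hc)
  set Y := c.support.tail.toFinset with hY
  have hmem : ∀ v, v ∈ c.support → v ∈ Y := by
    intro v hv
    rw [hY, List.mem_toFinset]
    rcases (Walk.mem_support_iff c).1 hv with rfl | h1
    · exact c.end_mem_tail_support hc.not_nil
    · exact h1
  have hYc : Y.card = c.length := by
    rw [hY, List.toFinset_card_of_nodup hc.support_nodup]
    have := c.length_support
    rw [List.length_tail]
    omega
  have hE : c.edges.toFinset ⊆ inE G Y := by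
    intro e he
    rw [List.mem_toFinset] at he
    rw [mem_inE]
    refine ⟨c.edges_subset_edgeSet he, fun v hv => hmem v ?_⟩
    exact c.mem_support_of_mem_edges he hv
  have hEc := Finset.card_le_card hE
  rw [List.toFinset_card_of_nodup hc.isCircuit.isTrail.edges_nodup, Walk.length_edges] at hEc
  have hYS : Y ⊆ Finset.univ \ S := by
    intro v hv
    rw [hY, List.mem_toFinset] at hv
    simp only [Finset.mem_sdiff, Finset.mem_univ, true_and]
    exact hsup v (List.mem_of_mem_tail hv)
  have hYne : Y.Nonempty := ⟨_, hmem _ c.start_mem_support⟩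
  have := h Y hYS hYne
  unfold ec at this
  omega

theorem fvs_le_of_sparse {G : SimpleGraph V} {S : Finset V} (h : Sparse G (Finset.univ \ S)) :
    fvs G ≤ S.card := by
  apply Nat.sInf_le
  exact ⟨S, sparse_fvs h, by simp⟩

theorem edgeSet_ncard (G : SimpleGraph V) : G.edgeSet.ncard = ec G Finset.univ := by
  unfold ec
  rw [← Set.ncard_coe_finset]
  congr 1
  ext e
  simp [mem_inE]

theorem cross_ge {G : SimpleGraph V} (hG : G.Connected) {P : Finset (Finset V)}
    (hP : IsPart P Finset.univ) : P.card ≤ (crossE G P Finset.univ).card + 1 := by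
  have key : ∀ n, 1 ≤ n → n ≤ P.card → ∃ J ⊆ P, J.card = n ∧
      n ≤ ((crossE G P Finset.univ).filter (fun e => ∀ v ∈ e, v ∈ J.biUnion id)).card + 1 := by
    intro n hn
    induction n, hn using Nat.le_induction with
    | base =>
      intro h1
      obtain ⟨C, hC⟩ := Finset.card_pos.1 h1
      exact ⟨{C}, by simpa using hC, by simp, by omega⟩
    | succ n hn ih =>
      intro h1
      obtain ⟨J, hJ, hJc, hJn⟩ := ih (by omega)
      obtain ⟨L, hL⟩ : J.Nonempty := Finset.card_pos.1 (by omega)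
      obtain ⟨u, hu⟩ := hP.ne L (hJ hL)
      obtain ⟨K, hK, hKJ⟩ : ∃ K ∈ P, K ∉ J := by
        by_contra hcon
        push Not at hcon
        have := Finset.card_le_card hcon
        omega
      obtain ⟨v, hv⟩ := hP.ne K hK
      obtain ⟨p⟩ := hG.preconnected u v
      obtain ⟨d, _, hd1, hd2⟩ := p.exists_boundary_dart (((J.biUnion id : Finset V)) : Set V)
        (by simp only [Finset.mem_coe, Finset.mem_biUnion, id]; exact ⟨L, hL, hu⟩)
        (by
          simp only [Finset.mem_coe, Finset.mem_biUnion, id]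
          rintro ⟨M, hM, hvM⟩
          have := hP.uniq K hK M (hJ hM) v hv hvM
          exact hKJ (this ▸ hM))
      simp only [Finset.mem_coe, Finset.mem_biUnion, id] at hd1 hd2
      push Not at hd2
      obtain ⟨A, hA, hdA⟩ := hd1
      obtain ⟨B, hB, hdB⟩ := hP.cov d.snd (Finset.mem_univ _)
      have hBJ : B ∉ J := fun hBJ => hd2 B hBJ hdB
      refine ⟨insert B J, ?_, by rw [Finset.card_insert_of_notMem hBJ, hJc], ?_⟩
      · intro M hM
        rcases Finset.mem_insert.1 hM with rfl | hM
        · exact hB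
        · exact hJ hM
      · have hnew : s(d.fst, d.snd) ∉
            (crossE G P Finset.univ).filter (fun e => ∀ v ∈ e, v ∈ J.biUnion id) := by
          intro hc
          have := (Finset.mem_filter.1 hc).2 d.snd (by simp)
          simp only [Finset.mem_biUnion, id] at this
          obtain ⟨M, hM, hdM⟩ := this
          exact hd2 M hM hdM
        have hsub : insert s(d.fst, d.snd)
            ((crossE G P Finset.univ).filter (fun e => ∀ v ∈ e, v ∈ J.biUnion id)) ⊆
            (crossE G P Finset.univ).filter (fun e => ∀ v ∈ e, v ∈ (insert B J).biUnion id) := by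
          intro e he
          rcases Finset.mem_insert.1 he with rfl | he
          · rw [Finset.mem_filter]
            refine ⟨?_, ?_⟩
            · simp only [crossE, Finset.mem_filter, mem_inE]
              refine ⟨⟨d.adj, by simp⟩, ?_⟩
              intro M hM hcon
              have e1 := hP.uniq M hM A (hJ hA) d.fst (hcon _ (by simp)) hdA
              have e2 := hP.uniq M hM B hB d.snd (hcon _ (by simp)) hdB
              exact hBJ (e2 ▸ e1 ▸ hA)
            · intro v hv
              simp only [Finset.mem_biUnion, id]
              rcases Sym2.mem_iff.1 hv with rfl | rfl
              · exact ⟨A, Finset.mem_insert_of_mem hA, hdA⟩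
              · exact ⟨B, Finset.mem_insert_self _ _, hdB⟩
          · rw [Finset.mem_filter] at he ⊢
            refine ⟨he.1, fun v hv => ?_⟩
            have := he.2 v hv
            simp only [Finset.mem_biUnion, id] at this ⊢
            obtain ⟨M, hM, hvM⟩ := this
            exact ⟨M, Finset.mem_insert_of_mem hM, hvM⟩
        have := Finset.card_le_card hsub
        rw [Finset.card_insert_of_notMem hnew] at this
        omega
  by_cases h0 : P.card = 0
  · omega
  obtain ⟨J, _, _, h2⟩ := key P.card (by omega) le_rfl
  refine h2.trans ?_
  gcongr 1
  exact Finset.card_le_card (Finset.filter_subset _ _)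

theorem cross_bridge {G : SimpleGraph V} (hG : G.Connected) {P : Finset (Finset V)}
    (hP : IsPart P Finset.univ) (hc : (crossE G P Finset.univ).card + 1 ≤ P.card)
    {e : Sym2 V} (he : e ∈ crossE G P Finset.univ) : G.IsBridge e := by
  by_contra hnb
  induction e with
  | _ a b =>
    have h1 := hG.connected_delete_edge_of_not_isBridge hnb
    have h2 := cross_ge h1 hP
    have h3 : crossE (G.deleteEdges {s(a, b)}) P Finset.univ ⊆
        (crossE G P Finset.univ).erase s(a, b) := by
      intro e he
      simp only [crossE, Finset.mem_filter, mem_inE, Finset.mem_erase, edgeSet_deleteEdges,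
        Set.mem_sdiff, Set.mem_singleton_iff] at he ⊢
      tauto
    have h4 := Finset.card_le_card h3
    have h5 := Finset.card_erase_add_one he
    omega

theorem main_bound (G : SimpleGraph V) {P : Finset (Finset V)} (hP : Opt G P Finset.univ) :
    5 * (fvs G : ℤ) ≤ G.edgeSet.ncard + ∑ J ∈ P, (5 * wt G J - ec G J)
      - (crossE G P Finset.univ).card := by
  obtain ⟨S, _, hS, hSp⟩ := theorem_N G _ Finset.univ rfl P hP
  have h1 := fvs_le_of_sparse hSp
  have hcov : Finset.univ ⊆ P.biUnion id := by
    intro v _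
    obtain ⟨J, hJ, hv⟩ := hP.1.cov v (Finset.mem_univ v)
    simp only [Finset.mem_biUnion, id]
    exact ⟨J, hJ, hv⟩
  have h2 := count_edges G hP.1 (Finset.Subset.refl P) hcov
  rw [edgeSet_ncard, h2, Finset.sum_sub_distrib, ← Finset.mul_sum]
  simp only [Finset.univ_inter, Finset.mem_univ, implies_true, Finset.filter_true]
  push_cast
  have : (fvs G : ℤ) ≤ S.card := by exact_mod_cast h1
  linarith

/-- No triangles and no 4-cycles. -/
structure G5 {V : Type} (K : SimpleGraph V) : Prop where
  tri : ∀ a b c, K.Adj a b → K.Adj b c → K.Adj c a → False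
  quad : ∀ a b c d, K.Adj a b → K.Adj b c → K.Adj c d → K.Adj d a → a ≠ c → b ≠ d → False

theorem g5_of_egirth {V : Type} {K : SimpleGraph V} (h : 5 ≤ K.egirth) : G5 K := by
  rw [le_egirth] at h
  constructor
  · intro a b c hab hbc hca
    have := h a (.cons hab (.cons hbc (.cons hca .nil))) (by
      have := hab.ne; have := hbc.ne; have := hca.ne
      simp [Walk.isCycle_def, Walk.isTrail_def]
      grind)
    simp at this
    have h' : (5 : ℕ∞) ≤ ((3 : ℕ) : ℕ∞) := by convert this; norm_num
    have : (5 : ℕ) ≤ 3 := by exact_mod_cast h'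
    omega
  · intro a b c d hab hbc hcd hda hac hbd
    have := h a (.cons hab (.cons hbc (.cons hcd (.cons hda .nil)))) (by
      have := hab.ne; have := hbc.ne; have := hcd.ne; have := hda.ne
      simp [Walk.isCycle_def, Walk.isTrail_def]
      grind)
    simp at this
    have h' : (5 : ℕ∞) ≤ ((4 : ℕ) : ℕ∞) := by convert this; norm_num
    have : (5 : ℕ) ≤ 4 := by exact_mod_cast h'
    omega

end Assembly

section Degrees
open Classical
set_option linter.unusedSectionVars false

variable {V : Type} [Fintype V]

/-- Neighbours of `v` in `X`. -/
noncomputable def nb (K : SimpleGraph V) (X : Finset V) (v : V) : Finset V :=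
  X.filter (fun u => K.Adj v u)

/-- Degree of `v` into `X`. -/
noncomputable def dg (K : SimpleGraph V) (X : Finset V) (v : V) : ℕ := (nb K X v).card

theorem mem_nb {K : SimpleGraph V} {X : Finset V} {u v : V} :
    u ∈ nb K X v ↔ u ∈ X ∧ K.Adj v u := by simp [nb]

theorem nb_mono (K : SimpleGraph V) {X Y : Finset V} (h : X ⊆ Y) (v : V) :
    nb K X v ⊆ nb K Y v := by
  intro u hu
  rw [mem_nb] at hu ⊢
  exact ⟨h hu.1, hu.2⟩

theorem dg_mono (K : SimpleGraph V) {X Y : Finset V} (h : X ⊆ Y) (v : V) :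
    dg K X v ≤ dg K Y v := Finset.card_le_card (nb_mono K h v)

theorem dg_union (K : SimpleGraph V) {X Y : Finset V} (h : Disjoint X Y) (v : V) :
    dg K (X ∪ Y) v = dg K X v + dg K Y v := by
  unfold dg nb
  rw [Finset.filter_union, Finset.card_union_of_disjoint (Finset.disjoint_filter_filter h)]

theorem sum_dg_comm (K : SimpleGraph V) (X Y : Finset V) :
    ∑ v ∈ X, dg K Y v = ∑ u ∈ Y, dg K X u := by
  have := Finset.sum_card_bipartiteAbove_eq_sum_card_bipartiteBelow (s := X) (t := Y)
    (fun v u => K.Adj v u)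
  unfold dg nb
  simp only [Finset.bipartiteAbove, Finset.bipartiteBelow] at this
  rw [this]
  simp only [K.adj_comm]

/-- The graph of edges inside `X`. -/
def restr (G : SimpleGraph V) (X : Finset V) : SimpleGraph V where
  Adj u v := G.Adj u v ∧ u ∈ X ∧ v ∈ X
  symm := ⟨fun _ _ h => ⟨h.1.symm, h.2.2, h.2.1⟩⟩
  loopless := ⟨fun _ h => G.loopless.irrefl _ h.1⟩

theorem restr_adj {G : SimpleGraph V} {X : Finset V} {u v : V} :
    (restr G X).Adj u v ↔ G.Adj u v ∧ u ∈ X ∧ v ∈ X := Iff.rfl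

theorem handshake (G : SimpleGraph V) (X : Finset V) : ∑ v ∈ X, dg G X v = 2 * ec G X := by
  have h := (restr G X).sum_degrees_eq_twice_card_edges
  have h1 : (restr G X).edgeFinset = inE G X := by
    ext e
    rw [mem_edgeFinset, mem_inE]
    induction e with
    | _ a b => simp [restr]
  rw [h1] at h
  unfold ec
  rw [← h]
  rw [← Finset.sum_subset (Finset.subset_univ X)]
  · apply Finset.sum_congr rfl
    intro v hv
    unfold dg
    rw [← card_neighborFinset_eq_degree]
    congr 1
    ext u
    rw [mem_nb, mem_neighborFinset, restr_adj]
    tauto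
  · intro v _ hv
    rw [← card_neighborFinset_eq_degree, Finset.card_eq_zero, Finset.eq_empty_iff_forall_notMem]
    intro u hu
    rw [mem_neighborFinset, restr_adj] at hu
    exact hv hu.2.1

theorem ec_union (G : SimpleGraph V) {A B : Finset V} (h : Disjoint A B) :
    ec G (A ∪ B) = ec G A + ec G B + ∑ v ∈ A, dg G B v := by
  have h0 := handshake G (A ∪ B)
  have h1 := handshake G A
  have h2 := handshake G B
  rw [Finset.sum_union h] at h0
  simp only [dg_union G h, Finset.sum_add_distrib] at h0
  have h3 := sum_dg_comm G B A
  omega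

theorem Opt.two_edge {G : SimpleGraph V} {P : Finset (Finset V)} {U : Finset V}
    (h : Opt G P U) {J : Finset V} (hJ : J ∈ P) {A : Finset V} (hA : A ⊆ J)
    (hne : A.Nonempty) (hneq : A ≠ J) : 2 ≤ ∑ v ∈ A, dg G (J \ A) v := by
  have hd : Disjoint A (J \ A) := Finset.disjoint_sdiff
  have hne2 : (J \ A).Nonempty := by
    rw [Finset.sdiff_nonempty]
    intro hc
    exact hneq (Finset.Subset.antisymm hA hc)
  have hAB : A ≠ J \ A := by
    intro hc
    rw [← hc, disjoint_self] at hd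
    exact hne.ne_empty hd
  have hpart : IsPart {A, J \ A} J := by
    refine ⟨?_, ?_, ?_, ?_⟩
    · intro K hK
      simp only [Finset.mem_insert, Finset.mem_singleton] at hK
      rcases hK with rfl | rfl <;> assumption
    · intro K hK
      simp only [Finset.mem_insert, Finset.mem_singleton] at hK
      rcases hK with rfl | rfl
      · exact hA
      · exact Finset.sdiff_subset
    · intro v hv
      by_cases hvA : v ∈ A
      · exact ⟨A, by simp, hvA⟩
      · exact ⟨J \ A, by simp, by simp [hv, hvA]⟩
    · intro K hK L hL v hvK hvL
      simp only [Finset.mem_insert, Finset.mem_singleton] at hK hL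
      rcases hK with rfl | rfl <;> rcases hL with rfl | rfl
      · rfl
      · exact absurd hvL (Finset.disjoint_left.1 hd hvK)
      · exact absurd hvK (Finset.disjoint_left.1 hd hvL)
      · rfl
  have h1 := h.split hJ hpart (by rw [Finset.card_pair hAB])
  rw [Finset.sum_pair hAB] at h1
  have h2 := ec_union G hd
  rw [Finset.union_sdiff_of_subset hA] at h2
  have h3 := Finset.card_sdiff_add_card_eq_card hA
  unfold wt at h1
  omega

theorem ball {G : SimpleGraph V} (hG : G5 G) {X : Finset V} {v : V} (hv : v ∈ X) :
    1 + ∑ u ∈ nb G X v, dg G X u ≤ X.card := by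
  have h1 : ∑ u ∈ nb G X v, dg G X u =
      ((nb G X v).biUnion (fun u => insert u ((nb G X u).erase v))).card := by
    rw [Finset.card_biUnion]
    · apply Finset.sum_congr rfl
      intro u hu
      rw [mem_nb] at hu
      rw [Finset.card_insert_of_notMem, Finset.card_erase_add_one]
      · rfl
      · rw [mem_nb]; exact ⟨hv, hu.2.symm⟩
      · simp [mem_nb]
    · intro u hu w hw huw
      change Disjoint (insert u ((nb G X u).erase v)) (insert w ((nb G X w).erase v))
      rw [Finset.mem_coe, mem_nb] at hu hw
      rw [Finset.disjoint_left]
      intro x hx hx'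
      simp only [Finset.mem_insert, Finset.mem_erase, mem_nb] at hx hx'
      rcases hx with rfl | hx <;> rcases hx' with rfl | hx'
      · exact huw rfl
      · exact hG.tri v w x hw.2 hx'.2.2 hu.2.symm
      · exact hG.tri v u x hu.2 hx.2.2 hw.2.symm
      · exact hG.quad v u x w hu.2 hx.2.2 hx'.2.2.symm hw.2.symm (Ne.symm hx.1) huw
  have h2 : insert v ((nb G X v).biUnion (fun u => insert u ((nb G X u).erase v))) ⊆ X := by
    intro x hx
    simp only [Finset.mem_insert, Finset.mem_biUnion, Finset.mem_erase, mem_nb] at hx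
    rcases hx with rfl | ⟨u, hu, rfl | hx⟩
    · exact hv
    · exact hu.1
    · exact hx.2.1
  have h3 := Finset.card_le_card h2
  rw [Finset.card_insert_of_notMem, ← h1] at h3
  · omega
  · simp only [Finset.mem_insert, Finset.mem_biUnion, Finset.mem_erase, mem_nb, ne_eq,
      not_true_eq_false, false_and, or_false, not_exists, not_and]
    rintro u hu rfl
    exact G.loopless.irrefl _ hu.2

theorem delta_bound {G : SimpleGraph V} (hG : G5 G) {J : Finset V}
    (hne : J.Nonempty) (h2 : ∀ v ∈ J, 2 ≤ dg G J v) (h3 : ∀ v ∈ J, dg G J v ≤ 3) :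
    5 * wt G J - ec G J ≤ 0 ∨
    (5 * wt G J - ec G J = 2 ∧ J.card = 12 ∧ ∀ v ∈ J, dg G J v = 3) ∨
    (5 * wt G J - ec G J = 1 ∧
      ((J.card = 10 ∧ (J.filter (fun v => dg G J v = 2)).card = 2) ∨
       (J.card = 13 ∧ (J.filter (fun v => dg G J v = 2)).card = 1) ∨
       (J.card = 16 ∧ ∀ v ∈ J, dg G J v = 3))) := by
  set D2 := J.filter (fun v => dg G J v = 2) with hD2
  set D3 := J.filter (fun v => ¬ dg G J v = 2) with hD3
  have hD3' : ∀ v ∈ D3, v ∈ J ∧ dg G J v = 3 := by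
    intro v hv
    have := Finset.mem_filter.1 hv
    have := h2 v this.1
    have := h3 v (Finset.mem_filter.1 hv).1
    exact ⟨(Finset.mem_filter.1 hv).1, by have := (Finset.mem_filter.1 hv).2; omega⟩
  have hn : D2.card + D3.card = J.card := Finset.card_filter_add_card_filter_not _
  have hs := handshake G J
  rw [← Finset.sum_filter_add_sum_filter_not J (fun v => dg G J v = 2)] at hs
  rw [Finset.sum_congr rfl (fun v hv => (Finset.mem_filter.1 hv).2),
    Finset.sum_congr (s₁ := J.filter (fun v => ¬ dg G J v = 2)) rfl
      (fun v hv => (hD3' v hv).2)] at hs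
  simp only [Finset.sum_const, smul_eq_mul] at hs
  change D2.card * 2 + D3.card * 3 = _ at hs
  have hJD : D2 ∪ D3 = J := Finset.filter_union_filter_not_eq _ _
  have hdisj : Disjoint D2 D3 := Finset.disjoint_filter_filter_not _ _ _
  have hcross : ∑ v ∈ D3, dg G D2 v ≤ 2 * D2.card := by
    rw [sum_dg_comm]
    calc ∑ u ∈ D2, dg G D3 u ≤ ∑ u ∈ D2, 2 := by
          apply Finset.sum_le_sum
          intro u hu
          calc dg G D3 u ≤ dg G J u := dg_mono G (Finset.filter_subset _ _) u
            _ = 2 := (Finset.mem_filter.1 hu).2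
      _ = 2 * D2.card := by simp [mul_comm]
  have hball : ∀ v ∈ J, 1 + 2 * dg G J v + dg G D3 v ≤ J.card := by
    intro v hv
    refine le_trans ?_ (ball hG hv)
    have e1 : ∑ u ∈ nb G J v, dg G J u = ∑ u ∈ nb G D2 v, 2 + ∑ u ∈ nb G D3 v, 3 := by
      have : nb G J v = nb G D2 v ∪ nb G D3 v := by
        conv_lhs => rw [← hJD]
        unfold nb
        rw [Finset.filter_union]
      rw [this, Finset.sum_union]
      · congr 1
        · apply Finset.sum_congr rfl
          intro u hu
          exact (Finset.mem_filter.1 (mem_nb.1 hu).1).2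
        · apply Finset.sum_congr rfl
          intro u hu
          exact (hD3' u (mem_nb.1 hu).1).2
      · exact Finset.disjoint_filter_filter hdisj
    rw [e1]
    have e2 := dg_union G hdisj v
    rw [hJD] at e2
    simp only [Finset.sum_const, smul_eq_mul]
    change _ ≤ 1 + (dg G D2 v * 2 + dg G D3 v * 3)
    omega
  have hn5 : 5 ≤ J.card := by
    obtain ⟨v, hv⟩ := hne
    have := hball v hv
    have := h2 v hv
    omega
  have hn7 : D3.card ≠ 0 → 7 ≤ J.card := by
    intro h0
    obtain ⟨v, hv⟩ := Finset.card_pos.1 (Nat.pos_of_ne_zero h0)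
    have := hball v (hD3' v hv).1
    have := (hD3' v hv).2
    omega
  have hdeg3 : ∀ v ∈ D3, dg G D2 v + dg G D3 v = 3 := by
    intro v hv
    have e2 := dg_union G hdisj v
    rw [hJD] at e2
    have := (hD3' v hv).2
    omega
  have hn8 : J.card ≤ 7 → 3 * D3.card ≤ 2 * D2.card := by
    intro h7
    refine le_trans ?_ hcross
    rw [mul_comm, ← smul_eq_mul, ← Finset.sum_const]
    apply Finset.sum_le_sum
    intro v hv
    have := hball v (hD3' v hv).1
    have := (hD3' v hv).2
    have := hdeg3 v hv
    omega
  have hn10 : J.card ≤ 9 → D3.card ≤ 2 * D2.card := by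
    intro h9
    refine le_trans ?_ hcross
    rw [Finset.card_eq_sum_ones]
    apply Finset.sum_le_sum
    intro v hv
    have := hball v (hD3' v hv).1
    have := (hD3' v hv).2
    have := hdeg3 v hv
    omega
  have hcub : D2.card = 0 → ∀ v ∈ J, dg G J v = 3 := by
    intro h0 v hv
    have : v ∉ D2 := by rw [Finset.card_eq_zero.1 h0]; simp
    exact (hD3' v (Finset.mem_filter.2 ⟨hv, fun hc => this (Finset.mem_filter.2 ⟨hv, hc⟩)⟩)).2
  have hw : wt G J = ((ec G J : ℤ) - J.card + 2) / 2 := rfl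
  by_cases hle : 5 * wt G J - ec G J ≤ 0
  · exact Or.inl hle
  right
  have hD3bound : D3.card < 20 := by omega
  obtain ⟨t, ht⟩ : ∃ t, D3.card = 2 * t := ⟨D3.card / 2, by omega⟩
  have he : ec G J = 3 * t + D2.card := by omega
  have htb : t < 10 := by omega
  interval_cases t
  · omega
  · omega
  · omega
  · omega
  · right
    refine ⟨by omega, Or.inl ⟨by omega, by omega⟩⟩
  · omega
  · by_cases h0 : D2.card = 0
    · left
      exact ⟨by omega, by omega, hcub h0⟩
    · right
      exact ⟨by omega, Or.inr (Or.inl ⟨by omega, by omega⟩)⟩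
  · omega
  · right
    exact ⟨by omega, Or.inr (Or.inr ⟨by omega, hcub (by omega)⟩)⟩
  · omega

end Degrees

section Machinery
open Classical
set_option linter.unusedSectionVars false

theorem memF_iso {i j : ℕ} {W W' : Type} {G : SimpleGraph W} {G' : SimpleGraph W'}
    (h : MemF i j G) (f : G' ≃g G) : MemF i j G' := by
  cases h with
  | cycle hi h => exact .cycle hi ⟨f.trans h.some⟩
  | k4 h => exact .k4 ⟨f.trans h.some⟩
  | circ hj hH hxy he1 he2 hG =>
    refine .circ hj hH hxy he1 he2 ?_
    rcases hG with ⟨h1, x1, y1, x2, y2, h2, h3, h4⟩ | ⟨h1, x, y, h2, h4⟩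
    · exact Or.inl ⟨h1, x1, y1, x2, y2, h2, h3, ⟨f.trans h4.some⟩⟩
    · exact Or.inr ⟨h1, x, y, h2, ⟨f.trans h4.some⟩⟩
  | subd hj hH hxy hG => exact .subd hj hH hxy ⟨f.trans hG.some⟩

theorem subdivide_some_some {W : Type} (H : SimpleGraph W) (x y u v : W) :
    (subdivide H x y).Adj (some u) (some v) ↔ H.Adj u v ∧ s(u, v) ≠ s(x, y) := by
  simp only [subdivide, SimpleGraph.fromRel_adj, ne_eq, Option.some.injEq]
  constructor
  · rintro ⟨_, h | h⟩
    · exact h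
    · refine ⟨h.1.symm, ?_⟩
      rw [Sym2.eq_swap]; exact h.2
  · intro h
    exact ⟨h.1.ne, Or.inl h⟩

theorem subdivide_some_none {W : Type} (H : SimpleGraph W) (x y u : W) :
    (subdivide H x y).Adj (some u) none ↔ u = x ∨ u = y := by
  simp [subdivide, SimpleGraph.fromRel_adj]

theorem subdivide_none_some {W : Type} (H : SimpleGraph W) (x y u : W) :
    (subdivide H x y).Adj none (some u) ↔ u = x ∨ u = y := by
  rw [SimpleGraph.adj_comm, subdivide_some_none]

theorem subdivide_comm {W : Type} (H : SimpleGraph W) (x y : W) :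
    subdivide H x y = subdivide H y x := by
  ext u v
  rcases u with _ | u <;> rcases v with _ | v
  · simp
  · rw [subdivide_none_some, subdivide_none_some, or_comm]
  · rw [subdivide_some_none, subdivide_some_none, or_comm]
  · rw [subdivide_some_some, subdivide_some_some, Sym2.eq_swap (a := x)]

/-- subdivision respects isomorphism -/
def subdivideIso {W W' : Type} {H : SimpleGraph W} {H' : SimpleGraph W'} (f : H ≃g H')
    (x y : W) : subdivide H x y ≃g subdivide H' (f x) (f y) where
  toEquiv := Equiv.optionCongr f.toEquiv
  map_rel_iff' := by
    intro u v
    rcases u with _ | u <;> rcases v with _ | v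
    · simp
    · change (subdivide H' (f x) (f y)).Adj none (some (f v)) ↔ _
      rw [subdivide_none_some, subdivide_none_some]
      simp
    · change (subdivide H' (f x) (f y)).Adj (some (f u)) none ↔ _
      rw [subdivide_some_none, subdivide_some_none]
      simp
    · change (subdivide H' (f x) (f y)).Adj (some (f u)) (some (f v)) ↔ _
      rw [subdivide_some_some, subdivide_some_some]
      have hf : H'.Adj (f u) (f v) ↔ H.Adj u v := f.map_adj_iff
      rw [hf]
      simp

theorem subdivideIso_none {W W' : Type} {H : SimpleGraph W} {H' : SimpleGraph W'} (f : H ≃g H')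
    (x y : W) : subdivideIso f x y none = none := rfl

theorem subdivideIso_some {W W' : Type} {H : SimpleGraph W} {H' : SimpleGraph W'} (f : H ≃g H')
    (x y u : W) : subdivideIso f x y (some u) = some (f u) := rfl

theorem addApex_some_some {W : Type} (H : SimpleGraph W) (S : Set W) (u v : W) :
    (addApex H S).Adj (some u) (some v) ↔ H.Adj u v := by
  simp only [addApex, SimpleGraph.fromRel_adj, ne_eq, Option.some.injEq]
  constructor
  · rintro ⟨_, h | h⟩
    · exact h
    · exact h.symm
  · intro h
    exact ⟨h.ne, Or.inl h⟩

theorem addApex_some_none {W : Type} (H : SimpleGraph W) (S : Set W) (u : W) :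
    (addApex H S).Adj (some u) none ↔ u ∈ S := by
  simp [addApex, SimpleGraph.fromRel_adj]

theorem addApex_none_some {W : Type} (H : SimpleGraph W) (S : Set W) (u : W) :
    (addApex H S).Adj none (some u) ↔ u ∈ S := by
  rw [SimpleGraph.adj_comm, addApex_some_none]

/-- adding an apex respects isomorphism -/
def addApexIso {W W' : Type} {H : SimpleGraph W} {H' : SimpleGraph W'} (f : H ≃g H')
    (S : Set W) (S' : Set W') (hS : ∀ u, f u ∈ S' ↔ u ∈ S) : addApex H S ≃g addApex H' S' where
  toEquiv := Equiv.optionCongr f.toEquiv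
  map_rel_iff' := by
    intro u v
    rcases u with _ | u <;> rcases v with _ | v
    · simp
    · change (addApex H' S').Adj none (some (f v)) ↔ _
      rw [addApex_none_some, addApex_none_some, hS]
    · change (addApex H' S').Adj (some (f u)) none ↔ _
      rw [addApex_some_none, addApex_some_none, hS]
    · change (addApex H' S').Adj (some (f u)) (some (f v)) ↔ _
      rw [addApex_some_some, addApex_some_some]
      exact f.map_adj_iff

theorem circ_abs {j : ℕ} (hj : 1 ≤ j) {W W1 W2 W3 W4 : Type} {G : SimpleGraph W}
    {K1 : SimpleGraph W1} {K2 : SimpleGraph W2} {K3 : SimpleGraph W3} {K4 : SimpleGraph W4}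
    {α β γ : W1} {γ1 γ2 α' β' : W2} {β1 β2 α'' : W3} {a1 a2 : W4}
    (F : G ≃g addApex K1 {α, β, γ}) (f1 : K1 ≃g subdivide K2 γ1 γ2)
    (h1c : f1 γ = none) (h1b : f1 β = some β') (h1a : f1 α = some α')
    (f2 : K2 ≃g subdivide K3 β1 β2) (h2b : f2 β' = none) (h2a : f2 α' = some α'')
    (f3 : K3 ≃g subdivide K4 a1 a2) (h3a : f3 α'' = none) (hadj : K4.Adj a1 a2)
    (hM : MemF j j K4) (hb : K3.Adj β1 β2)
    (hc : (∃ c1 c2, f2 γ1 = some c1 ∧ f2 γ2 = some c2 ∧ K3.Adj c1 c2 ∧ s(c1, c2) ≠ s(β1, β2)) ∨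
      (f2 γ1 = none ∧ f2 γ2 = some β2)) : MemF (j + 1) (j + 1) G := by
  let g2 : K2 ≃g subdivide (subdivide K4 a1 a2) (f3 β1) (f3 β2) :=
    f2.trans (subdivideIso f3 β1 β2)
  let g1 : K1 ≃g subdivide (subdivide (subdivide K4 a1 a2) (f3 β1) (f3 β2)) (g2 γ1) (g2 γ2) :=
    f1.trans (subdivideIso g2 γ1 γ2)
  have ec1 : g1 γ = none := by
    change subdivideIso g2 γ1 γ2 (f1 γ) = none
    rw [h1c, subdivideIso_none]
  have eb1 : g1 β = some none := by
    change subdivideIso g2 γ1 γ2 (f1 β) = some none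
    rw [h1b, subdivideIso_some]
    change some (subdivideIso f3 β1 β2 (f2 β')) = _
    rw [h2b, subdivideIso_none]
  have ea1 : g1 α = some (some none) := by
    change subdivideIso g2 γ1 γ2 (f1 α) = _
    rw [h1a, subdivideIso_some]
    change some (subdivideIso f3 β1 β2 (f2 α')) = _
    rw [h2a, subdivideIso_some, h3a]
  let A : G ≃g addApex
      (subdivide (subdivide (subdivide K4 a1 a2) (f3 β1) (f3 β2)) (g2 γ1) (g2 γ2))
      {some (some none), some none, none} := F.trans (addApexIso g1 _ _ (by
        intro u
        simp only [Set.mem_insert_iff, Set.mem_singleton_iff]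
        rw [← ea1, ← eb1, ← ec1]
        simp))
  have he1 : s(f3 β1, f3 β2) ∈ (subdivide K4 a1 a2).edgeSet := by
    rw [SimpleGraph.mem_edgeSet]
    exact f3.map_adj_iff.2 hb
  rcases hc with ⟨c1, c2, hc1, hc2, hcadj, hcne⟩ | ⟨hc1, hc2⟩
  · have q1 : g2 γ1 = some (f3 c1) := by
      change subdivideIso f3 β1 β2 (f2 γ1) = _
      rw [hc1, subdivideIso_some]
    have q2 : g2 γ2 = some (f3 c2) := by
      change subdivideIso f3 β1 β2 (f2 γ2) = _
      rw [hc2, subdivideIso_some]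
    have he2 : s(f3 c1, f3 c2) ∈ (subdivide K4 a1 a2).edgeSet := by
      rw [SimpleGraph.mem_edgeSet]
      exact f3.map_adj_iff.2 hcadj
    refine MemF.circ (by omega) (by simpa using hM) hadj he1 he2 (Or.inl ⟨?_, ?_⟩)
    · intro hcon
      apply hcne
      have : Sym2.map f3 s(β1, β2) = Sym2.map f3 s(c1, c2) := by simpa using hcon
      exact (Sym2.map.injective f3.injective this).symm
    · refine ⟨f3 β1, f3 β2, f3 c1, f3 c2, rfl, rfl, ?_⟩
      rw [← q1, ← q2]
      exact ⟨A⟩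
  · have q1 : g2 γ1 = none := by
      change subdivideIso f3 β1 β2 (f2 γ1) = _
      rw [hc1, subdivideIso_none]
    have q2 : g2 γ2 = some (f3 β2) := by
      change subdivideIso f3 β1 β2 (f2 γ2) = _
      rw [hc2, subdivideIso_some]
    refine MemF.circ (by omega) (by simpa using hM) hadj he1 he1 (Or.inr ⟨rfl, ?_⟩)
    refine ⟨f3 β1, f3 β2, rfl, ?_⟩
    have hA : Nonempty (G ≃g addApex
      (subdivide (subdivide (subdivide K4 a1 a2) (f3 β1) (f3 β2)) (g2 γ1) (g2 γ2))
      {some (some none), some none, none}) := ⟨A⟩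
    rw [q1, q2] at hA
    exact hA

variable {V : Type} [Fintype V]

/-- Suppress the vertex `z`: join its neighbours and isolate it. -/
def unsub (K : SimpleGraph V) (z : V) : SimpleGraph V where
  Adj x y := x ≠ z ∧ y ≠ z ∧ x ≠ y ∧ (K.Adj x y ∨ (K.Adj x z ∧ K.Adj z y))
  symm := ⟨fun _ _ h => ⟨h.2.1, h.1, h.2.2.1.symm,
    h.2.2.2.elim (fun h => Or.inl h.symm) (fun h => Or.inr ⟨h.2.symm, h.1.symm⟩)⟩⟩
  loopless := ⟨fun _ h => h.2.2.1 rfl⟩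

theorem unsub_adj {K : SimpleGraph V} {z x y : V} : (unsub K z).Adj x y ↔
    x ≠ z ∧ y ≠ z ∧ x ≠ y ∧ (K.Adj x y ∨ (K.Adj x z ∧ K.Adj z y)) := Iff.rfl

/-- `z` has exactly two neighbours in `S`, namely the nonadjacent vertices `p`, `q`. -/
structure SupAt (K : SimpleGraph V) (S : Finset V) (z p q : V) : Prop where
  hz : z ∈ S
  hp : p ∈ S
  hq : q ∈ S
  hpq : p ≠ q
  hna : ¬ K.Adj p q
  hadj : ∀ x ∈ S, K.Adj z x ↔ x = p ∨ x = q

theorem SupAt.symm {K : SimpleGraph V} {S : Finset V} {z p q : V} (h : SupAt K S z p q) :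
    SupAt K S z q p :=
  ⟨h.hz, h.hq, h.hp, h.hpq.symm, fun hc => h.hna hc.symm,
    fun x hx => by rw [h.hadj x hx, or_comm]⟩

theorem SupAt.pz {K : SimpleGraph V} {S : Finset V} {z p q : V} (h : SupAt K S z p q) :
    p ≠ z := by
  rintro rfl
  exact K.loopless.irrefl _ ((h.hadj p h.hp).2 (Or.inl rfl))

theorem SupAt.unsub_adj {K : SimpleGraph V} {S : Finset V} {z p q : V} (h : SupAt K S z p q) :
    (unsub K z).Adj p q :=
  ⟨h.pz, h.symm.pz, h.hpq, Or.inr ⟨((h.hadj p h.hp).2 (Or.inl rfl)).symm,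
    (h.hadj q h.hq).2 (Or.inr rfl)⟩⟩

theorem unsub_iso {K : SimpleGraph V} {S : Finset V} {z p q : V} (h : SupAt K S z p q)
    (hp : p ∈ ((S.erase z : Finset V) : Set V)) (hq : q ∈ ((S.erase z : Finset V) : Set V)) :
    ∃ f : K.induce (S : Set V) ≃g
      subdivide ((unsub K z).induce ((S.erase z : Finset V) : Set V)) ⟨p, hp⟩ ⟨q, hq⟩,
      (∀ hz, f ⟨z, hz⟩ = none) ∧
      (∀ x hx (hx' : x ∈ ((S.erase z : Finset V) : Set V)), f ⟨x, hx⟩ = some ⟨x, hx'⟩) := by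
  have hzS := h.hz
  let e : (S : Set V) ≃ Option ((S.erase z : Finset V) : Set V) :=
    { toFun := fun x => if hx : (x : V) = z then none else
        some ⟨x, by simp only [Finset.mem_coe, Finset.mem_erase]; exact ⟨hx, x.2⟩⟩
      invFun := fun y => match y with
        | none => ⟨z, hzS⟩
        | some y => ⟨y, Finset.mem_coe.2 (Finset.mem_of_mem_erase y.2)⟩
      left_inv := by
        rintro ⟨x, hx⟩
        by_cases hxz : x = z
        · subst hxz; simp
        · simp [hxz]
      right_inv := by
        rintro (_ | ⟨y, hy⟩)
        · simp
        · have : y ≠ z := (Finset.mem_erase.1 (Finset.mem_coe.1 hy)).1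
          simp [this] }
  have he0 : ∀ hz, e ⟨z, hz⟩ = none := by intro hz; simp [e]
  have he1 : ∀ x hx (hx' : x ∈ ((S.erase z : Finset V) : Set V)), e ⟨x, hx⟩ = some ⟨x, hx'⟩ := by
    intro x hx hx'
    have : x ≠ z := (Finset.mem_erase.1 (Finset.mem_coe.1 hx')).1
    simp [e, this]
  refine ⟨⟨e, ?_⟩, he0, he1⟩
  rintro ⟨x, hx⟩ ⟨y, hy⟩
  by_cases hxz : x = z <;> by_cases hyz : y = z
  · subst hxz; subst hyz; simp
  · subst hxz
    have hy' : y ∈ ((S.erase x : Finset V) : Set V) := by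
      simp only [Finset.mem_coe, Finset.mem_erase]; exact ⟨hyz, hy⟩
    rw [he0, he1 y hy hy', subdivide_none_some]
    simp only [Subtype.mk.injEq, comap_adj, Function.Embedding.subtype_apply]
    exact (h.hadj y hy).symm
  · subst hyz
    have hx' : x ∈ ((S.erase y : Finset V) : Set V) := by
      simp only [Finset.mem_coe, Finset.mem_erase]; exact ⟨hxz, hx⟩
    rw [he0, he1 x hx hx', subdivide_some_none]
    simp only [Subtype.mk.injEq, comap_adj, Function.Embedding.subtype_apply]
    rw [K.adj_comm]
    exact (h.hadj x hx).symm
  · have hx' : x ∈ ((S.erase z : Finset V) : Set V) := by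
      simp only [Finset.mem_coe, Finset.mem_erase]; exact ⟨hxz, hx⟩
    have hy' : y ∈ ((S.erase z : Finset V) : Set V) := by
      simp only [Finset.mem_coe, Finset.mem_erase]; exact ⟨hyz, hy⟩
    rw [he1 x hx hx', he1 y hy hy', subdivide_some_some]
    simp only [Subtype.mk.injEq, comap_adj, Function.Embedding.subtype_apply, ne_eq, Sym2.eq_iff,
      InducedForest.unsub_adj]
    rw [K.adj_comm x z, h.hadj x hx, h.hadj y hy]
    have := h.hna
    constructor
    · rintro ⟨⟨_, _, hne, h1 | h1⟩, h2⟩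
      · exact h1
      · exfalso
        rcases h1 with ⟨rfl | rfl, rfl | rfl⟩ <;> simp_all
    · intro h1
      refine ⟨⟨hxz, hyz, h1.ne, Or.inl h1⟩, ?_⟩
      rintro (⟨rfl, rfl⟩ | ⟨rfl, rfl⟩)
      · exact this h1
      · exact this h1.symm

theorem apex_iso {K : SimpleGraph V} {S : Finset V} {w a b c : V} (hw : w ∈ S)
    (ha : a ∈ ((S.erase w : Finset V) : Set V)) (hb : b ∈ ((S.erase w : Finset V) : Set V))
    (hc : c ∈ ((S.erase w : Finset V) : Set V))
    (hadj : ∀ x ∈ S, K.Adj w x ↔ x = a ∨ x = b ∨ x = c) :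
    Nonempty (K.induce (S : Set V) ≃g
      addApex (K.induce ((S.erase w : Finset V) : Set V)) {⟨a, ha⟩, ⟨b, hb⟩, ⟨c, hc⟩}) := by
  let e : (S : Set V) ≃ Option ((S.erase w : Finset V) : Set V) :=
    { toFun := fun x => if hx : (x : V) = w then none else
        some ⟨x, by simp only [Finset.mem_coe, Finset.mem_erase]; exact ⟨hx, x.2⟩⟩
      invFun := fun y => match y with
        | none => ⟨w, hw⟩
        | some y => ⟨y, Finset.mem_coe.2 (Finset.mem_of_mem_erase y.2)⟩
      left_inv := by
        rintro ⟨x, hx⟩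
        by_cases hxz : x = w
        · subst hxz; simp
        · simp [hxz]
      right_inv := by
        rintro (_ | ⟨y, hy⟩)
        · simp
        · have : y ≠ w := (Finset.mem_erase.1 (Finset.mem_coe.1 hy)).1
          simp [this] }
  have he0 : ∀ hz, e ⟨w, hz⟩ = none := by intro hz; simp [e]
  have he1 : ∀ x hx (hx' : x ∈ ((S.erase w : Finset V) : Set V)), e ⟨x, hx⟩ = some ⟨x, hx'⟩ := by
    intro x hx hx'
    have : x ≠ w := (Finset.mem_erase.1 (Finset.mem_coe.1 hx')).1
    simp [e, this]
  refine ⟨⟨e, ?_⟩⟩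
  rintro ⟨x, hx⟩ ⟨y, hy⟩
  by_cases hxz : x = w <;> by_cases hyz : y = w
  · subst hxz; subst hyz; simp
  · subst hxz
    have hy' : y ∈ ((S.erase x : Finset V) : Set V) := by
      simp only [Finset.mem_coe, Finset.mem_erase]; exact ⟨hyz, hy⟩
    rw [he0, he1 y hy hy', addApex_none_some]
    simp only [Set.mem_insert_iff, Set.mem_singleton_iff, Subtype.mk.injEq, comap_adj,
      Function.Embedding.subtype_apply]
    exact (hadj y hy).symm
  · subst hyz
    have hx' : x ∈ ((S.erase y : Finset V) : Set V) := by
      simp only [Finset.mem_coe, Finset.mem_erase]; exact ⟨hxz, hx⟩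
    rw [he0, he1 x hx hx', addApex_some_none]
    simp only [Set.mem_insert_iff, Set.mem_singleton_iff, Subtype.mk.injEq, comap_adj,
      Function.Embedding.subtype_apply]
    rw [K.adj_comm]
    exact (hadj x hx).symm
  · have hx' : x ∈ ((S.erase w : Finset V) : Set V) := by
      simp only [Finset.mem_coe, Finset.mem_erase]; exact ⟨hxz, hx⟩
    have hy' : y ∈ ((S.erase w : Finset V) : Set V) := by
      simp only [Finset.mem_coe, Finset.mem_erase]; exact ⟨hyz, hy⟩
    rw [he1 x hx hx', he1 y hy hy', addApex_some_some]
    simp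

theorem circ_general {j : ℕ} (hj : 1 ≤ j) {K : SimpleGraph V} {S : Finset V} {w a b c : V}
    (hw : w ∈ S) (hab : a ≠ b) (hac : a ≠ c) (hbc : b ≠ c)
    (hadj : ∀ x ∈ S, K.Adj w x ↔ x = a ∨ x = b ∨ x = c)
    {c1 c2 b1 b2 a1 a2 : V}
    (hc : SupAt K (S.erase w) c c1 c2)
    (hb : SupAt (unsub K c) ((S.erase w).erase c) b b1 b2)
    (ha : SupAt (unsub (unsub K c) b) (((S.erase w).erase c).erase b) a a1 a2)
    (hM : MemF j j ((unsub (unsub (unsub K c) b) a).induce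
      (((((S.erase w).erase c).erase b).erase a : Finset V) : Set V))) :
    MemF (j + 1) (j + 1) (K.induce (S : Set V)) := by
  have mem : ∀ {T : Finset V} {z p q : V} {L : SimpleGraph V}, SupAt L T z p q →
      p ∈ ((T.erase z : Finset V) : Set V) ∧ q ∈ ((T.erase z : Finset V) : Set V) := by
    intro T z p q L h
    simp only [Finset.mem_coe, Finset.mem_erase]
    exact ⟨⟨h.pz, h.hp⟩, ⟨h.symm.pz, h.hq⟩⟩
  have a3 : a ∈ (((((S.erase w).erase c).erase b) : Finset V) : Set V) := ha.hz
  have a2' : a ∈ ((((S.erase w).erase c) : Finset V) : Set V) := Finset.mem_of_mem_erase ha.hz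
  have a1' : a ∈ (((S.erase w) : Finset V) : Set V) := Finset.mem_of_mem_erase a2'
  have b2' : b ∈ ((((S.erase w).erase c) : Finset V) : Set V) := hb.hz
  have b1' : b ∈ (((S.erase w) : Finset V) : Set V) := Finset.mem_of_mem_erase hb.hz
  have c1' : c ∈ (((S.erase w) : Finset V) : Set V) := hc.hz
  obtain ⟨F⟩ := apex_iso hw a1' b1' c1' hadj
  by_cases hcb : c1 = b ∨ c2 = b
  · obtain ⟨d1, d2, hd, hd1⟩ : ∃ d1 d2, SupAt K (S.erase w) c d1 d2 ∧ d1 = b := by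
      rcases hcb with h | h
      · exact ⟨c1, c2, hc, h⟩
      · exact ⟨c2, c1, hc.symm, h⟩
    subst hd1
    have hd2' : (unsub K c).Adj d1 d2 := hd.unsub_adj
    have hd2m : d2 ∈ (S.erase w).erase c := (mem hd).2
    have hor := (hb.hadj d2 hd2m).1 hd2'
    obtain ⟨e1, e2, he, he2⟩ : ∃ e1 e2, SupAt (unsub K c) ((S.erase w).erase c) d1 e1 e2 ∧
        e2 = d2 := by
      rcases hor with h | h
      · exact ⟨b2, b1, hb.symm, h.symm⟩
      · exact ⟨b1, b2, hb, h.symm⟩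
    subst he2
    obtain ⟨f1, f1a, f1b⟩ := unsub_iso hd (mem hd).1 (mem hd).2
    obtain ⟨f2, f2a, f2b⟩ := unsub_iso he (mem he).1 (mem he).2
    obtain ⟨f3, f3a, f3b⟩ := unsub_iso ha (mem ha).1 (mem ha).2
    refine circ_abs hj F f1 (f1a _) (f1b _ _ b2') (f1b _ _ a2') f2 (f2a _) (f2b _ _ a3) f3
      (f3a _) ?_ hM ?_ (Or.inr ⟨f2a _, f2b _ _ (mem he).2⟩)
    · simpa using ha.unsub_adj
    · simpa using he.unsub_adj
  · push Not at hcb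
    obtain ⟨f1, f1a, f1b⟩ := unsub_iso hc (mem hc).1 (mem hc).2
    obtain ⟨f2, f2a, f2b⟩ := unsub_iso hb (mem hb).1 (mem hb).2
    obtain ⟨f3, f3a, f3b⟩ := unsub_iso ha (mem ha).1 (mem ha).2
    have m1 : c1 ∈ ((((S.erase w).erase c).erase b : Finset V) : Set V) :=
      Finset.mem_coe.2 (Finset.mem_erase.2 ⟨hcb.1, (mem hc).1⟩)
    have m2 : c2 ∈ ((((S.erase w).erase c).erase b : Finset V) : Set V) :=
      Finset.mem_coe.2 (Finset.mem_erase.2 ⟨hcb.2, (mem hc).2⟩)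
    refine circ_abs hj F f1 (f1a _) (f1b _ _ b2') (f1b _ _ a2') f2 (f2a _) (f2b _ _ a3) f3
      (f3a _) ?_ hM ?_ (Or.inl ⟨_, _, f2b _ _ m1, f2b _ _ m2, ?_, ?_⟩)
    · simpa using ha.unsub_adj
    · simpa using hb.unsub_adj
    · simp only [comap_adj, Function.Embedding.subtype_apply]
      exact ⟨hcb.1, hcb.2, hc.hpq, Or.inl hc.unsub_adj⟩
    · intro hcon
      simp only [Sym2.eq_iff, Subtype.mk.injEq] at hcon
      rcases hcon with ⟨rfl, rfl⟩ | ⟨rfl, rfl⟩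
      · exact hb.hna hc.unsub_adj
      · exact hb.hna hc.unsub_adj.symm

/-- every nonempty closed subset is everything -/
def Conn (K : SimpleGraph V) (S : Finset V) : Prop :=
  ∀ X ⊆ S, X.Nonempty → (∀ x ∈ X, ∀ y ∈ S, K.Adj x y → y ∈ X) → X = S

theorem Conn.unsub {K : SimpleGraph V} {S : Finset V} (h : Conn K S) {z : V} (hz : z ∈ S) :
    Conn (unsub K z) (S.erase z) := by
  intro X hX hne hcl
  have hXz : ∀ x ∈ X, x ≠ z := fun x hx => (Finset.mem_erase.1 (hX hx)).1
  by_cases hx : ∃ x ∈ X, K.Adj x z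
  · obtain ⟨x0, hx0, hxz⟩ := hx
    have : insert z X = S := by
      apply h
      · intro y hy
        rcases Finset.mem_insert.1 hy with rfl | hy
        · exact hz
        · exact Finset.mem_of_mem_erase (hX hy)
      · exact ⟨z, by simp⟩
      · intro x hx y hy hxy
        by_cases hyz : y = z
        · simp [hyz]
        apply Finset.mem_insert_of_mem
        rcases Finset.mem_insert.1 hx with rfl | hx
        · by_cases hyx : y = x0
          · rw [hyx]; exact hx0
          · exact hcl x0 hx0 y (Finset.mem_erase.2 ⟨hyz, hy⟩)
              ⟨hXz _ hx0, hyz, Ne.symm hyx, Or.inr ⟨hxz, hxy⟩⟩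
        · exact hcl x hx y (Finset.mem_erase.2 ⟨hyz, hy⟩) ⟨hXz _ hx, hyz, hxy.ne, Or.inl hxy⟩
    rw [← this, Finset.erase_insert]
    intro hc
    exact hXz z hc rfl
  · push Not at hx
    exfalso
    have : X = S := by
      apply h X (hX.trans (Finset.erase_subset _ _)) hne
      intro x hx' y hy hxy
      have hyz : y ≠ z := by
        rintro rfl
        exact hx x hx' hxy
      exact hcl x hx' y (Finset.mem_erase.2 ⟨hyz, hy⟩) ⟨hXz _ hx', hyz, hxy.ne, Or.inl hxy⟩
    rw [← this] at hz
    exact hXz z hz rfl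

theorem SupAt.dg_eq {K : SimpleGraph V} {S : Finset V} {z p q : V} (h : SupAt K S z p q)
    {v : V} (hv : v ∈ S) (hvz : v ≠ z) : dg (InducedForest.unsub K z) (S.erase z) v = dg K S v := by
  have main : ∀ {p q : V}, SupAt K S z p q →
      dg (InducedForest.unsub K z) (S.erase z) p = dg K S p := by
    intro p q h
    have : nb (InducedForest.unsub K z) (S.erase z) p = insert q ((nb K S p).erase z) := by
      ext u
      simp only [mem_nb, Finset.mem_erase, Finset.mem_insert, InducedForest.unsub_adj]
      constructor
      · rintro ⟨⟨h1, h2⟩, _, _, h4, h5 | h5⟩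
        · exact Or.inr ⟨h1, h2, h5⟩
        · rcases (h.hadj u h2).1 h5.2 with rfl | rfl
          · exact absurd rfl h4
          · exact Or.inl rfl
      · rintro (rfl | ⟨h1, h2, h3⟩)
        · exact ⟨⟨h.symm.pz, h.hq⟩, h.unsub_adj⟩
        · exact ⟨⟨h1, h2⟩, h.pz, h1, h3.ne, Or.inl h3⟩
    unfold dg
    rw [this, Finset.card_insert_of_notMem, Finset.card_erase_add_one]
    · rw [mem_nb]; exact ⟨h.hz, ((h.hadj p h.hp).2 (Or.inl rfl)).symm⟩
    · rw [Finset.mem_erase, mem_nb]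
      rintro ⟨_, _, hc⟩
      exact h.hna hc
  by_cases hvp : v = p
  · subst hvp; exact main h
  by_cases hvq : v = q
  · subst hvq; exact main h.symm
  have hn : ¬ K.Adj z v := by
    rw [h.hadj v hv]
    tauto
  unfold dg
  congr 1
  ext u
  simp only [mem_nb, Finset.mem_erase, InducedForest.unsub_adj]
  constructor
  · rintro ⟨⟨_, h2⟩, _, _, _, h5 | h5⟩
    · exact ⟨h2, h5⟩
    · exact absurd h5.1.symm hn
  · rintro ⟨h1, h2⟩
    have hu : u ≠ z := by rintro rfl; exact hn h2.symm
    exact ⟨⟨hu, h1⟩, hvz, hu, h2.ne, Or.inl h2⟩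

theorem subd_general {i j : ℕ} (hj : 1 ≤ j) {K : SimpleGraph V} {S : Finset V} {z p q : V}
    (h : SupAt K S z p q)
    (hM : MemF i j ((unsub K z).induce ((S.erase z : Finset V) : Set V))) :
    MemF (i + 1) j (K.induce (S : Set V)) := by
  have hp : p ∈ ((S.erase z : Finset V) : Set V) := by
    simp only [Finset.mem_coe, Finset.mem_erase]; exact ⟨h.pz, h.hp⟩
  have hq : q ∈ ((S.erase z : Finset V) : Set V) := by
    simp only [Finset.mem_coe, Finset.mem_erase]; exact ⟨h.symm.pz, h.hq⟩
  obtain ⟨f, _, _⟩ := unsub_iso h hp hq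
  exact MemF.subd hj hM (x := ⟨p, hp⟩) (y := ⟨q, hq⟩) (by simpa using h.unsub_adj) ⟨f⟩

end Machinery

section EightVertices
open Classical
set_option linter.unusedSectionVars false

/-- entry `(i, j)` of the adjacency matrix coded by `g` -/
def bt (g i j : ℕ) : Bool := g.testBit (8 * i + j)

/-- forces evaluation of the first argument -/
def force (g : ℕ) (f : ℕ → Bool) : Bool :=
  match g with
  | 0 => f 0
  | n + 1 => f (n + 1)

theorem force_eq (g : ℕ) (f : ℕ → Bool) : force g f = f g := by
  cases g <;> rfl

/-- all 3-element subsets of the set of the first 8 numbers (coded as a row and as a column),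
grouped according to their four lowest members -/
def grp : List (List (ℕ × ℕ)) :=
  [[(112, 282578783305728), (176, 72058697844523008), (208, 72339073309605888), (224,
    72340168526266368)],
      [(49, 1103806595073), (81, 281479271677953), (145, 72057598332895233), (97,
    282574488338433), (161, 72058693549555713), (193, 72339069014638593)],
      [(50, 1103806595328), (82, 281479271678208), (146, 72057598332895488), (98,
    282574488338688), (162, 72058693549555968), (194, 72339069014638848)],
      [(19, 4294967553), (35, 1099511628033), (67, 281474976710913), (131, 72057594037928193)],
      [(52, 1103806660608), (84, 281479271743488), (148, 72057598332960768), (100,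
    282574488403968), (164, 72058693549621248), (196, 72339069014704128)],
      [(21, 4295032833), (37, 1099511693313), (69, 281474976776193), (133, 72057594037993473)],
      [(22, 4295033088), (38, 1099511693568), (70, 281474976776448), (134, 72057594037993728)],
      [(7, 65793)],
      [(56, 1103823372288), (88, 281479288455168), (152, 72057598349672448), (104,
    282574505115648), (168, 72058693566332928), (200, 72339069031415808)],
      [(25, 4311744513), (41, 1099528404993), (73, 281474993487873), (137, 72057594054705153)],
      [(26, 4311744768), (42, 1099528405248), (74, 281474993488128), (138, 72057594054705408)],
      [(11, 16777473)],
      [(28, 4311810048), (44, 1099528470528), (76, 281474993553408), (140, 72057594054770688)],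
      [(13, 16842753)],
      [(14, 16843008)],
      []]

/-- suppress `z` -/
def stepB (g : ℕ) (s : List ℕ) (z : ℕ) (cont : ℕ → List ℕ → Bool) : Bool :=
  match s.filter (bt g z) with
  | [p, q] => !(p == q || bt g p q) &&
      force (g ||| 2 ^ (8 * p + q) ||| 2 ^ (8 * q + p)) fun g' => cont g' (s.filter (fun x => x != z))
  | _ => false

/-- removing `w` and suppressing its neighbours gives a complete graph -/
def wB (g w : ℕ) : Bool :=
  match (List.range 8).filter (bt g w) with
  | [a, b, c] => a != b && a != c && b != c &&
    stepB g ((List.range 8).filter (fun x => x != w)) c fun g1 s1 =>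
      stepB g1 s1 b fun g2 s2 => stepB g2 s2 a fun g3 s3 =>
        s3.all fun x => s3.all fun y => x == y || bt g3 x y
  | _ => false

/-- no edge leaves the first four vertices, or some vertex can be reduced -/
def leafB (g : ℕ) : Bool := (g &&& 4042322160 == 0) || (List.range 8).any (wB g)

/-- candidates for a row -/
def rowCand (k low : ℕ) : List (ℕ × ℕ) :=
  cond (Nat.ble k 4) (grp.getD (Nat.mod low 16) []) grp.flatten

/-- search over all cubic graphs -/
def srch : ℕ → ℕ → Bool
  | 0, g => leafB g
  | k + 1, g => force ((g >>> (8 * (7 - k))) &&& 255) fun low =>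
    force (2 ^ (8 - k)) fun p => (rowCand k low).all fun m => cond (Nat.beq (Nat.mod m.1 p) low)
      (force (g ||| (m.1 <<< (8 * (7 - k))) ||| (m.2 <<< (7 - k))) (srch k)) true

theorem srch_ok : srch 7 16843022 = true := by decide +kernel

/-- `K` on `S` is coded by `g` and `s` -/
structure Rep (K : SimpleGraph (Fin 8)) (S : Finset (Fin 8)) (g : ℕ) (s : List ℕ) : Prop where
  hs : ∀ x : Fin 8, x ∈ S ↔ (x : ℕ) ∈ s
  lt : ∀ x ∈ s, x < 8
  adj : ∀ x ∈ S, ∀ y ∈ S, K.Adj x y ↔ bt g x y = true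

theorem bt_or (g h x y : ℕ) : bt (g ||| h) x y = (bt g x y || bt h x y) := by
  simp [bt]

theorem bt_pow (p q x y : ℕ) (hq : q < 8) (hy : y < 8) :
    bt (2 ^ (8 * p + q)) x y = true ↔ x = p ∧ y = q := by
  rw [bt, Nat.testBit_two_pow]
  simp only [decide_eq_true_eq]
  omega

theorem Rep.nbs {K : SimpleGraph (Fin 8)} {S : Finset (Fin 8)} {g : ℕ} {s : List ℕ}
    (h : Rep K S g s) {z : Fin 8} (hz : z ∈ S) (x : Fin 8) :
    (x : ℕ) ∈ s.filter (bt g z) ↔ x ∈ S ∧ K.Adj z x := by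
  rw [List.mem_filter, ← h.hs]
  constructor
  · rintro ⟨h1, h2⟩
    exact ⟨h1, (h.adj z hz x h1).2 h2⟩
  · rintro ⟨h1, h2⟩
    exact ⟨h1, (h.adj z hz x h1).1 h2⟩

theorem Rep.lift {K : SimpleGraph (Fin 8)} {S : Finset (Fin 8)} {g : ℕ} {s : List ℕ}
    (h : Rep K S g s) {z p : ℕ} (hp : p ∈ s.filter (bt g z)) :
    ∃ P : Fin 8, (P : ℕ) = p ∧ P ∈ S := by
  have h1 := (List.mem_filter.1 hp).1
  exact ⟨⟨p, h.lt p h1⟩, rfl, (h.hs _).2 h1⟩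

theorem stepB_sound {K : SimpleGraph (Fin 8)} {S : Finset (Fin 8)} {g : ℕ} {s : List ℕ}
    (h : Rep K S g s) {z : Fin 8} (hz : z ∈ S) {cont : ℕ → List ℕ → Bool}
    (hst : stepB g s z cont = true) :
    ∃ p q g' s', SupAt K S z p q ∧ Rep (unsub K z) (S.erase z) g' s' ∧ cont g' s' = true := by
  unfold stepB at hst
  split at hst
  case h_2 => simp at hst
  case h_1 p q hpq =>
  rw [Bool.and_eq_true, force_eq] at hst
  obtain ⟨h1, h2⟩ := hst
  obtain ⟨P, hP, hPS⟩ := h.lift (z := z) (p := p) (by rw [hpq]; simp)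
  obtain ⟨Q, hQ, hQS⟩ := h.lift (z := z) (p := q) (by rw [hpq]; simp)
  subst hP hQ
  have hn : ∀ x : Fin 8, x ∈ S ∧ K.Adj z x ↔ x = P ∨ x = Q := by
    intro x
    rw [← h.nbs hz, hpq]
    simp [Fin.ext_iff]
  simp only [Bool.not_eq_true', Bool.or_eq_false_iff, beq_eq_false_iff_ne, ne_eq] at h1
  have hsup : SupAt K S z P Q := by
    refine ⟨hz, hPS, hQS, ?_, ?_, ?_⟩
    · rintro rfl; exact h1.1 rfl
    · rw [h.adj P hPS Q hQS]; simp [h1.2]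
    · intro x hx
      rw [← hn]; simp [hx]
  refine ⟨P, Q, _, _, hsup, ⟨?_, ?_, ?_⟩, h2⟩
  · intro x
    rw [Finset.mem_erase, List.mem_filter, h.hs]
    simp only [bne_iff_ne, ne_eq, Fin.ext_iff]
    tauto
  · intro x hx
    exact h.lt x (List.mem_filter.1 hx).1
  · intro x hx y hy
    obtain ⟨hx1, hx2⟩ := Finset.mem_erase.1 hx
    obtain ⟨hy1, hy2⟩ := Finset.mem_erase.1 hy
    rw [bt_or, bt_or, Bool.or_eq_true, Bool.or_eq_true, bt_pow _ _ _ _ Q.2 y.2,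
      bt_pow _ _ _ _ P.2 y.2, ← h.adj x hx2 y hy2, unsub_adj, K.adj_comm x z,
      hsup.hadj x hx2, hsup.hadj y hy2]
    simp only [← Fin.ext_iff]
    constructor
    · rintro ⟨_, _, h3, h4 | h4⟩
      · exact Or.inl (Or.inl h4)
      · rcases h4 with ⟨rfl | rfl, rfl | rfl⟩ <;> simp_all
    · rintro ((h3 | ⟨rfl, rfl⟩) | ⟨rfl, rfl⟩)
      · exact ⟨hx1, hy1, h3.ne, Or.inl h3⟩
      · exact ⟨hx1, hy1, hsup.hpq, Or.inr (by simp)⟩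
      · exact ⟨hx1, hy1, hsup.hpq.symm, Or.inr (by simp)⟩

theorem memF_k4 {V : Type} [Fintype V] {K : SimpleGraph V} {S : Finset V} (hc : S.card = 4)
    (h : ∀ x ∈ S, ∀ y ∈ S, x ≠ y → K.Adj x y) : MemF 1 1 (K.induce (S : Set V)) := by
  let e : (S : Set V) ≃ Fin 4 := S.equivFinOfCardEq hc
  refine .k4 ⟨⟨e, ?_⟩⟩
  intro x y
  simp only [top_adj, ne_eq, EmbeddingLike.apply_eq_iff_eq, comap_adj,
    Function.Embedding.subtype_apply]
  constructor
  · intro hxy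
    exact h x x.2 y y.2 (fun hc => hxy (Subtype.ext hc))
  · intro hxy hc
    exact hxy.ne (congrArg _ hc)

theorem card_erase4 {V : Type} [Fintype V] {S : Finset V} {w c b a : V} (hw : w ∈ S)
    (hc : c ∈ S.erase w) (hb : b ∈ (S.erase w).erase c) (ha : a ∈ ((S.erase w).erase c).erase b) :
    ((((S.erase w).erase c).erase b).erase a).card = S.card - 4 := by
  rw [Finset.card_erase_of_mem ha, Finset.card_erase_of_mem hb, Finset.card_erase_of_mem hc,
    Finset.card_erase_of_mem hw]
  omega

theorem wB_sound {K : SimpleGraph (Fin 8)} {g : ℕ} (h : Rep K Finset.univ g (List.range 8))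
    {w : ℕ} (hw : w < 8) (hwB : wB g w = true) :
    MemF 2 2 (K.induce ((Finset.univ : Finset (Fin 8)) : Set (Fin 8))) := by
  unfold wB at hwB
  split at hwB
  case h_2 => simp at hwB
  case h_1 a b c habc =>
  simp only [Bool.and_eq_true, bne_iff_ne, ne_eq] at hwB
  obtain ⟨⟨⟨hab, hac⟩, hbc⟩, hB⟩ := hwB
  obtain ⟨W, rfl⟩ : ∃ W : Fin 8, (W : ℕ) = w := ⟨⟨w, hw⟩, rfl⟩
  obtain ⟨A, hA, _⟩ := h.lift (z := W) (p := a) (by rw [habc]; simp)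
  obtain ⟨B, hB', _⟩ := h.lift (z := W) (p := b) (by rw [habc]; simp)
  obtain ⟨C, hC, _⟩ := h.lift (z := W) (p := c) (by rw [habc]; simp)
  subst hA hB' hC
  have hn : ∀ x : Fin 8, K.Adj W x ↔ x = A ∨ x = B ∨ x = C := by
    intro x
    have := h.nbs (Finset.mem_univ W) x
    rw [habc] at this
    simpa [Fin.ext_iff, eq_comm] using this.symm
  have hR0 : Rep K (Finset.univ.erase W) g ((List.range 8).filter (fun x => x != W)) := by
    refine ⟨?_, ?_, ?_⟩
    · intro x
      simp [Fin.ext_iff]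
    · intro x hx
      exact h.lt x (List.mem_filter.1 hx).1
    · intro x _ y _
      exact h.adj x (Finset.mem_univ _) y (Finset.mem_univ _)
  have nAB : A ≠ B := fun hc => hab (by rw [hc])
  have nAC : A ≠ C := fun hc => hac (by rw [hc])
  have nBC : B ≠ C := fun hc => hbc (by rw [hc])
  have hAW : A ≠ W := ((hn A).2 (by simp)).ne'
  have hBW : B ≠ W := ((hn B).2 (by simp)).ne'
  have hCW : C ≠ W := ((hn C).2 (by simp)).ne'
  obtain ⟨c1, c2, g1, s1, S1, R1, hB⟩ := stepB_sound hR0 (by simp [hCW]) hB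
  obtain ⟨b1, b2, g2, s2, S2, R2, hB⟩ := stepB_sound R1 (by simp [hBW, nBC]) hB
  obtain ⟨a1, a2, g3, s3, S3, R3, hB⟩ := stepB_sound R2 (by simp [hAW, nAC, nAB]) hB
  have ee : instDecidableEqFin 8 = fun a b => propDecidable (a = b) := Subsingleton.elim _ _
  rw [ee] at S1 S2 S3 R3
  refine circ_general le_rfl (Finset.mem_univ W) nAB nAC nBC (fun x _ => hn x) S1 S2 S3 ?_
  apply memF_k4
  · rw [card_erase4 (Finset.mem_univ W) S1.hz S2.hz S3.hz]
    simp
  · intro x hx y hy hxy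
    rw [R3.adj x hx y hy]
    rw [List.all_eq_true] at hB
    have := hB x ((R3.hs x).1 hx)
    rw [List.all_eq_true] at this
    have := this y ((R3.hs y).1 hy)
    rw [Bool.or_eq_true] at this
    rcases this with h1 | h1
    · exact absurd (Fin.ext (by simpa using h1)) hxy
    · exact h1

theorem leafB_sound {K : SimpleGraph (Fin 8)} {g : ℕ} (h : ∀ x y : Fin 8, K.Adj x y ↔ bt g x y = true)
    (hc : Conn K Finset.univ) (hl : leafB g = true) :
    MemF 2 2 (K.induce ((Finset.univ : Finset (Fin 8)) : Set (Fin 8))) := by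
  unfold leafB at hl
  rw [Bool.or_eq_true] at hl
  rcases hl with hl | hl
  · exfalso
    have hl' : g &&& 4042322160 = 0 := by simpa using hl
    have hno : ∀ x y : Fin 8, x.1 < 4 → 4 ≤ y.1 → ¬ K.Adj x y := by
      intro x y hx hy hxy
      rw [h] at hxy
      have h1 : (g &&& 4042322160).testBit (8 * x + y) = false := by rw [hl']; simp
      rw [Nat.testBit_and] at h1
      unfold bt at hxy
      rw [hxy] at h1
      have key : ∀ x y : Fin 8, x.1 < 4 → 4 ≤ y.1 → Nat.testBit 4042322160 (8 * x + y) = true := by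
        decide
      rw [key x y hx hy] at h1
      simp at h1
    have := hc {x : Fin 8 | x.1 < 4} (Finset.subset_univ _) ⟨0, by simp⟩ (by
      intro x hx y _ hxy
      simp only [Finset.mem_filter, Finset.mem_univ, true_and] at hx ⊢
      by_contra hcon
      exact hno x y hx (by omega) hxy)
    have h7 : (7 : Fin 8) ∈ (Finset.univ : Finset (Fin 8)) := Finset.mem_univ _
    rw [← this] at h7
    simp at h7
  · rw [List.any_eq_true] at hl
    obtain ⟨w, hw, hwB⟩ := hl
    refine wB_sound (g := g) ⟨?_, ?_, ?_⟩ (List.mem_range.1 hw) hwB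
    · intro x; simp
    · intro x hx; exact List.mem_range.1 hx
    · intro x _ y _; exact h x y

theorem grp_ok : ∀ x y z : Fin 8, x ≠ y → x ≠ z → y ≠ z → ∀ k : Fin 7, 
    (2 ^ x.1 ||| 2 ^ y.1 ||| 2 ^ z.1, 2 ^ (8 * x.1) ||| 2 ^ (8 * y.1) ||| 2 ^ (8 * z.1)) ∈
      rowCand k (2 ^ x.1 ||| 2 ^ y.1 ||| 2 ^ z.1) := by decide +kernel

theorem rowCand_mod (k a b : ℕ) (h : k ≤ 4 → a % 16 = b % 16) : rowCand k a = rowCand k b := by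
  unfold rowCand
  by_cases hk : k ≤ 4
  · have := h hk
    change cond _ (grp.getD (a % 16) []) _ = cond _ (grp.getD (b % 16) []) _
    rw [this]
  · have : Nat.ble k 4 = false := by
      rw [Bool.eq_false_iff]; intro hc; exact hk (Nat.le_of_ble_eq_true hc)
    simp [this]

theorem srch_sound {K : SimpleGraph (Fin 8)} (hc : Conn K Finset.univ)
    (hcub : ∀ v, ∃ x y z, x ≠ y ∧ x ≠ z ∧ y ≠ z ∧ ∀ u, K.Adj v u ↔ u = x ∨ u = y ∨ u = z) :
    ∀ (k g : ℕ), k ≤ 7 → (∀ x y : Fin 8, bt g x y = true ↔ K.Adj x y ∧ (x.1 < 8 - k ∨ y.1 < 8 - k)) →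
    srch k g = true →
    MemF 2 2 (K.induce ((Finset.univ : Finset (Fin 8)) : Set (Fin 8))) := by
  intro k
  induction k with
  | zero =>
    intro g _ hg hs
    refine leafB_sound (fun x y => ?_) hc hs
    rw [hg]
    have := x.2
    simp
  | succ k ih =>
    intro g hk hg hs
    obtain ⟨i, hi⟩ : ∃ i : Fin 8, i.1 = 7 - k := ⟨⟨7 - k, by omega⟩, rfl⟩
    obtain ⟨x, y, z, hxy, hxz, hyz, hadj⟩ := hcub i
    set m := 2 ^ x.1 ||| 2 ^ y.1 ||| 2 ^ z.1 with hm
    set m2 := 2 ^ (8 * x.1) ||| 2 ^ (8 * y.1) ||| 2 ^ (8 * z.1) with hm2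
    have mbit : ∀ j : Fin 8, m.testBit j = true ↔ K.Adj i j := by
      intro j
      rw [hadj, hm]
      simp only [Nat.testBit_or, Nat.testBit_two_pow, Bool.or_eq_true, decide_eq_true_eq, Fin.ext_iff]
      omega
    have mlt : m < 2 ^ 8 := by
      rw [hm]
      refine Nat.or_lt_two_pow (Nat.or_lt_two_pow ?_ ?_) ?_ <;>
        exact Nat.pow_lt_pow_right (by norm_num) (Fin.is_lt _)
    have mbig : ∀ j, 8 ≤ j → m.testBit j = false := by
      intro j hj
      exact Nat.testBit_lt_two_pow (lt_of_lt_of_le mlt (Nat.pow_le_pow_right (by norm_num) hj))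
    have hlow : m % 2 ^ (8 - k) = (g >>> (8 * (7 - k))) &&& 255 := by
      apply Nat.eq_of_testBit_eq
      intro j
      have h255 : (255 : ℕ) = 2 ^ 8 - 1 := by norm_num
      rw [Nat.testBit_mod_two_pow, Nat.testBit_and, Nat.testBit_shiftRight, h255,
        Nat.testBit_two_pow_sub_one]
      by_cases hj : j < 8
      · have h1 := hg i ⟨j, hj⟩
        have h2 := mbit ⟨j, hj⟩
        simp only [bt, hi] at h1
        rw [Bool.eq_iff_iff]
        simp only [Bool.and_eq_true, decide_eq_true_eq, hj, and_true]
        rw [h1]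
        simp only at h2
        rw [h2]
        constructor
        · rintro ⟨h3, h4⟩
          refine ⟨h4, Or.inr ?_⟩
          have : j ≠ i.1 := by
            rintro rfl
            exact K.loopless.irrefl _ h4
          omega
        · rintro ⟨h3, h4⟩
          exact ⟨by omega, h3⟩
      · simp [mbig j (by omega), hj]
    have hmem := grp_ok x y z hxy hxz hyz ⟨k, by omega⟩
    rw [← hm, ← hm2] at hmem
    unfold srch at hs
    rw [force_eq, force_eq, List.all_eq_true, ← hlow] at hs
    have h3 := hs (m, m2) (by
      rw [rowCand_mod k _ m]
      · exact hmem
      · intro hk4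
        obtain ⟨d, hd⟩ : 16 ∣ 2 ^ (8 - k) := by
          have : (16 : ℕ) = 2 ^ 4 := by norm_num
          rw [this]
          exact pow_dvd_pow _ (by omega)
        exact Nat.mod_mod_of_dvd _ ⟨d, hd⟩)
    have h4 : Nat.beq (Nat.mod m (2 ^ (8 - k))) (m % 2 ^ (8 - k)) = true := Nat.beq_refl _
    rw [h4, cond_true, force_eq] at h3
    refine ih _ (by omega) ?_ h3
    intro a b
    have e1 : bt (m <<< (8 * (7 - k))) a b = true ↔ a = i ∧ K.Adj i b := by
      unfold bt
      rw [Nat.testBit_shiftLeft, Bool.and_eq_true, decide_eq_true_eq, ← hi, ← mbit]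
      have hb := b.2
      constructor
      · rintro ⟨h5, h6⟩
        have : a.1 = i.1 := by
          by_contra hne
          have := mbig (8 * a + b - 8 * i) (by omega)
          rw [this] at h6
          simp at h6
        refine ⟨Fin.ext this, ?_⟩
        have h7 : 8 * a.1 + b - 8 * i = b := by omega
        rwa [h7] at h6
      · rintro ⟨rfl, h6⟩
        refine ⟨by omega, ?_⟩
        have h7 : 8 * a.1 + b - 8 * a = b := by omega
        rwa [h7]
    have e2 : bt (m2 <<< (7 - k)) a b = true ↔ b = i ∧ K.Adj i a := by
      unfold bt
      rw [Nat.testBit_shiftLeft, Bool.and_eq_true, decide_eq_true_eq, ← hi, hadj, hm2]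
      simp only [Nat.testBit_or, Nat.testBit_two_pow, Bool.or_eq_true, decide_eq_true_eq,
        Fin.ext_iff]
      have hb := b.2
      have hi8 := i.2
      omega
    rw [bt_or, bt_or, Bool.or_eq_true, Bool.or_eq_true, e1, e2, hg]
    constructor
    · rintro ((⟨h5, h6⟩ | ⟨rfl, h6⟩) | ⟨rfl, h6⟩)
      · exact ⟨h5, by omega⟩
      · exact ⟨h6, by omega⟩
      · exact ⟨h6.symm, by omega⟩
    · rintro ⟨h5, h6⟩
      by_cases ha : a = i
      · subst ha; exact Or.inl (Or.inr ⟨rfl, h5⟩)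
      by_cases hb : b = i
      · subst hb; exact Or.inr ⟨rfl, h5.symm⟩
      have ha' : a.1 ≠ i.1 := fun h => ha (Fin.ext h)
      have hb' : b.1 ≠ i.1 := fun h => hb (Fin.ext h)
      exact Or.inl (Or.inl ⟨h5, by omega⟩)

variable {V : Type} [Fintype V]

theorem F22 {K : SimpleGraph V} {S : Finset V} (hS : S.card = 8) (hc : Conn K S)
    (hd : ∀ v ∈ S, dg K S v = 3) : MemF 2 2 (K.induce (S : Set V)) := by
  obtain ⟨v, hv⟩ : S.Nonempty := Finset.card_pos.1 (by omega)
  have hN := hd v hv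
  set N := nb K S v with hNdef
  have hNS : N ⊆ S := fun u hu => (mem_nb.1 hu).1
  have hvN : v ∉ N := fun hu => K.loopless.irrefl _ (mem_nb.1 hu).2
  have hNc : N.card = 3 := hN
  obtain ⟨n1, n2, n3, hl1⟩ : ∃ n1 n2 n3, N.toList = [n1, n2, n3] := by
    have : N.toList.length = 3 := by rw [Finset.length_toList, hNc]
    exact List.length_eq_three.1 this
  set l : List V := v :: (N.toList ++ ((S \ N).erase v).toList) with hl
  have hlm : ∀ u, u ∈ l ↔ u ∈ S := by
    intro u
    rw [hl, List.mem_cons, List.mem_append, Finset.mem_toList, Finset.mem_toList, Finset.mem_erase,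
      Finset.mem_sdiff]
    constructor
    · rintro (rfl | h | h)
      · exact hv
      · exact hNS h
      · exact h.2.1
    · intro h
      tauto
  have hln : l.Nodup := by
    rw [hl, List.nodup_cons]
    refine ⟨by simp [hvN], ?_⟩
    refine List.Nodup.append (Finset.nodup_toList _) (Finset.nodup_toList _) ?_
    intro u hu hu'
    simp only [Finset.mem_toList, Finset.mem_erase, Finset.mem_sdiff] at hu hu'
    exact hu'.2.2 hu
  have hll : l.length = 8 := by
    rw [← hS, ← List.toFinset_card_of_nodup hln]
    congr 1
    ext u
    rw [List.mem_toFinset, hlm]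
  let e : Fin 8 → V := fun i => l[i.1]'(by rw [hll]; exact i.2)
  have einj : Function.Injective e := by
    intro i j hij
    exact Fin.ext ((List.Nodup.getElem_inj_iff hln).1 hij)
  have eS : ∀ i, e i ∈ S := fun i => (hlm _).1 (List.getElem_mem _)
  have esur : ∀ u ∈ S, ∃ i, e i = u := by
    intro u hu
    obtain ⟨i, hi, h⟩ := List.getElem_of_mem ((hlm u).2 hu)
    exact ⟨⟨i, by rw [← hll]; exact hi⟩, h⟩
  let K' : SimpleGraph (Fin 8) := K.comap e
  have hcub : ∀ i, ∃ x y z, x ≠ y ∧ x ≠ z ∧ y ≠ z ∧ ∀ u, K'.Adj i u ↔ u = x ∨ u = y ∨ u = z := by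
    intro i
    have h3 := hd (e i) (eS i)
    obtain ⟨a, b, c, hab, hac, hbc, heq⟩ := Finset.card_eq_three.1 h3
    have hm : ∀ u, u ∈ S ∧ K.Adj (e i) u ↔ u = a ∨ u = b ∨ u = c := by
      intro u
      rw [← mem_nb, heq]; simp
    obtain ⟨x, rfl⟩ := esur a ((hm a).2 (by simp)).1
    obtain ⟨y, rfl⟩ := esur b ((hm b).2 (by simp)).1
    obtain ⟨z, rfl⟩ := esur c ((hm c).2 (by simp)).1
    refine ⟨x, y, z, fun h => hab (by rw [h]), fun h => hac (by rw [h]), fun h => hbc (by rw [h]), ?_⟩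
    intro u
    have := hm (e u)
    simp only [eS, true_and, einj.eq_iff] at this
    exact this
  have hconn : Conn K' Finset.univ := by
    intro X _ hne hcl
    have hi : X.image e = S := by
      apply hc
      · intro u hu
        obtain ⟨i, _, rfl⟩ := Finset.mem_image.1 hu
        exact eS i
      · exact hne.image e
      · intro u hu w hw huw
        obtain ⟨i, hi, rfl⟩ := Finset.mem_image.1 hu
        obtain ⟨j, rfl⟩ := esur w hw
        exact Finset.mem_image_of_mem _ (hcl i hi j (Finset.mem_univ _) huw)
    ext i
    simp only [Finset.mem_univ, iff_true]
    have := eS i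
    rw [← hi] at this
    obtain ⟨j, hj, hji⟩ := Finset.mem_image.1 this
    rwa [← einj hji]
  have h0 : ∀ j : Fin 8, K'.Adj 0 j ↔ j = 1 ∨ j = 2 ∨ j = 3 := by
    have e1 : e 1 = n1 := by simp [e, hl, hl1]
    have e2 : e 2 = n2 := by simp [e, hl, hl1]
    have e3 : e 3 = n3 := by simp [e, hl, hl1]
    intro j
    have : K'.Adj 0 j ↔ e j ∈ N := by
      rw [hNdef, mem_nb]
      change K.Adj v (e j) ↔ _
      simp [eS]
    rw [this, ← Finset.mem_toList, hl1, ← e1, ← e2, ← e3]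
    simp [einj.eq_iff]
  have hmain := srch_sound hconn hcub 7 16843022 le_rfl (by
    intro x y
    have hval : ∀ x y : Fin 8, bt 16843022 x y = true ↔
        (x = 0 ∧ (y = 1 ∨ y = 2 ∨ y = 3)) ∨ (y = 0 ∧ (x = 1 ∨ x = 2 ∨ x = 3)) := by
      decide +kernel
    rw [hval, ← h0, ← h0, K'.adj_comm 0 x]
    constructor
    · rintro (⟨rfl, h⟩ | ⟨rfl, h⟩)
      · exact ⟨h, by simp⟩
      · exact ⟨h, by simp⟩
    · rintro ⟨h, h1 | h1⟩
      · have : x = 0 := Fin.ext (by simpa using h1)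
        subst this; exact Or.inl ⟨rfl, h⟩
      · have : y = 0 := Fin.ext (by simpa using h1)
        subst this; exact Or.inr ⟨rfl, h⟩) srch_ok
  let E : ((Finset.univ : Finset (Fin 8)) : Set (Fin 8)) ≃ (S : Set V) :=
    Equiv.ofBijective (fun i => ⟨e i.1, eS i.1⟩) ⟨by
      intro i j hij
      exact Subtype.ext (einj (congrArg Subtype.val hij)), by
      rintro ⟨u, hu⟩
      obtain ⟨i, hi⟩ := esur u hu
      exact ⟨⟨i, by simp⟩, Subtype.ext hi⟩⟩
  have f : K'.induce ((Finset.univ : Finset (Fin 8)) : Set (Fin 8)) ≃g K.induce (S : Set V) :=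
    ⟨E, by intro i j; rfl⟩
  exact memF_iso hmain f.symm

end EightVertices

section RecogR
open Classical
set_option linter.unusedSectionVars false

variable {V : Type} [Fintype V]

theorem dg_three {K : SimpleGraph V} {X : Finset V} {v : V} (h : dg K X v = 3) :
    ∃ a b c, a ∈ X ∧ b ∈ X ∧ c ∈ X ∧ a ≠ b ∧ a ≠ c ∧ b ≠ c ∧ K.Adj v a ∧ K.Adj v b ∧ K.Adj v c ∧
      ∀ u ∈ X, K.Adj v u ↔ u = a ∨ u = b ∨ u = c := by
  obtain ⟨a, b, c, hab, hac, hbc, heq⟩ := Finset.card_eq_three.1 h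
  have hm : ∀ u, u ∈ X ∧ K.Adj v u ↔ u = a ∨ u = b ∨ u = c := by
    intro u
    rw [← mem_nb, heq]; simp
  have ha := (hm a).2 (by simp)
  have hb := (hm b).2 (by simp)
  have hc := (hm c).2 (by simp)
  exact ⟨a, b, c, ha.1, hb.1, hc.1, hab, hac, hbc, ha.2, hb.2, hc.2,
    fun u hu => by rw [← hm]; simp [hu]⟩

theorem dg_three' {K : SimpleGraph V} {X : Finset V} {v a : V} (h : dg K X v = 3)
    (haX : a ∈ X) (ha : K.Adj v a) :
    ∃ b c, b ∈ X ∧ c ∈ X ∧ a ≠ b ∧ a ≠ c ∧ b ≠ c ∧ K.Adj v b ∧ K.Adj v c ∧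
      ∀ u ∈ X, K.Adj v u ↔ u = a ∨ u = b ∨ u = c := by
  obtain ⟨x, y, z, hx, hy, hz, hxy, hxz, hyz, h1, h2, h3, h4⟩ := dg_three h
  rcases (h4 a haX).1 ha with rfl | rfl | rfl
  · exact ⟨y, z, hy, hz, hxy, hxz, hyz, h2, h3, h4⟩
  · exact ⟨x, z, hx, hz, hxy.symm, hyz, hxz, h1, h3, fun u hu => by rw [h4 u hu]; tauto⟩
  · exact ⟨x, y, hx, hy, hxz.symm, hyz.symm, hxy, h1, h2, fun u hu => by rw [h4 u hu]; tauto⟩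

theorem dg_three'' {K : SimpleGraph V} {X : Finset V} {v a b : V} (h : dg K X v = 3)
    (haX : a ∈ X) (ha : K.Adj v a) (hbX : b ∈ X) (hb : K.Adj v b) (hab : a ≠ b) :
    ∃ c, c ∈ X ∧ a ≠ c ∧ b ≠ c ∧ K.Adj v c ∧
      ∀ u ∈ X, K.Adj v u ↔ u = a ∨ u = b ∨ u = c := by
  obtain ⟨x, y, hx, hy, hax, hay, hxy, h1, h2, h4⟩ := dg_three' h haX ha
  rcases (h4 b hbX).1 hb with rfl | rfl | rfl
  · exact absurd rfl hab
  · exact ⟨y, hy, hay, hxy, h2, h4⟩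
  · exact ⟨x, hx, hax, hxy.symm, h1, fun u hu => by rw [h4 u hu]; tauto⟩

theorem dg_two' {K : SimpleGraph V} {X : Finset V} {v a : V} (h : dg K X v = 2)
    (haX : a ∈ X) (ha : K.Adj v a) :
    ∃ b, b ∈ X ∧ a ≠ b ∧ K.Adj v b ∧ ∀ u ∈ X, K.Adj v u ↔ u = a ∨ u = b := by
  obtain ⟨x, y, hxy, heq⟩ := Finset.card_eq_two.1 h
  have hm : ∀ u, u ∈ X ∧ K.Adj v u ↔ u = x ∨ u = y := by
    intro u
    rw [← mem_nb, heq]; simp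
  have hx := (hm x).2 (by simp)
  have hy := (hm y).2 (by simp)
  have hm' : ∀ u ∈ X, K.Adj v u ↔ u = x ∨ u = y := fun u hu => by rw [← hm]; simp [hu]
  rcases (hm' a haX).1 ha with rfl | rfl
  · exact ⟨y, hy.1, hxy, hy.2, hm'⟩
  · exact ⟨x, hx.1, hxy.symm, hx.2, fun u hu => by rw [hm' u hu]; tauto⟩

/-- neighbours in our labelling of `R` -/
def rtab : Fin 10 → List (Fin 10) :=
  ![[1, 2, 3], [0, 4, 7], [0, 5, 8], [0, 6, 9], [1, 5], [2, 4, 6], [3, 5, 7], [1, 6, 8],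
    [2, 7, 9], [3, 8]]

/-- the corresponding vertices of `R` -/
def rlab : Fin 10 → ZMod 5 × Fin 2 :=
  ![(3, 0), (4, 0), (3, 1), (2, 0), (0, 0), (0, 1), (2, 1), (4, 1), (1, 1), (1, 0)]

theorem rlab_adj (i j : Fin 10) : Rgraph.Adj (rlab i) (rlab j) ↔ j ∈ rtab i := by
  have key : ∀ i j : Fin 10, (((rlab i ≠ rlab j) ∧
    ((((rlab i).2 = 0 ∧ (rlab j).2 = 0 ∧ (rlab j).1 = (rlab i).1 + 1) ∨
    ((rlab i).2 = 1 ∧ (rlab j).2 = 1 ∧ (rlab j).1 = (rlab i).1 + 2) ∨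
    ((rlab i).2 = 0 ∧ (rlab j).2 = 1 ∧ (rlab i).1 = (rlab j).1)) ∨
    (((rlab j).2 = 0 ∧ (rlab i).2 = 0 ∧ (rlab i).1 = (rlab j).1 + 1) ∨
    ((rlab j).2 = 1 ∧ (rlab i).2 = 1 ∧ (rlab i).1 = (rlab j).1 + 2) ∨
    ((rlab j).2 = 0 ∧ (rlab i).2 = 1 ∧ (rlab j).1 = (rlab i).1)))) ∧
    ¬ ((rlab i = (0, 0) ∧ rlab j = (1, 0)) ∨ (rlab i = (1, 0) ∧ rlab j = (0, 0)))) ↔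
      j ∈ rtab i := by decide +kernel
  rw [← key]
  unfold Rgraph petersen
  rw [deleteEdges_adj, fromRel_adj, Set.mem_singleton_iff, Sym2.eq_iff]

theorem rlab_bij : Function.Bijective rlab := by decide +kernel

theorem iso_R {G : SimpleGraph V} {J : Finset V} (hJ : J.card = 10) (e : Fin 10 → V)
    (he : ∀ i, e i ∈ J) (hs : ∀ u ∈ J, ∃ i, e i = u)
    (hadj : ∀ i, ∀ u ∈ J, G.Adj (e i) u ↔ ∃ j ∈ rtab i, u = e j) :
    Nonempty (G.induce (J : Set V) ≃g Rgraph) := by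
  have himg : Finset.univ.image e = J := by
    ext u
    simp only [Finset.mem_image, Finset.mem_univ, true_and]
    constructor
    · rintro ⟨i, rfl⟩; exact he i
    · exact hs u
  have einj : Function.Injective e := by
    have hcc : (Finset.univ.image e).card = (Finset.univ : Finset (Fin 10)).card := by
      rw [himg, hJ]; simp
    have := Finset.card_image_iff.1 hcc
    simpa using this
  let E1 : Fin 10 ≃ (J : Set V) := Equiv.ofBijective (fun i => ⟨e i, he i⟩) ⟨by
      intro i j hij
      exact einj (congrArg Subtype.val hij), by
      rintro ⟨u, hu⟩
      obtain ⟨i, hi⟩ := hs u hu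
      exact ⟨i, Subtype.ext hi⟩⟩
  let E2 : Fin 10 ≃ ZMod 5 × Fin 2 := Equiv.ofBijective rlab rlab_bij
  refine ⟨⟨E1.symm.trans E2, ?_⟩⟩
  intro x y
  obtain ⟨i, rfl⟩ := E1.surjective x
  obtain ⟨j, rfl⟩ := E1.surjective y
  simp only [Equiv.trans_apply, Equiv.symm_apply_apply]
  change Rgraph.Adj (rlab i) (rlab j) ↔ G.Adj (e i) (e j)
  rw [rlab_adj, hadj i _ (he j)]
  constructor
  · intro h; exact ⟨j, h, rfl⟩
  · rintro ⟨k, hk, hkj⟩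
    rwa [einj hkj]

theorem close_R {G : SimpleGraph V} (hG : G5 G) {J : Finset V} (hJ : J.card = 10) {v p q x y : V}
    (hd : ∀ u ∈ J, u ≠ p → u ≠ q → dg G J u = 3)
    (hv : v ∈ J) (hvd : dg G J v = 3)
    (hx : x ∈ J) (hy : y ∈ J) (hxy : x ≠ y) (hxv : x ≠ v) (hyv : y ≠ v)
    (hxn : ¬ G.Adj v x) (hyn : ¬ G.Adj v y)
    (D : Finset V) (hDc : D.card ≤ 9) (hvD : v ∈ D) (hN : nb G J v ⊆ D) (hxD : x ∈ D) (hyD : y ∈ D)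
    (hpD : p ∈ D) (hqD : q ∈ D)
    (hcl : ∀ d ∈ D, d ≠ v → ¬ G.Adj v d → ∀ u ∈ J, G.Adj d u → u ∈ D) : False := by
  have hX1 : 1 ≤ (J \ D).card := by
    have := Finset.le_card_sdiff D J
    omega
  have hX4 : (J \ D).card ≤ 4 := by
    have h6 : (insert v (insert x (insert y (nb G J v)))).card = 6 := by
      rw [Finset.card_insert_of_notMem, Finset.card_insert_of_notMem, Finset.card_insert_of_notMem]
      · change dg G J v + 1 + 1 + 1 = 6
        omega
      · simp [mem_nb, hyn]
      · simp [mem_nb, hxn, hxy]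
      · simp [mem_nb, hxv.symm, hyv.symm]
    have hsub : insert v (insert x (insert y (nb G J v))) ⊆ J ∩ D := by
      intro u hu
      simp only [Finset.mem_insert] at hu
      rw [Finset.mem_inter]
      rcases hu with rfl | rfl | rfl | hu
      · exact ⟨hv, hvD⟩
      · exact ⟨hx, hxD⟩
      · exact ⟨hy, hyD⟩
      · exact ⟨(mem_nb.1 hu).1, hN hu⟩
    have h7 := Finset.card_le_card hsub
    have h8 := Finset.card_sdiff_add_card_inter J D
    omega
  have hdeg : ∀ y ∈ J \ D, 2 ≤ dg G (J \ D) y := by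
    intro y hy
    obtain ⟨hyJ, hyD⟩ := Finset.mem_sdiff.1 hy
    have h3 : dg G J y = 3 := hd y hyJ (fun h => hyD (h ▸ hpD)) (fun h => hyD (h ▸ hqD))
    have hun : dg G ((J \ D) ∪ (J ∩ D)) y = dg G (J \ D) y + dg G (J ∩ D) y :=
      dg_union G (Finset.disjoint_left.2 (fun u hu hu' =>
        (Finset.mem_sdiff.1 hu).2 (Finset.mem_inter.1 hu').2)) y
    rw [Finset.sdiff_union_inter, h3] at hun
    have h1 : dg G (J ∩ D) y ≤ 1 := by
      refine Finset.card_le_one.2 ?_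
      have hpar : ∀ w ∈ nb G (J ∩ D) y, G.Adj v w ∧ G.Adj w y := by
        intro w hw
        obtain ⟨hw1, hw2⟩ := mem_nb.1 hw
        obtain ⟨hwJ, hwD⟩ := Finset.mem_inter.1 hw1
        refine ⟨?_, hw2.symm⟩
        by_contra hvw
        by_cases hwv : w = v
        · subst hwv
          exact hyD (hN (mem_nb.2 ⟨hyJ, hw2.symm⟩))
        · exact hyD (hcl w hwD hwv hvw y hyJ hw2.symm)
      intro w hw w' hw'
      by_contra hne
      have h1 := hpar w hw
      have h2 := hpar w' hw'
      exact hG.quad v w y w' h1.1 h1.2 h2.2.symm h2.1.symm (fun h => hyD (h ▸ hvD)) hne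
    omega
  obtain ⟨z, hz⟩ := Finset.card_pos.1 hX1
  have hb := ball hG hz
  have hs : 2 * 2 ≤ ∑ u ∈ nb G (J \ D) z, dg G (J \ D) u := by
    calc 2 * 2 ≤ (nb G (J \ D) z).card * 2 := Nat.mul_le_mul_right 2 (hdeg z hz)
      _ = ∑ u ∈ nb G (J \ D) z, 2 := by simp
      _ ≤ _ := Finset.sum_le_sum fun u hu => hdeg u (mem_nb.1 hu).1
  omega

set_option maxHeartbeats 2000000 in
theorem recog_R {G : SimpleGraph V} (hG : G5 G) {J : Finset V} (hJ : J.card = 10)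
    (h2 : ∀ v ∈ J, 2 ≤ dg G J v) (h3 : ∀ v ∈ J, dg G J v ≤ 3)
    (hf : (J.filter (fun v => dg G J v = 2)).card = 2) :
    Nonempty (G.induce (J : Set V) ≃g Rgraph) := by
  obtain ⟨p, q, hpq, heq⟩ := Finset.card_eq_two.1 hf
  have hmem : ∀ u, u ∈ J ∧ dg G J u = 2 ↔ u = p ∨ u = q := by
    intro u
    rw [← Finset.mem_filter (p := fun v => dg G J v = 2), heq]; simp
  obtain ⟨hpJ, hp2⟩ := (hmem p).2 (by simp)
  obtain ⟨hqJ, hq2⟩ := (hmem q).2 (by simp)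
  have hd : ∀ u ∈ J, u ≠ p → u ≠ q → dg G J u = 3 := by
    intro u hu h4 h5
    have := h2 u hu
    have := h3 u hu
    have : dg G J u ≠ 2 := fun h => by
      rcases (hmem u).1 ⟨hu, h⟩ with h | h
      · exact h4 h
      · exact h5 h
    omega
  obtain ⟨v, hv, hvB⟩ : ∃ v ∈ J, v ∉ insert p (insert q (nb G J p ∪ nb G J q)) := by
    apply Finset.exists_mem_notMem_of_card_lt_card
    have h4 := Finset.card_insert_le p (insert q (nb G J p ∪ nb G J q))
    have h5 := Finset.card_insert_le q (nb G J p ∪ nb G J q)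
    have h6 := Finset.card_union_le (nb G J p) (nb G J q)
    have h7 : (nb G J p).card = 2 := hp2
    have h8 : (nb G J q).card = 2 := hq2
    omega
  simp only [Finset.mem_insert, Finset.mem_union, mem_nb, not_or, not_and] at hvB
  obtain ⟨hvp, hvq, hnp, hnq⟩ := hvB
  have hnp' : ¬ G.Adj v p := fun h => hnp hv h.symm
  have hnq' : ¬ G.Adj v q := fun h => hnq hv h.symm
  have hvd : dg G J v = 3 := hd v hv hvp hvq
  have hNd : ∀ w ∈ J, G.Adj v w → dg G J w = 3 := by
    intro w hw hvw
    exact hd w hw (by rintro rfl; exact hnp' hvw) (by rintro rfl; exact hnq' hvw)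
  -- every other vertex has a parent
  have hT : ∀ u ∈ J, u ≠ v → ¬ G.Adj v u → ∃ w ∈ J, G.Adj v w ∧ G.Adj w u := by
    intro u hu huv hvu
    by_contra hcon
    push Not at hcon
    have hvX : v ∈ J.erase u := Finset.mem_erase.2 ⟨huv.symm, hv⟩
    have hb := ball hG hvX
    have e1 : nb G (J.erase u) v = nb G J v := by
      ext w
      simp only [mem_nb, Finset.mem_erase]
      constructor
      · rintro ⟨⟨_, h5⟩, h6⟩; exact ⟨h5, h6⟩
      · rintro ⟨h5, h6⟩; exact ⟨⟨by rintro rfl; exact hvu h6, h5⟩, h6⟩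
    have e2 : ∑ w ∈ nb G J v, dg G (J.erase u) w = ∑ w ∈ nb G J v, 3 := by
      apply Finset.sum_congr rfl
      intro w hw
      obtain ⟨hwJ, hvw⟩ := mem_nb.1 hw
      rw [← hNd w hwJ hvw]
      unfold dg
      congr 1
      ext y
      simp only [mem_nb, Finset.mem_erase]
      constructor
      · rintro ⟨⟨_, h5⟩, h6⟩; exact ⟨h5, h6⟩
      · rintro ⟨h5, h6⟩; exact ⟨⟨by rintro rfl; exact hcon w hwJ hvw h6, h5⟩, h6⟩
    rw [e1, e2, Finset.card_erase_of_mem hu, hJ] at hb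
    have : (nb G J v).card = 3 := hvd
    simp [this] at hb
  have hTu : ∀ u w w', u ≠ v → G.Adj v w → G.Adj v w' → G.Adj w u → G.Adj w' u → w = w' := by
    intro u w w' huv h4 h5 h6 h7
    by_contra hne
    exact hG.quad v w u w' h4 h6 h7.symm h5.symm huv.symm hne
  have step : ∀ x y, G.Adj x y → x ≠ v → y ≠ v → ¬ G.Adj v x → ∀ w, G.Adj v w → G.Adj w x → w ≠ y →
      ¬ G.Adj v y := by
    intro x y hxy hxv hyv hvx w hvw hwx hwy hvy
    exact hwy (hTu x w y hxv hvw hvy hwx hxy.symm)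
  -- x1 = p
  obtain ⟨a, haJ, hva, hap⟩ := hT p hpJ (Ne.symm hvp) hnp'
  obtain ⟨x2, hx2J, hax2, hpx2, Np⟩ := dg_two' hp2 haJ hap.symm
  have x2v : x2 ≠ v := by rintro rfl; exact hnp' hpx2.symm
  have x2n : ¬ G.Adj v x2 := step p x2 hpx2 (Ne.symm hvp) x2v hnp' a hva hap hax2
  obtain ⟨b, hbJ, hvb, hbx2⟩ := hT x2 hx2J x2v x2n
  have hab : a ≠ b := by rintro rfl; exact hG.tri a p x2 hap hpx2 hbx2.symm
  have hbp : b ≠ p := by rintro rfl; exact hnp' hvb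
  have hcard : (nb G J v).card = 3 := hvd
  have x2q : x2 ≠ q := by
    rintro rfl
    obtain ⟨y, hyJ, hby, hx2y, Nx2⟩ := dg_two' hq2 hbJ hbx2.symm
    obtain rfl : p = y := by
      rcases (Nx2 p hpJ).1 hpx2.symm with h | h
      · exact absurd h.symm hbp
      · exact h
    refine close_R hG hJ hd hv hvd hpJ hqJ hpq (Ne.symm hvp) (Ne.symm hvq) hnp' hnq'
      (insert v (insert p (insert x2 (nb G J v)))) ?_ (by simp) ?_ (by simp) (by simp) (by simp)
      (by simp) ?_
    · have h4 := Finset.card_insert_le v (insert p (insert x2 (nb G J v)))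
      have h5 := Finset.card_insert_le p (insert x2 (nb G J v))
      have h6 := Finset.card_insert_le x2 (nb G J v)
      omega
    · intro u hu; simp [hu]
    · intro d hdD hdv hvd' u hu hdu
      simp only [Finset.mem_insert, mem_nb] at hdD ⊢
      rcases hdD with rfl | rfl | rfl | h
      · exact absurd rfl hdv
      · rcases (Np u hu).1 hdu with rfl | rfl
        · simp [haJ, hva]
        · simp
      · rcases (Nx2 u hu).1 hdu with rfl | rfl
        · simp [hbJ, hvb]
        · simp
      · exact absurd h.2 hvd'
  have x2p : x2 ≠ p := hpx2.ne'
  obtain ⟨x3, hx3J, hbx3, hpx3, hx23, Nx2⟩ :=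
    dg_three'' (hd x2 hx2J x2p x2q) hbJ hbx2.symm hpJ hpx2.symm hbp
  have x3v : x3 ≠ v := by rintro rfl; exact x2n hx23.symm
  have x3n : ¬ G.Adj v x3 := step x2 x3 hx23 x2v x3v x2n b hvb hbx2 hbx3
  obtain ⟨c, hcJ, hvc, hcx3⟩ := hT x3 hx3J x3v x3n
  have hbc : b ≠ c := by rintro rfl; exact hG.tri b x2 x3 hbx2 hx23 hcx3.symm
  have hac : a ≠ c := by
    rintro rfl; exact hG.quad a p x2 x3 hap hpx2 hx23 hcx3.symm hax2 hpx3
  have Nv : ∀ u ∈ J, G.Adj v u ↔ u = a ∨ u = b ∨ u = c := by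
    obtain ⟨c', hc'J, h4, h5, h6, h7⟩ := dg_three'' hvd haJ hva hbJ hvb hab
    rcases (h7 c hcJ).1 hvc with h | h | h
    · exact absurd h.symm hac
    · exact absurd h.symm hbc
    · rw [h]; exact h7
  have hcx2 : c ≠ x2 := by rintro rfl; exact x2n hvc
  have x3p : x3 ≠ p := hpx3.symm
  have x3q : x3 ≠ q := by
    rintro rfl
    obtain ⟨y, hyJ, hby, hx2y, Nx3⟩ := dg_two' hq2 hcJ hcx3.symm
    obtain rfl : x2 = y := by
      rcases (Nx3 x2 hx2J).1 hx23.symm with h | h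
      · exact absurd h.symm hcx2
      · exact h
    refine close_R hG hJ hd hv hvd hpJ hqJ hpq (Ne.symm hvp) (Ne.symm hvq) hnp' hnq'
      (insert v (insert p (insert x2 (insert x3 (nb G J v))))) ?_ (by simp) ?_ (by simp) (by simp)
      (by simp) (by simp) ?_
    · have h3 := Finset.card_insert_le v (insert p (insert x2 (insert x3 (nb G J v))))
      have h4 := Finset.card_insert_le p (insert x2 (insert x3 (nb G J v)))
      have h5 := Finset.card_insert_le x2 (insert x3 (nb G J v))
      have h6 := Finset.card_insert_le x3 (nb G J v)
      omega
    · intro u hu; simp [hu]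
    · intro d hdD hdv hvd' u hu hdu
      simp only [Finset.mem_insert, mem_nb] at hdD ⊢
      rcases hdD with rfl | rfl | rfl | rfl | h
      · exact absurd rfl hdv
      · rcases (Np u hu).1 hdu with rfl | rfl
        · simp [haJ, hva]
        · simp
      · rcases (Nx2 u hu).1 hdu with rfl | rfl | rfl
        · simp [hbJ, hvb]
        · simp
        · simp
      · rcases (Nx3 u hu).1 hdu with rfl | rfl
        · simp [hcJ, hvc]
        · simp
      · exact absurd h.2 hvd'
  obtain ⟨x4, hx4J, hcx4, hx24, hx34, Nx3⟩ :=
    dg_three'' (hd x3 hx3J x3p x3q) hcJ hcx3.symm hx2J hx23.symm hcx2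
  have x4v : x4 ≠ v := by rintro rfl; exact x3n hx34.symm
  have x4n : ¬ G.Adj v x4 := step x3 x4 hx34 x3v x4v x3n c hvc hcx3 hcx4
  obtain ⟨w4, hw4J, hvw4, hwx4⟩ := hT x4 hx4J x4v x4n
  have hw4 : a = w4 := by
    rcases (Nv w4 hw4J).1 hvw4 with h | h | h
    · exact h.symm
    · subst h
      exact absurd rfl fun _ : (0 : ℕ) = 0 =>
        hG.quad w4 x2 x3 x4 hbx2 hx23 hx34 hwx4.symm hbx3 hx24
    · subst h
      exact absurd rfl fun _ : (0 : ℕ) = 0 => hG.tri w4 x3 x4 hcx3 hx34 hwx4.symm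
  subst hw4
  have x4p : x4 ≠ p := by rintro rfl; exact hG.tri x4 x2 x3 hpx2 hx23 hx34
  have hax3 : a ≠ x3 := by rintro rfl; exact x3n hva
  have x4q : x4 ≠ q := by
    rintro rfl
    obtain ⟨y, hyJ, hby, hx2y, Nx4⟩ := dg_two' hq2 haJ hwx4.symm
    obtain rfl : x3 = y := by
      rcases (Nx4 x3 hx3J).1 hx34.symm with h | h
      · exact absurd h.symm hax3
      · exact h
    refine close_R hG hJ hd hv hvd hpJ hqJ hpq (Ne.symm hvp) (Ne.symm hvq) hnp' hnq'
      (insert v (insert p (insert x2 (insert x3 (insert x4 (nb G J v)))))) ?_ (by simp) ?_ (by simp)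
      (by simp) (by simp) (by simp) ?_
    · have h2 := Finset.card_insert_le v (insert p (insert x2 (insert x3 (insert x4 (nb G J v)))))
      have h3 := Finset.card_insert_le p (insert x2 (insert x3 (insert x4 (nb G J v))))
      have h4 := Finset.card_insert_le x2 (insert x3 (insert x4 (nb G J v)))
      have h5 := Finset.card_insert_le x3 (insert x4 (nb G J v))
      have h6 := Finset.card_insert_le x4 (nb G J v)
      omega
    · intro u hu; simp [hu]
    · intro d hdD hdv hvd' u hu hdu
      simp only [Finset.mem_insert, mem_nb] at hdD ⊢
      rcases hdD with rfl | rfl | rfl | rfl | rfl | h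
      · exact absurd rfl hdv
      · rcases (Np u hu).1 hdu with rfl | rfl
        · simp [haJ, hva]
        · simp
      · rcases (Nx2 u hu).1 hdu with rfl | rfl | rfl
        · simp [hbJ, hvb]
        · simp
        · simp
      · rcases (Nx3 u hu).1 hdu with rfl | rfl | rfl
        · simp [hcJ, hvc]
        · simp
        · simp
      · rcases (Nx4 u hu).1 hdu with rfl | rfl
        · simp [haJ, hva]
        · simp
      · exact absurd h.2 hvd'
  obtain ⟨x5, hx5J, hax5, hx35, hx45, Nx4⟩ :=
    dg_three'' (hd x4 hx4J x4p x4q) haJ hwx4.symm hx3J hx34.symm hax3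
  have x5v : x5 ≠ v := by rintro rfl; exact x4n hx45.symm
  have x5n : ¬ G.Adj v x5 := step x4 x5 hx45 x4v x5v x4n a hva hwx4 hax5
  obtain ⟨w5, hw5J, hvw5, hwx5⟩ := hT x5 hx5J x5v x5n
  have hw5 : b = w5 := by
    rcases (Nv w5 hw5J).1 hvw5 with h | h | h
    · subst h
      exact absurd rfl fun _ : (0 : ℕ) = 0 => hG.tri w5 x4 x5 hwx4 hx45 hwx5.symm
    · exact h.symm
    · subst h
      exact absurd rfl fun _ : (0 : ℕ) = 0 =>
        hG.quad w5 x3 x4 x5 hcx3 hx34 hx45 hwx5.symm hcx4 hx35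
  subst hw5
  have x5x2 : x5 ≠ x2 := by rintro rfl; exact hG.tri x5 x3 x4 hx23 hx34 hx45
  have x5p : x5 ≠ p := by
    rintro rfl
    exact hab (hTu x5 a b x5v hva hvb hap hwx5)
  have hbx4 : b ≠ x4 := by rintro rfl; exact x4n hvb
  have x5q : x5 ≠ q := by
    rintro rfl
    obtain ⟨y, hyJ, hby, hx2y, Nx5⟩ := dg_two' hq2 hbJ hwx5.symm
    obtain rfl : x4 = y := by
      rcases (Nx5 x4 hx4J).1 hx45.symm with h | h
      · exact absurd h.symm hbx4
      · exact h
    refine close_R hG hJ hd hv hvd hpJ hqJ hpq (Ne.symm hvp) (Ne.symm hvq) hnp' hnq'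
      (insert v (insert p (insert x2 (insert x3 (insert x4 (insert x5 (nb G J v))))))) ?_ (by simp) ?_
      (by simp) (by simp) (by simp) (by simp) ?_
    · have h1 := Finset.card_insert_le v
        (insert p (insert x2 (insert x3 (insert x4 (insert x5 (nb G J v))))))
      have h2 := Finset.card_insert_le p (insert x2 (insert x3 (insert x4 (insert x5 (nb G J v)))))
      have h3 := Finset.card_insert_le x2 (insert x3 (insert x4 (insert x5 (nb G J v))))
      have h4 := Finset.card_insert_le x3 (insert x4 (insert x5 (nb G J v)))
      have h5 := Finset.card_insert_le x4 (insert x5 (nb G J v))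
      have h6 := Finset.card_insert_le x5 (nb G J v)
      omega
    · intro u hu; simp [hu]
    · intro d hdD hdv hvd' u hu hdu
      simp only [Finset.mem_insert, mem_nb] at hdD ⊢
      rcases hdD with rfl | rfl | rfl | rfl | rfl | rfl | h
      · exact absurd rfl hdv
      · rcases (Np u hu).1 hdu with rfl | rfl
        · simp [haJ, hva]
        · simp
      · rcases (Nx2 u hu).1 hdu with rfl | rfl | rfl
        · simp [hbJ, hvb]
        · simp
        · simp
      · rcases (Nx3 u hu).1 hdu with rfl | rfl | rfl
        · simp [hcJ, hvc]
        · simp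
        · simp
      · rcases (Nx4 u hu).1 hdu with rfl | rfl | rfl
        · simp [haJ, hva]
        · simp
        · simp
      · rcases (Nx5 u hu).1 hdu with rfl | rfl
        · simp [hbJ, hvb]
        · simp
      · exact absurd h.2 hvd'
  obtain ⟨x6, hx6J, hbx6, hx46, hx56, Nx5⟩ :=
    dg_three'' (hd x5 hx5J x5p x5q) hbJ hwx5.symm hx4J hx45.symm hbx4
  have x6v : x6 ≠ v := by rintro rfl; exact x5n hx56.symm
  have x6n : ¬ G.Adj v x6 := step x5 x6 hx56 x5v x6v x5n b hvb hwx5 hbx6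
  obtain ⟨w6, hw6J, hvw6, hwx6⟩ := hT x6 hx6J x6v x6n
  have hw6 : c = w6 := by
    rcases (Nv w6 hw6J).1 hvw6 with h | h | h
    · subst h
      exact absurd rfl fun _ : (0 : ℕ) = 0 =>
        hG.quad w6 x4 x5 x6 hwx4 hx45 hx56 hwx6.symm hax5 hx46
    · subst h
      exact absurd rfl fun _ : (0 : ℕ) = 0 => hG.tri w6 x5 x6 hwx5 hx56 hwx6.symm
    · exact h.symm
  subst hw6
  have x6x3 : x6 ≠ x3 := by rintro rfl; exact hG.tri x6 x4 x5 hx34 hx45 hx56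
  have Na : ∀ u ∈ J, G.Adj a u ↔ u = v ∨ u = p ∨ u = x4 := by
    obtain ⟨y, hyJ, h4, h5, h6, h7⟩ :=
      dg_three'' (hNd a haJ hva) hv hva.symm hpJ hap hvp
    rcases (h7 x4 hx4J).1 hwx4 with h | h | h
    · exact absurd h x4v
    · exact absurd h x4p
    · rw [h]; exact h7
  have Nb : ∀ u ∈ J, G.Adj b u ↔ u = v ∨ u = x2 ∨ u = x5 := by
    obtain ⟨y, hyJ, h4, h5, h6, h7⟩ :=
      dg_three'' (hNd b hbJ hvb) hv hvb.symm hx2J hbx2 x2v.symm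
    rcases (h7 x5 hx5J).1 hwx5 with h | h | h
    · exact absurd h x5v
    · exact absurd h x5x2
    · rw [h]; exact h7
  have Nc : ∀ u ∈ J, G.Adj c u ↔ u = v ∨ u = x3 ∨ u = x6 := by
    obtain ⟨y, hyJ, h4, h5, h6, h7⟩ :=
      dg_three'' (hNd c hcJ hvc) hv hvc.symm hx3J hcx3 x3v.symm
    rcases (h7 x6 hx6J).1 hwx6 with h | h | h
    · exact absurd h x6v
    · exact absurd h x6x3
    · rw [h]; exact h7
  have hcov : ∀ u ∈ J, u = v ∨ u = a ∨ u = b ∨ u = c ∨ u = p ∨ u = x2 ∨ u = x3 ∨ u = x4 ∨ u = x5 ∨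
      u = x6 := by
    intro u hu
    by_cases huv : u = v
    · exact Or.inl huv
    by_cases hvu : G.Adj v u
    · rcases (Nv u hu).1 hvu with h | h | h <;> simp only [h, true_or, or_true]
    · obtain ⟨w, hw, hvw, hwu⟩ := hT u hu huv hvu
      rcases (Nv w hw).1 hvw with rfl | rfl | rfl
      · rcases (Na u hu).1 hwu with h | h | h <;> simp only [h, true_or, or_true]
      · rcases (Nb u hu).1 hwu with h | h | h <;> simp only [h, true_or, or_true]
      · rcases (Nc u hu).1 hwu with h | h | h <;> simp only [h, true_or, or_true]
  have hq6 : x6 = q := by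
    rcases hcov q hqJ with h | h | h | h | h | h | h | h | h | h
    · exact absurd h.symm hvq
    · exact absurd (h ▸ hva) hnq'
    · exact absurd (h ▸ hvb) hnq'
    · exact absurd (h ▸ hvc) hnq'
    · exact absurd h.symm hpq
    · exact absurd h.symm x2q
    · exact absurd h.symm x3q
    · exact absurd h.symm x4q
    · exact absurd h.symm x5q
    · exact h.symm
  have hcx5 : c ≠ x5 := by rintro rfl; exact x5n hvc
  have Nx6 : ∀ u ∈ J, G.Adj x6 u ↔ u = c ∨ u = x5 := by
    rw [hq6]
    obtain ⟨y, hyJ, hby, hx2y, h7⟩ := dg_two' hq2 hcJ (hq6 ▸ hwx6.symm)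
    rcases (h7 x5 hx5J).1 (hq6 ▸ hx56.symm) with h | h
    · exact absurd h.symm hcx5
    · rw [h]; exact h7
  refine iso_R hJ ![v, a, b, c, p, x2, x3, x4, x5, x6] ?_ ?_ ?_
  · intro i
    fin_cases i <;> assumption
  · intro u hu
    rcases hcov u hu with h | h | h | h | h | h | h | h | h | h
    · exact ⟨0, h.symm⟩
    · exact ⟨1, h.symm⟩
    · exact ⟨2, h.symm⟩
    · exact ⟨3, h.symm⟩
    · exact ⟨4, h.symm⟩
    · exact ⟨5, h.symm⟩
    · exact ⟨6, h.symm⟩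
    · exact ⟨7, h.symm⟩
    · exact ⟨8, h.symm⟩
    · exact ⟨9, h.symm⟩
  · intro i u hu
    fin_cases i
    · simpa [rtab] using Nv u hu
    · simpa [rtab] using Na u hu
    · simpa [rtab] using Nb u hu
    · simpa [rtab] using Nc u hu
    · simpa [rtab] using Np u hu
    · simpa [rtab] using Nx2 u hu
    · simpa [rtab] using Nx3 u hu
    · simpa [rtab] using Nx4 u hu
    · simpa [rtab] using Nx5 u hu
    · simpa [rtab] using Nx6 u hu

end RecogR

section LTwo
open Classical
set_option linter.unusedSectionVars false

variable {V : Type} [Fintype V]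

/-- removing a vertex and suppressing its three neighbours -/
theorem claw {j : ℕ} (hj : 1 ≤ j) {K : SimpleGraph V} {S : Finset V} {w a b c : V}
    (hw : w ∈ S) (haS : a ∈ S) (hbS : b ∈ S) (hcS : c ∈ S) (hab : a ≠ b) (hac : a ≠ c) (hbc : b ≠ c)
    (Nw : ∀ x ∈ S, K.Adj w x ↔ x = a ∨ x = b ∨ x = c)
    (nab : ¬ K.Adj a b) (nac : ¬ K.Adj a c) (nbc : ¬ K.Adj b c)
    (hd : ∀ v ∈ S, dg K S v = 3)
    (tri : ∀ t, (t = a ∨ t = b ∨ t = c) → ∀ x ∈ S, ∀ y ∈ S, x ≠ w → y ≠ w → K.Adj t x → K.Adj t y →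
      ¬ K.Adj x y)
    (quad : ∀ s t, (s = a ∨ s = b ∨ s = c) → (t = a ∨ t = b ∨ t = c) → s ≠ t → ∀ x ∈ S, ∀ y ∈ S,
      x ≠ w → y ≠ w → x ≠ y → K.Adj s x → K.Adj s y → K.Adj t x → K.Adj t y → False)
    (hC : Conn K (S.erase w)) :
    ∃ K' : SimpleGraph V,
      (∀ x ∈ (((S.erase w).erase c).erase b).erase a, ∀ y ∈ (((S.erase w).erase c).erase b).erase a,
        K'.Adj x y ↔ x ≠ y ∧
          (K.Adj x y ∨ ∃ t, (t = a ∨ t = b ∨ t = c) ∧ K.Adj x t ∧ K.Adj t y)) ∧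
      (∀ v ∈ (((S.erase w).erase c).erase b).erase a,
        dg K' ((((S.erase w).erase c).erase b).erase a) v = 3) ∧
      Conn K' ((((S.erase w).erase c).erase b).erase a) ∧
      (MemF j j (K'.induce (((((S.erase w).erase c).erase b).erase a : Finset V) : Set V)) →
        MemF (j + 1) (j + 1) (K.induce (S : Set V))) := by
  have hwa : K.Adj w a := (Nw a haS).2 (by simp)
  have hwb : K.Adj w b := (Nw b hbS).2 (by simp)
  have hwc : K.Adj w c := (Nw c hcS).2 (by simp)
  obtain ⟨a1, a2, ha1, ha2, hwa1, hwa2, ha12, aa1, aa2, Na⟩ := dg_three' (hd a haS) hw hwa.symm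
  obtain ⟨b1, b2, hb1, hb2, hwb1, hwb2, hb12, bb1, bb2, Nb⟩ := dg_three' (hd b hbS) hw hwb.symm
  obtain ⟨c1, c2, hc1, hc2, hwc1, hwc2, hc12, cc1, cc2, Nc⟩ := dg_three' (hd c hcS) hw hwc.symm
  have ne : ∀ {x y u : V}, ¬ K.Adj x y → K.Adj x u → u ≠ y := by
    rintro x y u h1 h2 rfl; exact h1 h2
  have nba : ¬ K.Adj b a := fun h => nab h.symm
  have nca : ¬ K.Adj c a := fun h => nac h.symm
  have ncb : ¬ K.Adj c b := fun h => nbc h.symm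
  have hsc : SupAt K (S.erase w) c c1 c2 := by
    refine ⟨by simp [hcS, hwc.ne'], by simp [hc1, hwc1.symm], by simp [hc2, hwc2.symm], hc12,
      tri c (by simp) c1 hc1 c2 hc2 hwc1.symm hwc2.symm cc1 cc2, ?_⟩
    intro x hx
    rw [Finset.mem_erase] at hx
    rw [Nc x hx.2]; simp [hx.1]
  have hsb : SupAt (unsub K c) ((S.erase w).erase c) b b1 b2 := by
    refine ⟨by simp [hbS, hwb.ne', hbc], by simp [hb1, hwb1.symm, ne nbc bb1],
      by simp [hb2, hwb2.symm, ne nbc bb2], hb12, ?_, ?_⟩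
    · rintro ⟨-, -, -, h | h⟩
      · exact tri b (by simp) b1 hb1 b2 hb2 hwb1.symm hwb2.symm bb1 bb2 h
      · exact quad b c (by simp) (by simp) hbc b1 hb1 b2 hb2 hwb1.symm hwb2.symm hb12 bb1 bb2
          h.1.symm h.2
    · intro x hx
      simp only [Finset.mem_erase] at hx
      have := Nb x hx.2.2
      rw [unsub_adj]
      constructor
      · rintro ⟨-, -, -, h | h⟩
        · rcases this.1 h with h | h
          · exact absurd h hx.2.1
          · exact h
        · exact absurd h.1 nbc
      · intro h
        have h' := this.2 (Or.inr h)
        exact ⟨hbc, hx.1, h'.ne, Or.inl h'⟩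
  have hsa : SupAt (unsub (unsub K c) b) (((S.erase w).erase c).erase b) a a1 a2 := by
    have key : ∀ x, (unsub (unsub K c) b).Adj a x → K.Adj a x := by
      rintro x ⟨-, -, -, h | h⟩
      · rcases h.2.2.2 with h | h
        · exact h
        · exact absurd h.1 nac
      · rcases h.1.2.2.2 with h | h
        · exact absurd h nab
        · exact absurd h.1 nac
    refine ⟨by simp [haS, hwa.ne', hab, hac], by simp [ha1, hwa1.symm, ne nac aa1, ne nab aa1],
      by simp [ha2, hwa2.symm, ne nac aa2, ne nab aa2], ha12, ?_, ?_⟩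
    · have h1 : ∀ t, (t = a ∨ t = b ∨ t = c) → a ≠ t → ¬ (K.Adj a1 t ∧ K.Adj t a2) := by
        intro t ht hat h
        exact quad a t (by simp) ht hat a1 ha1 a2 ha2 hwa1.symm hwa2.symm ha12 aa1 aa2
          h.1.symm h.2
      rintro ⟨-, -, -, h | h⟩
      · rcases h.2.2.2 with h | h
        · exact tri a (by simp) a1 ha1 a2 ha2 hwa1.symm hwa2.symm aa1 aa2 h
        · exact h1 c (by simp) hac h
      · rcases h.1.2.2.2 with h3 | h3
        · rcases h.2.2.2.2 with h4 | h4
          · exact h1 b (by simp) hab ⟨h3, h4⟩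
          · exact nbc h4.1
        · exact ncb h3.2
    · intro x hx
      simp only [Finset.mem_erase] at hx
      constructor
      · intro h
        rcases (Na x hx.2.2.2).1 (key x h) with h | h
        · exact absurd h hx.2.2.1
        · exact h
      · intro h
        have h' := (Na x hx.2.2.2).2 (Or.inr h)
        exact ⟨hab, hx.1, h'.ne, Or.inl ⟨hac, hx.2.1, h'.ne, Or.inl h'⟩⟩
  refine ⟨unsub (unsub (unsub K c) b) a, ?_, ?_, ?_, ?_⟩
  · intro x hx y hy
    simp only [Finset.mem_erase] at hx hy
    simp only [unsub_adj]
    constructor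
    · rintro ⟨h1, h2, h3, h⟩
      refine ⟨h3, ?_⟩
      rcases h with ⟨_, _, _, ⟨_, _, _, h | h⟩ | ⟨⟨_, _, _, h | h⟩, ⟨_, _, _, h' | h'⟩⟩⟩ |
        ⟨⟨_, _, _, ⟨_, _, _, h | h⟩ | ⟨⟨_, _, _, h | h⟩, ⟨_, _, _, h' | h'⟩⟩⟩,
          ⟨_, _, _, ⟨_, _, _, k | k⟩ | ⟨⟨_, _, _, k | k⟩, ⟨_, _, _, k' | k'⟩⟩⟩⟩
      · exact Or.inl h
      · exact Or.inr ⟨c, by simp, h⟩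
      · exact Or.inr ⟨b, by simp, h, h'⟩
      · exact absurd h'.1 nbc
      · exact absurd h.2 ncb
      · exact absurd h.2 ncb
      · exact Or.inr ⟨a, by simp, h, k⟩
      all_goals first
        | exact absurd k.1 nac
        | exact absurd k nab
        | exact absurd h.2 nca
        | exact absurd h' nba
        | exact absurd h'.1 nbc
    · rintro ⟨h3, h⟩
      refine ⟨hx.1, hy.1, h3, ?_⟩
      rcases h with h | ⟨t, rfl | rfl | rfl, h, h'⟩
      · exact Or.inl ⟨hx.2.1, hy.2.1, h3, Or.inl ⟨hx.2.2.1, hy.2.2.1, h3, Or.inl h⟩⟩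
      · exact Or.inr ⟨⟨hx.2.1, hab, hx.1, Or.inl ⟨hx.2.2.1, hac, hx.1, Or.inl h⟩⟩,
          ⟨hab, hy.2.1, Ne.symm hy.1, Or.inl ⟨hac, hy.2.2.1, Ne.symm hy.1, Or.inl h'⟩⟩⟩
      · exact Or.inl ⟨hx.2.1, hy.2.1, h3, Or.inr ⟨⟨hx.2.2.1, hbc, hx.2.1, Or.inl h⟩,
          ⟨hbc, hy.2.2.1, Ne.symm hy.2.1, Or.inl h'⟩⟩⟩
      · exact Or.inl ⟨hx.2.1, hy.2.1, h3, Or.inl ⟨hx.2.2.1, hy.2.2.1, h3, Or.inr ⟨h, h'⟩⟩⟩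
  · intro v hv
    simp only [Finset.mem_erase] at hv
    rw [hsa.dg_eq (by simp [hv]) hv.1, hsb.dg_eq (by simp [hv]) hv.2.1,
      hsc.dg_eq (by simp [hv]) hv.2.2.1, ← hd v hv.2.2.2.2]
    have : nb K (S.erase w) v = nb K S v := by
      ext u
      simp only [mem_nb, Finset.mem_erase]
      constructor
      · rintro ⟨h1, h2⟩; exact ⟨h1.2, h2⟩
      · rintro ⟨h1, h2⟩
        refine ⟨⟨?_, h1⟩, h2⟩
        rintro rfl
        rcases (Nw v hv.2.2.2.2).1 h2.symm with h | h | h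
        · exact hv.1 h
        · exact hv.2.1 h
        · exact hv.2.2.1 h
    unfold dg
    rw [this]
  · exact ((hC.unsub hsc.hz).unsub hsb.hz).unsub hsa.hz
  · intro hM
    exact circ_general hj hw hab hac hbc Nw hsc hsb hsa hM

theorem recog_L2 {G : SimpleGraph V} (hG : G5 G) {J : Finset V} (hJ : J.card = 13)
    (h2 : ∀ v ∈ J, 2 ≤ dg G J v) (h3 : ∀ v ∈ J, dg G J v ≤ 3)
    (hf : (J.filter (fun v => dg G J v = 2)).card = 1)
    (he : ∀ A ⊆ J, A.Nonempty → A ≠ J → 2 ≤ ∑ v ∈ A, dg G (J \ A) v) :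
    MemF 4 3 (G.induce (J : Set V)) := by
  obtain ⟨z, hz⟩ := Finset.card_eq_one.1 hf
  have hzm : ∀ v, v ∈ J ∧ dg G J v = 2 ↔ v = z := by
    intro v
    rw [← Finset.mem_filter (p := fun v => dg G J v = 2), hz]; simp
  obtain ⟨hzJ, hz2⟩ := (hzm z).2 rfl
  have hd : ∀ v ∈ J, v ≠ z → dg G J v = 3 := by
    intro v hv hvz
    have a1 := h2 v hv
    have a2 := h3 v hv
    have a3 : dg G J v ≠ 2 := fun h => hvz ((hzm v).1 ⟨hv, h⟩)
    omega
  obtain ⟨p, hp⟩ : (nb G J z).Nonempty := Finset.card_pos.1 (by unfold dg at hz2; omega)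
  rw [mem_nb] at hp
  obtain ⟨q, hqJ, hpq, hzq, Nz⟩ := dg_two' hz2 hp.1 hp.2
  have hs : SupAt G J z p q :=
    ⟨hzJ, hp.1, hqJ, hpq, fun h => hG.tri z p q hp.2 h hzq.symm, Nz⟩
  -- a far vertex
  obtain ⟨w, hwJ, hwz, hzw, hwf⟩ : ∃ w ∈ J, w ≠ z ∧ ¬ G.Adj z w ∧
      ∀ u, u ∈ J → G.Adj z u → ¬ G.Adj u w := by
    by_contra hcon
    push Not at hcon
    have hsub : J ⊆ insert z (nb G J z ∪ (nb G J z).biUnion (fun u => nb G J u)) := by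
      intro w hw
      simp only [Finset.mem_insert, Finset.mem_union, Finset.mem_biUnion, mem_nb]
      by_cases h1 : w = z
      · exact Or.inl h1
      by_cases h2 : G.Adj z w
      · exact Or.inr (Or.inl ⟨hw, h2⟩)
      obtain ⟨u, hu, h3, h4⟩ := hcon w hw h1 h2
      exact Or.inr (Or.inr ⟨u, ⟨hu, h3⟩, hw, h4⟩)
    have c1 := Finset.card_le_card hsub
    have c2 := Finset.card_insert_le z (nb G J z ∪ (nb G J z).biUnion (fun u => nb G J u))
    have c3 := Finset.card_union_le (nb G J z) ((nb G J z).biUnion (fun u => nb G J u))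
    have c4 : ((nb G J z).biUnion (fun u => nb G J u)).card ≤ (nb G J z).card * 3 := by
      apply Finset.card_biUnion_le_card_mul
      intro u hu
      exact h3 u (mem_nb.1 hu).1
    have c5 : (nb G J z).card = 2 := hz2
    omega
  obtain ⟨a, b, c, haJ, hbJ, hcJ, hab, hac, hbc, hwa, hwb, hwc, Nw⟩ := dg_three (hd w hwJ hwz)
  have hn : ∀ t, (t = a ∨ t = b ∨ t = c) → t ∈ J ∧ G.Adj w t ∧ t ≠ z ∧ ¬ G.Adj t z := by
    intro t ht
    have htJ : t ∈ J := by rcases ht with rfl | rfl | rfl <;> assumption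
    have hwt := (Nw t htJ).2 ht
    refine ⟨htJ, hwt, ?_, ?_⟩
    · rintro rfl; exact hzw hwt.symm
    · intro h; exact hwf t htJ h.symm hwt.symm
  have kt : ∀ t, (t = a ∨ t = b ∨ t = c) → ∀ x, (unsub G z).Adj t x → G.Adj t x := by
    rintro t ht x ⟨-, -, -, h | h⟩
    · exact h
    · exact absurd h.1 (hn t ht).2.2.2
  have nadj : ∀ s t, (s = a ∨ s = b ∨ s = c) → (t = a ∨ t = b ∨ t = c) → ¬ (unsub G z).Adj s t := by
    intro s t hs ht h
    exact hG.tri w s t (hn s hs).2.1 (kt s hs t h) (hn t ht).2.1.symm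
  have hCw : Conn G (J.erase w) := by
    intro X hX hne hcl
    by_contra hXne
    have hwX : w ∉ X := fun h => by simpa using hX h
    have hXJ : X ⊆ J := fun x hx => Finset.mem_of_mem_erase (hX hx)
    set Y := (J.erase w) \ X with hY
    have hYJ : Y ⊆ J := fun y hy => Finset.mem_of_mem_erase (Finset.mem_sdiff.1 hy).1
    have hwY : w ∉ Y := by simp [hY]
    have hYne : Y.Nonempty := by
      rw [hY, Finset.sdiff_nonempty]
      intro h
      exact hXne (Finset.Subset.antisymm hX h)
    have e1 := he X hXJ hne (by rintro rfl; exact hwX hwJ)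
    have e2 := he Y hYJ hYne (by intro h; rw [h] at hwY; exact hwY hwJ)
    have f1 : ∑ v ∈ X, dg G (J \ X) v ≤ ∑ v ∈ X, dg G {w} v := by
      apply Finset.sum_le_sum
      intro v hv
      apply Finset.card_le_card
      intro u hu
      rw [mem_nb] at hu ⊢
      refine ⟨?_, hu.2⟩
      have hu1 := Finset.mem_sdiff.1 hu.1
      by_contra huw
      exact hu1.2 (hcl v hv u (Finset.mem_erase.2 ⟨by simpa using huw, hu1.1⟩) hu.2)
    have f2 : ∑ v ∈ Y, dg G (J \ Y) v ≤ ∑ v ∈ Y, dg G {w} v := by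
      apply Finset.sum_le_sum
      intro v hv
      apply Finset.card_le_card
      intro u hu
      rw [mem_nb] at hu ⊢
      refine ⟨?_, hu.2⟩
      have hu1 := Finset.mem_sdiff.1 hu.1
      by_contra huw
      have huw' : u ∈ J.erase w := Finset.mem_erase.2 ⟨by simpa using huw, hu1.1⟩
      have huX : u ∈ X := by
        by_contra huX
        exact hu1.2 (Finset.mem_sdiff.2 ⟨huw', huX⟩)
      have hv' := Finset.mem_sdiff.1 hv
      exact hv'.2 (hcl u huX v hv'.1 hu.2.symm)
    rw [sum_dg_comm G X {w}, Finset.sum_singleton] at f1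
    rw [sum_dg_comm G Y {w}, Finset.sum_singleton] at f2
    have hdis : Disjoint X Y := Finset.disjoint_sdiff
    have g1 := dg_union G hdis w
    have g2 : dg G (X ∪ Y) w ≤ dg G J w := dg_mono G (Finset.union_subset hXJ hYJ) w
    have g3 := h3 w hwJ
    omega
  have hC : Conn (unsub G z) ((J.erase z).erase w) := by
    rw [Finset.erase_right_comm]
    exact hCw.unsub (Finset.mem_erase.2 ⟨hwz.symm, hzJ⟩)
  have er : ∀ t, (t = a ∨ t = b ∨ t = c) → t ∈ J.erase z := fun t ht =>
    Finset.mem_erase.2 ⟨(hn t ht).2.2.1, (hn t ht).1⟩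
  have hdK : ∀ v ∈ J.erase z, dg (unsub G z) (J.erase z) v = 3 := by
    intro v hv
    rw [Finset.mem_erase] at hv
    rw [hs.dg_eq hv.2 hv.1, hd v hv.2 hv.1]
  have hwS : w ∈ J.erase z := Finset.mem_erase.2 ⟨hwz, hwJ⟩
  obtain ⟨K', -, hK3, hKC, hKM⟩ := claw (j := 2) (by norm_num) (K := unsub G z) (S := J.erase z) hwS
    (er a (by simp)) (er b (by simp)) (er c (by simp)) hab hac hbc
    (by
      intro x hx
      rw [Finset.mem_erase] at hx
      rw [← Nw x hx.2, unsub_adj]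
      constructor
      · rintro ⟨-, -, -, h | h⟩
        · exact h
        · exact absurd h.1.symm hzw
      · intro h
        exact ⟨hwz, hx.1, h.ne, Or.inl h⟩)
    (nadj a b (by simp) (by simp)) (nadj a c (by simp) (by simp)) (nadj b c (by simp) (by simp))
    hdK
    (by
      intro t ht x hx y hy hxw hyw htx hty hxy
      rcases hxy with ⟨h1, h2, h3, h | h⟩
      · exact hG.tri t x y (kt t ht x htx) h (kt t ht y hty).symm
      · exact hG.quad t x z y (kt t ht x htx) h.1 h.2 (kt t ht y hty).symm (hn t ht).2.2.1 h3)
    (by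
      intro s t hs ht hst x hx y hy hxw hyw hxy h1 h2 h3 h4
      exact hG.quad s x t y (kt s hs x h1) (kt t ht x h3).symm (kt t ht y h4) (kt s hs y h2).symm hst hxy)
    hC
  apply subd_general (by norm_num) hs
  apply hKM
  apply F22 _ hKC hK3
  have hca : ∀ t, (t = a ∨ t = b ∨ t = c) → t ≠ w := fun t ht => (hn t ht).2.1.ne'
  rw [card_erase4 hwS, Finset.card_erase_of_mem hzJ, hJ]
  · simp only [Finset.mem_erase]
    exact ⟨hca c (by simp), (hn c (by simp)).2.2.1, hcJ⟩
  · simp only [Finset.mem_erase]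
    exact ⟨hbc, hca b (by simp), (hn b (by simp)).2.2.1, hbJ⟩
  · simp only [Finset.mem_erase]
    exact ⟨hab, hac, hca a (by simp), (hn a (by simp)).2.2.1, haJ⟩

end LTwo

section LOneA
open Classical
set_option linter.unusedSectionVars false

variable {V : Type} [Fintype V]

theorem small_cut {G : SimpleGraph V} (hG : G5 G) (hd : ∀ v, dg G Finset.univ v = 3)
    {A : Finset V} (hne : A.Nonempty) (hA : A.card ≤ 8) :
    3 ≤ ∑ v ∈ A, dg G (Finset.univ \ A) v := by
  by_contra hcut
  push Not at hcut
  set f : V → ℕ := fun v => dg G (Finset.univ \ A) v with hf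
  have hcut' : ∑ v ∈ A, f v ≤ 2 := by simpa [hf] using Nat.le_of_lt_succ hcut
  have hsum : ∀ v, dg G A v + f v = 3 := by
    intro v
    rw [← hd v, hf, ← dg_union G Finset.disjoint_sdiff, Finset.union_sdiff_of_subset (Finset.subset_univ _)]
  have hball : ∀ v ∈ A, f v = 0 → 10 ≤ A.card + ∑ u ∈ nb G A v, f u := by
    intro v hv h0
    have b1 := ball hG hv
    have b2 : ∑ u ∈ nb G A v, (dg G A u + f u) = 9 := by
      rw [Finset.sum_congr rfl (fun u _ => hsum u), Finset.sum_const]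
      have := hsum v
      have : (nb G A v).card = 3 := by
        have : dg G A v = 3 := by omega
        exact this
      rw [this]
      rfl
    rw [Finset.sum_add_distrib] at b2
    omega
  set T := A.filter (fun v => f v = 0) with hT
  have hTA : T ⊆ A := Finset.filter_subset _ _
  have t1 : A.card ≤ T.card + 2 := by
    have h1 : (A.filter (fun v => ¬ f v = 0)).card ≤ ∑ v ∈ A, f v := by
      rw [Finset.card_filter]
      apply Finset.sum_le_sum
      intro v _
      split_ifs <;> omega
    have h2 : T.card + (A.filter (fun v => ¬ f v = 0)).card = A.card := by
      rw [hT]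
      convert Finset.card_filter_add_card_filter_not (s := A) (fun v => f v = 0)
    omega
  have t2 : 2 * T.card ≤ 4 := by
    have s1 : 2 * T.card ≤ ∑ v ∈ T, ∑ u ∈ nb G A v, f u := by
      rw [mul_comm, ← smul_eq_mul, ← Finset.sum_const]
      apply Finset.sum_le_sum
      intro v hv
      have hv' := Finset.mem_filter.1 hv
      have := hball v hv'.1 hv'.2
      omega
    have s2 : ∑ v ∈ T, ∑ u ∈ nb G A v, f u ≤ ∑ v ∈ A, ∑ u ∈ nb G A v, f u :=
      Finset.sum_le_sum_of_subset hTA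
    have s3 : ∑ v ∈ A, ∑ u ∈ nb G A v, f u = ∑ u ∈ A, ∑ _v ∈ nb G A u, f u := by
      apply Finset.sum_comm'
      intro x y
      simp only [mem_nb]
      constructor
      · rintro ⟨h1, h2, h3⟩; exact ⟨⟨h1, h3.symm⟩, h2⟩
      · rintro ⟨⟨h1, h3⟩, h2⟩; exact ⟨h1, h2, h3.symm⟩
    have s4 : ∑ u ∈ A, ∑ _v ∈ nb G A u, f u ≤ ∑ u ∈ A, 2 * f u := by
      apply Finset.sum_le_sum
      intro u _
      rw [Finset.sum_const, smul_eq_mul]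
      have h1 := hsum u
      have h2 : (nb G A u).card = dg G A u := rfl
      rw [h2]
      rcases Nat.eq_zero_or_pos (f u) with h | h
      · rw [h]; omega
      · exact Nat.mul_le_mul_right _ (by omega)
    rw [← Finset.mul_sum] at s4
    omega
  have t3 : T = ∅ := by
    by_contra h
    obtain ⟨v, hv⟩ := Finset.nonempty_iff_ne_empty.2 h
    have hv' := Finset.mem_filter.1 hv
    have h1 := hball v hv'.1 hv'.2
    have h2 : ∑ u ∈ nb G A v, f u ≤ ∑ u ∈ A, f u :=
      Finset.sum_le_sum_of_subset (fun u hu => (mem_nb.1 hu).1)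
    omega
  have t4 : A.card ≤ 2 := by rw [t3] at t1; simpa using t1
  have t5 : ∀ v ∈ A, dg G A v + 1 ≤ A.card := by
    intro v hv
    have : nb G A v ⊆ A.erase v := by
      intro u hu
      rw [mem_nb] at hu
      exact Finset.mem_erase.2 ⟨hu.2.ne', hu.1⟩
    have h1 := Finset.card_le_card this
    rw [Finset.card_erase_of_mem hv] at h1
    have h2 := Finset.card_pos.2 hne
    unfold dg
    omega
  have t6 : ∀ v ∈ A, 2 ≤ f v + (A.card - 2) := by
    intro v hv
    have := t5 v hv
    have := hsum v
    omega
  obtain ⟨v, hv⟩ := hne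
  have hv1 : f v ≤ ∑ v ∈ A, f v := Finset.single_le_sum (fun _ _ => Nat.zero_le _) hv
  have hp := Finset.card_pos.2 ⟨v, hv⟩
  rcases (by omega : A.card = 1 ∨ A.card = 2) with h | h
  · have := t5 v hv
    have := hsum v
    omega
  · have h7 : ∑ v ∈ A, 2 ≤ ∑ v ∈ A, f v := by
      apply Finset.sum_le_sum
      intro v hv
      have := t6 v hv
      omega
    rw [Finset.sum_const, h] at h7
    simp only [smul_eq_mul] at h7
    omega

theorem three_edge {G : SimpleGraph V} (hG : G5 G) (hV : Fintype.card V = 16)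
    (hd : ∀ v, dg G Finset.univ v = 3)
    {A : Finset V} (hne : A.Nonempty) (hA : A ≠ Finset.univ) :
    3 ≤ ∑ v ∈ A, dg G (Finset.univ \ A) v := by
  rcases Nat.lt_or_ge 8 A.card with h | h
  · have h1 : (Finset.univ \ A).card ≤ 8 := by
      rw [Finset.card_sdiff_of_subset (Finset.subset_univ _), Finset.card_univ, hV]; omega
    have h2 : (Finset.univ \ A).Nonempty := by
      rw [Finset.sdiff_nonempty]
      intro h3
      exact hA (Finset.Subset.antisymm (Finset.subset_univ _) h3)
    have := small_cut hG hd h2 h1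
    rw [Finset.sdiff_sdiff_eq_self (Finset.subset_univ _)] at this
    rwa [sum_dg_comm]
  · exact small_cut hG hd hne h

theorem cut2 {G : SimpleGraph V} (hG : G5 G) (hV : Fintype.card V = 16)
    (hd : ∀ v, dg G Finset.univ v = 3) (l : List V) (hl : l.length < 16) (p q : V) (hpl : p ∈ l)
    (hcl : ∀ v ∈ l, v ≠ p → v ≠ q → ∀ u, G.Adj v u → u ∈ l)
    (hp : ∃ x ∈ l, ∃ y ∈ l, x ≠ y ∧ G.Adj p x ∧ G.Adj p y)
    (hq : ∃ x ∈ l, ∃ y ∈ l, x ≠ y ∧ G.Adj q x ∧ G.Adj q y) : False := by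
  set A := l.toFinset with hAdef
  have hAc : A.card < 16 := lt_of_le_of_lt (List.toFinset_card_le l) hl
  have h3 := three_edge hG hV hd (A := A) ⟨p, by simpa [hAdef] using hpl⟩ (by
    intro h
    rw [h, Finset.card_univ, hV] at hAc
    omega)
  have one : ∀ p, (∃ x ∈ l, ∃ y ∈ l, x ≠ y ∧ G.Adj p x ∧ G.Adj p y) →
      dg G (Finset.univ \ A) p ≤ 1 := by
    rintro p ⟨x, hx, y, hy, hxy, hpx, hpy⟩
    have h1 := dg_union G (Finset.disjoint_sdiff (s := A) (t := Finset.univ)) p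
    rw [Finset.union_sdiff_of_subset (Finset.subset_univ _), hd p] at h1
    have h2 : ({x, y} : Finset V) ⊆ nb G A p := by
      intro u hu
      rw [mem_nb]
      simp only [Finset.mem_insert, Finset.mem_singleton] at hu
      rcases hu with rfl | rfl
      · exact ⟨by simpa [hAdef] using hx, hpx⟩
      · exact ⟨by simpa [hAdef] using hy, hpy⟩
    have h4 := Finset.card_le_card h2
    rw [Finset.card_pair hxy] at h4
    have : (nb G A p).card = dg G A p := rfl
    omega
  have h5 : ∑ v ∈ A, dg G (Finset.univ \ A) v ≤ ∑ v ∈ {p, q}, dg G (Finset.univ \ A) v := by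
    have e : ∑ v ∈ A, dg G (Finset.univ \ A) v
        = ∑ v ∈ A.filter (fun v => v = p ∨ v = q), dg G (Finset.univ \ A) v := by
      rw [Finset.sum_filter_of_ne]
      intro v hv hne
      by_contra hc
      push Not at hc
      apply hne
      apply Finset.card_eq_zero.2
      rw [Finset.eq_empty_iff_forall_notMem]
      intro u hu
      rw [mem_nb, Finset.mem_sdiff] at hu
      apply hu.1.2
      have := hcl v (by simpa [hAdef] using hv) hc.1 hc.2 u hu.2
      simpa [hAdef] using this
    rw [e]
    apply Finset.sum_le_sum_of_subset
    intro v hv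
    have := (Finset.mem_filter.1 hv).2
    simpa using this
  have h6 : ∑ v ∈ {p, q}, dg G (Finset.univ \ A) v ≤ 2 := by
    by_cases hpq : p = q
    · subst hpq
      have := one p hp
      simp only [Finset.insert_eq_of_mem, Finset.mem_singleton, Finset.sum_singleton]
      omega
    · rw [Finset.sum_pair hpq]
      have := one p hp
      have := one q hq
      omega
  omega

theorem third {G : SimpleGraph V} (hd : ∀ v, dg G Finset.univ v = 3) {v a b : V}
    (ha : G.Adj v a) (hb : G.Adj v b) (hab : a ≠ b) :
    ∃ c, a ≠ c ∧ b ≠ c ∧ G.Adj v c ∧ ∀ u, G.Adj v u ↔ u = a ∨ u = b ∨ u = c := by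
  obtain ⟨c, -, h1, h2, h3, h4⟩ := dg_three'' (hd v) (Finset.mem_univ _) ha (Finset.mem_univ _) hb hab
  exact ⟨c, h1, h2, h3, fun u => h4 u (Finset.mem_univ _)⟩

theorem three_iff {G : SimpleGraph V} (hd : ∀ v, dg G Finset.univ v = 3) {v a b c : V}
    (ha : G.Adj v a) (hb : G.Adj v b) (hc : G.Adj v c) (hab : a ≠ b) (hac : a ≠ c) (hbc : b ≠ c) :
    ∀ u, G.Adj v u ↔ u = a ∨ u = b ∨ u = c := by
  obtain ⟨c', h1, h2, h3, h4⟩ := third hd ha hb hab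
  rcases (h4 c).1 hc with h | h | h
  · exact absurd h.symm hac
  · exact absurd h.symm hbc
  · rw [h]; exact h4

def BadI (G : SimpleGraph V) (w1 a w2 : V) : Prop :=
  ∃ a' b d u v, G.Adj a a' ∧ a' ≠ w1 ∧ a' ≠ w2 ∧ G.Adj w1 b ∧ b ≠ a ∧ G.Adj w2 d ∧ d ≠ a ∧
    G.Adj b d ∧ G.Adj b u ∧ G.Adj u a' ∧ G.Adj d v ∧ G.Adj v a'

def BadII (G : SimpleGraph V) (w1 a w2 : V) : Prop :=
  ∃ b c d e u v, G.Adj w1 b ∧ G.Adj w1 c ∧ G.Adj w2 d ∧ G.Adj w2 e ∧ b ≠ c ∧ d ≠ e ∧ b ≠ a ∧ c ≠ a ∧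
    d ≠ a ∧ e ≠ a ∧ G.Adj b d ∧ G.Adj c e ∧ G.Adj b u ∧ G.Adj u e ∧ G.Adj d v ∧ G.Adj v c

structure Cfg (G : SimpleGraph V) (x0 x1 x2 x3 x4 x5 x6 x7 : V) : Prop where
  N0 : ∀ u, G.Adj x0 u ↔ u = x1 ∨ u = x7 ∨ u = x4
  N2 : ∀ u, G.Adj x2 u ↔ u = x3 ∨ u = x1 ∨ u = x6
  N4 : ∀ u, G.Adj x4 u ↔ u = x5 ∨ u = x3 ∨ u = x0
  N6 : ∀ u, G.Adj x6 u ↔ u = x7 ∨ u = x5 ∨ u = x2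
  n02 : x0 ≠ x2
  n24 : x2 ≠ x4
  n46 : x4 ≠ x6
  n60 : x6 ≠ x0

theorem Cfg.rot {G : SimpleGraph V} {x0 x1 x2 x3 x4 x5 x6 x7 : V}
    (h : Cfg G x0 x1 x2 x3 x4 x5 x6 x7) : Cfg G x2 x3 x4 x5 x6 x7 x0 x1 :=
  ⟨h.N2, h.N4, h.N6, h.N0, h.n24, h.n46, h.n60, h.n02⟩

theorem Cfg.refl {G : SimpleGraph V} {x0 x1 x2 x3 x4 x5 x6 x7 : V}
    (h : Cfg G x0 x1 x2 x3 x4 x5 x6 x7) : Cfg G x0 x7 x6 x5 x4 x3 x2 x1 :=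
  ⟨fun u => by rw [h.N0]; tauto, fun u => by rw [h.N6]; tauto, fun u => by rw [h.N4]; tauto,
    fun u => by rw [h.N2]; tauto, h.n60.symm, h.n46.symm, h.n24.symm, h.n02.symm⟩

theorem Cfg.step {G : SimpleGraph V} (hG : G5 G) (hd : ∀ v, dg G Finset.univ v = 3)
    {x0 x1 x2 x3 x4 x5 x6 x7 : V}
    (h : Cfg G x0 x1 x2 x3 x4 x5 x6 x7) {o : V} (ho : G.Adj x1 o) (ho0 : o ≠ x0) (ho2 : o ≠ x2)
    (hb : BadI G o x1 x0) :
    G.Adj o x5 ∨ ∃ e, G.Adj e x3 ∧ G.Adj e x7 ∧ G.Adj o e := by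
  have a01 : G.Adj x0 x1 := (h.N0 x1).2 (by simp)
  have a07 : G.Adj x0 x7 := (h.N0 x7).2 (by simp)
  have a04 : G.Adj x0 x4 := (h.N0 x4).2 (by simp)
  have a21 : G.Adj x2 x1 := (h.N2 x1).2 (by simp)
  have a23 : G.Adj x2 x3 := (h.N2 x3).2 (by simp)
  have a43 : G.Adj x4 x3 := (h.N4 x3).2 (by simp)
  have a45 : G.Adj x4 x5 := (h.N4 x5).2 (by simp)
  have a65 : G.Adj x6 x5 := (h.N6 x5).2 (by simp)
  have a67 : G.Adj x6 x7 := (h.N6 x7).2 (by simp)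
  have N1 := three_iff hd a01.symm a21.symm ho h.n02 ho0.symm ho2.symm
  obtain ⟨m, b, d, u, v, h1, h2, h3, h4, h5, h6, h7, h8, h9, h10, h11, h12⟩ := hb
  obtain rfl : m = x2 := by
    rcases (N1 m).1 h1 with h | h | h
    · exact absurd h h3
    · exact h
    · exact absurd h h2
  have u1 : u ≠ x1 := by
    rintro rfl
    rcases (N1 b).1 h9.symm with rfl | rfl | rfl
    · exact hG.tri _ _ _ h4 h9 ho
    · exact hG.tri _ _ _ h4 h9 ho
    · exact h4.ne rfl
  have v1 : v ≠ x1 := by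
    rintro rfl
    exact hG.tri _ _ _ a01 h11.symm h6.symm
  have uv : u ≠ v := by
    rintro rfl
    exact hG.tri _ _ _ h8 h11 h9.symm
  have n74 : x7 ≠ x4 := by
    rintro rfl
    exact hG.tri _ _ _ a67 a45 a65.symm
  have n30 : x3 ≠ x0 := by
    rintro rfl
    exact hG.tri _ _ _ a01 a21.symm a23
  rcases (h.N0 d).1 h6 with rfl | rfl | rfl
  · exact absurd rfl h7
  · rcases (h.N2 v).1 h12.symm with rfl | rfl | rfl
    · exact (hG.quad _ _ _ _ h11 a43.symm a04.symm a07 n74 n30).elim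
    · exact absurd rfl v1
    · rcases (h.N2 u).1 h10.symm with rfl | rfl | rfl
      · exact Or.inr ⟨b, h9, h8, h4⟩
      · exact absurd rfl u1
      · exact absurd rfl uv
  · rcases (h.N2 v).1 h12.symm with rfl | rfl | rfl
    · rcases (h.N2 u).1 h10.symm with rfl | rfl | rfl
      · exact absurd rfl uv
      · exact absurd rfl u1
      · rcases (h.N6 b).1 h9.symm with rfl | rfl | rfl
        · exact (hG.tri _ _ _ a07 h8 a04.symm).elim
        · exact Or.inl h4
        · exact (hG.tri _ _ _ a23 a43.symm h8.symm).elim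
    · exact absurd rfl v1
    · exact (hG.tri _ _ _ h11 a65 a45.symm).elim

theorem Cfg.closed {G : SimpleGraph V} (hG : G5 G) (hV : Fintype.card V = 16)
    (hd : ∀ v, dg G Finset.univ v = 3) {x0 x1 x2 x3 x4 x5 x6 x7 : V}
    (h : Cfg G x0 x1 x2 x3 x4 x5 x6 x7) {c e : V} (c1 : G.Adj c x1) (c5 : G.Adj c x5)
    (e3 : G.Adj e x3) (e7 : G.Adj e x7) : False := by
  have a01 : G.Adj x0 x1 := (h.N0 x1).2 (by simp)
  have a07 : G.Adj x0 x7 := (h.N0 x7).2 (by simp)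
  have a04 : G.Adj x0 x4 := (h.N0 x4).2 (by simp)
  have a21 : G.Adj x2 x1 := (h.N2 x1).2 (by simp)
  have a23 : G.Adj x2 x3 := (h.N2 x3).2 (by simp)
  have a26 : G.Adj x2 x6 := (h.N2 x6).2 (by simp)
  have a43 : G.Adj x4 x3 := (h.N4 x3).2 (by simp)
  have a45 : G.Adj x4 x5 := (h.N4 x5).2 (by simp)
  have a65 : G.Adj x6 x5 := (h.N6 x5).2 (by simp)
  have a67 : G.Adj x6 x7 := (h.N6 x7).2 (by simp)
  have c0 : c ≠ x0 := by rintro rfl; exact hG.tri _ _ _ c5 a45.symm a04.symm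
  have c2 : c ≠ x2 := by rintro rfl; exact hG.tri _ _ _ c5 a65.symm a26.symm
  have c4 : c ≠ x4 := by rintro rfl; exact hG.tri _ _ _ c1 a01.symm a04
  have c6 : c ≠ x6 := by rintro rfl; exact hG.tri _ _ _ c1 a21.symm a26
  have e0 : e ≠ x0 := by rintro rfl; exact hG.tri _ _ _ e3 a43.symm a04.symm
  have e2 : e ≠ x2 := by rintro rfl; exact hG.tri _ _ _ e7 a67.symm a26.symm
  have e4 : e ≠ x4 := by rintro rfl; exact hG.tri _ _ _ e7 a07.symm a04
  have e6 : e ≠ x6 := by rintro rfl; exact hG.tri _ _ _ e3 a23.symm a26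
  have N1 := three_iff hd a01.symm a21.symm c1.symm h.n02 c0.symm c2.symm
  have N3 := three_iff hd a23.symm a43.symm e3.symm h.n24 e2.symm e4.symm
  have N5 := three_iff hd a45.symm a65.symm c5.symm h.n46 c4.symm c6.symm
  have N7 := three_iff hd a67.symm a07.symm e7.symm h.n60 e6.symm e0.symm
  refine cut2 hG hV hd [x0, x1, x2, x3, x4, x5, x6, x7, c, e] (by simp) c e (by simp) ?_
    ⟨x1, by simp, x5, by simp, ?_, c1, c5⟩ ⟨x3, by simp, x7, by simp, ?_, e3, e7⟩
  · have w : ∀ {v p q r : V} {l : List V}, (∀ u, G.Adj v u ↔ u = p ∨ u = q ∨ u = r) →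
        p ∈ l → q ∈ l → r ∈ l → ∀ u, G.Adj v u → u ∈ l := by
      intro v p q r l hv hp hq hr u hu
      rcases (hv u).1 hu with rfl | rfl | rfl <;> assumption
    simp only [List.forall_mem_cons]
    refine ⟨fun _ _ => w h.N0 ?_ ?_ ?_, fun _ _ => w N1 ?_ ?_ ?_, fun _ _ => w h.N2 ?_ ?_ ?_,
      fun _ _ => w N3 ?_ ?_ ?_, fun _ _ => w h.N4 ?_ ?_ ?_, fun _ _ => w N5 ?_ ?_ ?_,
      fun _ _ => w h.N6 ?_ ?_ ?_, fun _ _ => w N7 ?_ ?_ ?_, fun hn => absurd rfl hn,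
      fun _ hn => absurd rfl hn, by simp⟩
    all_goals simp
  · rintro rfl; exact hG.tri _ _ _ a01 a45.symm a04.symm
  · rintro rfl; exact hG.tri _ _ _ a07 a43.symm a04.symm

theorem Cfg.false1 {G : SimpleGraph V} (hG : G5 G) (hV : Fintype.card V = 16)
    (hd : ∀ v, dg G Finset.univ v = 3)
    (hall : ∀ w1 a w2, G.Adj w1 a → G.Adj a w2 → w1 ≠ w2 → BadI G w1 a w2)
    {x0 x1 x2 x3 x4 x5 x6 x7 : V}
    (h : Cfg G x0 x1 x2 x3 x4 x5 x6 x7) {c : V} (c1 : G.Adj c x1) (c5 : G.Adj c x5) : False := by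
  have a01 : G.Adj x0 x1 := (h.N0 x1).2 (by simp)
  have a07 : G.Adj x0 x7 := (h.N0 x7).2 (by simp)
  have a04 : G.Adj x0 x4 := (h.N0 x4).2 (by simp)
  have a21 : G.Adj x2 x1 := (h.N2 x1).2 (by simp)
  have a23 : G.Adj x2 x3 := (h.N2 x3).2 (by simp)
  have a43 : G.Adj x4 x3 := (h.N4 x3).2 (by simp)
  have a45 : G.Adj x4 x5 := (h.N4 x5).2 (by simp)
  have a65 : G.Adj x6 x5 := (h.N6 x5).2 (by simp)
  have a67 : G.Adj x6 x7 := (h.N6 x7).2 (by simp)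
  obtain ⟨o7, p6, p0, q7, -⟩ := third hd a67.symm a07.symm h.n60
  obtain ⟨o3, p2, p4, q3, -⟩ := third hd a23.symm a43.symm h.n24
  have s7 := h.refl.step hG hd q7 p0.symm p6.symm (hall _ _ _ q7.symm a07.symm p0.symm)
  have s3 := h.rot.step hG hd q3 p2.symm p4.symm (hall _ _ _ q3.symm a23.symm p2.symm)
  rcases s7 with s7 | ⟨e, e1, e2, e3⟩
  · exact h.closed hG hV hd c1 c5 s7 q7.symm
  rcases s3 with s3 | ⟨f, f1, f2, f3⟩
  · exact h.closed hG hV hd c1 c5 q3.symm s3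
  have n15 : x1 ≠ x5 := by rintro rfl; exact hG.tri _ _ _ a01 a45.symm a04.symm
  have ec : e = c := by
    by_contra hne
    exact hG.quad e x5 c x1 e1 c5.symm c1 e2.symm hne n15.symm
  have fc : f = c := by
    by_contra hne
    exact hG.quad f x5 c x1 f1 c5.symm c1 f2.symm hne n15.symm
  subst ec
  subst fc
  have h71 : o7 ≠ x1 := by rintro rfl; exact hG.tri _ _ _ a01 q7.symm a07.symm
  have h75 : o7 ≠ x5 := by rintro rfl; exact hG.tri _ _ _ a65 q7.symm a67.symm
  have h31 : o3 ≠ x1 := by rintro rfl; exact hG.tri _ _ _ a21 q3.symm a23.symm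
  have h35 : o3 ≠ x5 := by rintro rfl; exact hG.tri _ _ _ a45 q3.symm a43.symm
  have N := three_iff hd c1 c5 e3.symm n15 h71.symm h75.symm
  rcases (N o3).1 f3.symm with h1 | h1 | h1
  · exact h31 h1
  · exact h35 h1
  · subst h1
    exact h.closed hG hV hd c1 c5 q3.symm q7.symm

theorem Cfg.false {G : SimpleGraph V} (hG : G5 G) (hV : Fintype.card V = 16)
    (hd : ∀ v, dg G Finset.univ v = 3)
    (hall : ∀ w1 a w2, G.Adj w1 a → G.Adj a w2 → w1 ≠ w2 → BadI G w1 a w2)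
    {x0 x1 x2 x3 x4 x5 x6 x7 : V}
    (h : Cfg G x0 x1 x2 x3 x4 x5 x6 x7) : False := by
  have a01 : G.Adj x0 x1 := (h.N0 x1).2 (by simp)
  have a21 : G.Adj x2 x1 := (h.N2 x1).2 (by simp)
  obtain ⟨o, p0, p2, q, -⟩ := third hd a01.symm a21.symm h.n02
  rcases h.step hG hd q p0.symm p2.symm (hall _ _ _ q.symm a01.symm p0.symm) with s | ⟨e, e1, e2, e3⟩
  · exact h.false1 hG hV hd hall q.symm s
  · exact h.rot.false1 hG hV hd hall e1 e2

theorem BadI.cfg {G : SimpleGraph V} (hG : G5 G) (hd : ∀ v, dg G Finset.univ v = 3) {w1 a w2 : V}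
    (h1 : G.Adj w1 a) (h2 : G.Adj a w2) (h12 : w1 ≠ w2) (h : BadI G w1 a w2) :
    ∃ b u a' v d, Cfg G a w1 b u a' v d w2 := by
  obtain ⟨a', b, d, u, v, k1, k2, k3, k4, k5, k6, k7, k8, k9, k10, k11, k12⟩ := h
  have da : d ≠ a' := by rintro rfl; exact hG.tri _ _ _ k1 k6.symm h2.symm
  have ba : b ≠ a' := by rintro rfl; exact hG.tri _ _ _ k1 k4.symm h1
  have u1 : u ≠ w1 := by rintro rfl; exact hG.tri _ _ _ h1 k1 k10.symm
  have v1 : v ≠ w2 := by rintro rfl; exact hG.tri _ _ _ h2 k12 k1.symm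
  have uv : u ≠ v := by rintro rfl; exact hG.tri _ _ _ k8 k11 k9.symm
  have ua : u ≠ a := by rintro rfl; exact hG.tri _ _ _ h1 k9.symm k4.symm
  have va : v ≠ a := by rintro rfl; exact hG.tri _ _ _ h2 k6 k11
  have ud : u ≠ d := by rintro rfl; exact hG.quad _ _ _ _ k10 k1.symm h2 k6 k7 k3
  have vb : v ≠ b := by rintro rfl; exact hG.quad _ _ _ _ k12 k1.symm h1.symm k4 k5 k2
  have w1d : w1 ≠ d := by rintro rfl; exact hG.tri _ _ _ h1 h2 k6
  have w2b : w2 ≠ b := by rintro rfl; exact hG.tri _ _ _ h1 h2 k4.symm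
  exact ⟨b, u, a', v, d, three_iff hd h1.symm h2 k1 h12 k2.symm k3.symm,
    three_iff hd k9 k4.symm k8 u1 ud w1d, three_iff hd k12.symm k10.symm k1.symm uv.symm va ua,
    three_iff hd k6.symm k11 k8.symm v1.symm w2b vb, k5.symm, ba, da.symm, k7⟩

theorem BadII.pent {G : SimpleGraph V} (hG : G5 G) (hV : Fintype.card V = 16)
    (hd : ∀ v, dg G Finset.univ v = 3) {w1 a w2 : V}
    (h1 : G.Adj w1 a) (h2 : G.Adj a w2) (h12 : w1 ≠ w2) (h : BadII G w1 a w2) {a' : V}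
    (h3 : G.Adj a a') (h31 : a' ≠ w1) (h32 : a' ≠ w2) {x y : V} (hx : G.Adj w1 x) (hxa : x ≠ a)
    (hy : G.Adj a' y) (hya : y ≠ a) (hxy : G.Adj x y) : False := by
  obtain ⟨b, c, d, e, u, v, k1, k2, k3, k4, k5, k6, k7, k8, k9, k10, k11, k12, k13, k14, k15, k16⟩ := h
  have uv : u ≠ v := by rintro rfl; exact hG.tri _ _ _ k11 k15 k13.symm
  have uw : u ≠ w1 := by rintro rfl; exact hG.tri _ _ _ k2 k12 k14.symm
  have vw : v ≠ w1 := by rintro rfl; exact hG.tri _ _ _ k1 k11 k15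
  have uw2 : u ≠ w2 := by rintro rfl; exact hG.tri _ _ _ k11 k3.symm k13.symm
  have vw2 : v ≠ w2 := by rintro rfl; exact hG.tri _ _ _ k12 k4.symm k16
  have ud : u ≠ d := by rintro rfl; exact hG.tri _ _ _ k3 k14 k4.symm
  have ve : v ≠ e := by rintro rfl; exact hG.tri _ _ _ k3 k15 k4.symm
  have uc : u ≠ c := by rintro rfl; exact hG.tri _ _ _ k1 k13 k2.symm
  have vb : v ≠ b := by rintro rfl; exact hG.tri _ _ _ k1 k16 k2.symm
  have bd' : w1 ≠ d := by rintro rfl; exact hG.tri _ _ _ h1 h2 k3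
  have be' : w1 ≠ e := by rintro rfl; exact hG.tri _ _ _ h1 h2 k4
  have w2b : w2 ≠ b := by rintro rfl; exact hG.tri _ _ _ h1 h2 k1.symm
  have w2c : w2 ≠ c := by rintro rfl; exact hG.tri _ _ _ h1 h2 k2.symm
  have Nw1 := three_iff hd h1 k1 k2 k7.symm k8.symm k5
  have Nw2 := three_iff hd h2.symm k3 k4 k9.symm k10.symm k6
  have Na := three_iff hd h1.symm h2 h3 h12 h31.symm h32.symm
  have Nb := three_iff hd k1.symm k11 k13 bd' uw.symm ud.symm
  have Nc := three_iff hd k2.symm k12 k16.symm be' vw.symm ve.symm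
  have Nd := three_iff hd k3.symm k11.symm k15 w2b vw2.symm vb.symm
  have Ne := three_iff hd k4.symm k12.symm k14.symm w2c uw2.symm uc.symm
  have be : b ≠ e := by rintro rfl; exact hG.tri _ _ _ k1 k12.symm k2.symm
  have dc : d ≠ c := by rintro rfl; exact hG.tri _ _ _ k1 k11 k2.symm
  have w : ∀ {v p q r : V} {l : List V}, (∀ u, G.Adj v u ↔ u = p ∨ u = q ∨ u = r) →
      p ∈ l → q ∈ l → r ∈ l → ∀ u, G.Adj v u → u ∈ l := by
    intro v p q r l hv hp hq hr u hu
    rcases (hv u).1 hu with rfl | rfl | rfl <;> assumption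
  have ua : a ≠ u := by rintro rfl; exact hG.tri _ _ _ h1 k13.symm k1.symm
  have va : a ≠ v := by rintro rfl; exact hG.tri _ _ _ h1 k16 k2.symm
  have key : a' ≠ u ∧ a' ≠ v ∧ ¬ G.Adj a' u ∧ ¬ G.Adj a' v := by
    refine ⟨?_, ?_, ?_, ?_⟩
    · rintro rfl
      refine cut2 hG hV hd [w1, w2, a, b, c, d, e, a', v] (by simp) a' v (by simp) ?_
        ⟨b, by simp, e, by simp, be, k13.symm, k14⟩ ⟨d, by simp, c, by simp, dc, k15.symm, k16⟩
      simp only [List.forall_mem_cons]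
      refine ⟨fun _ _ => w Nw1 ?_ ?_ ?_, fun _ _ => w Nw2 ?_ ?_ ?_, fun _ _ => w Na ?_ ?_ ?_,
        fun _ _ => w Nb ?_ ?_ ?_, fun _ _ => w Nc ?_ ?_ ?_, fun _ _ => w Nd ?_ ?_ ?_,
        fun _ _ => w Ne ?_ ?_ ?_, fun hn => absurd rfl hn, fun _ hn => absurd rfl hn, by simp⟩
      all_goals simp
    · rintro rfl
      refine cut2 hG hV hd [w1, w2, a, b, c, d, e, u, a'] (by simp) u a' (by simp) ?_
        ⟨b, by simp, e, by simp, be, k13.symm, k14⟩ ⟨d, by simp, c, by simp, dc, k15.symm, k16⟩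
      simp only [List.forall_mem_cons]
      refine ⟨fun _ _ => w Nw1 ?_ ?_ ?_, fun _ _ => w Nw2 ?_ ?_ ?_, fun _ _ => w Na ?_ ?_ ?_,
        fun _ _ => w Nb ?_ ?_ ?_, fun _ _ => w Nc ?_ ?_ ?_, fun _ _ => w Nd ?_ ?_ ?_,
        fun _ _ => w Ne ?_ ?_ ?_, fun hn => absurd rfl hn, fun _ hn => absurd rfl hn, by simp⟩
      all_goals simp
    · intro hau
      by_cases hbe : a' = b ∨ a' = e
      · rcases hbe with rfl | rfl
        · exact hG.tri _ _ _ h1 h3 k1.symm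
        · exact hG.tri _ _ _ h2 k4 h3.symm
      push Not at hbe
      have Nu := three_iff hd k13.symm k14 hau.symm be hbe.1.symm hbe.2.symm
      refine cut2 hG hV hd [w1, w2, a, b, c, d, e, u, v, a'] (by simp) v a' (by simp) ?_
        ⟨d, by simp, c, by simp, dc, k15.symm, k16⟩ ⟨a, by simp, u, by simp, ua, h3.symm, hau⟩
      simp only [List.forall_mem_cons]
      refine ⟨fun _ _ => w Nw1 ?_ ?_ ?_, fun _ _ => w Nw2 ?_ ?_ ?_, fun _ _ => w Na ?_ ?_ ?_,
        fun _ _ => w Nb ?_ ?_ ?_, fun _ _ => w Nc ?_ ?_ ?_, fun _ _ => w Nd ?_ ?_ ?_,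
        fun _ _ => w Ne ?_ ?_ ?_, fun _ _ => w Nu ?_ ?_ ?_, fun hn => absurd rfl hn,
        fun _ hn => absurd rfl hn, by simp⟩
      all_goals simp
    · intro hav
      by_cases hdc : a' = d ∨ a' = c
      · rcases hdc with rfl | rfl
        · exact hG.tri _ _ _ h2 k3 h3.symm
        · exact hG.tri _ _ _ h1 h3 k2.symm
      push Not at hdc
      have Nv := three_iff hd k15.symm k16 hav.symm dc hdc.1.symm hdc.2.symm
      refine cut2 hG hV hd [w1, w2, a, b, c, d, e, u, v, a'] (by simp) u a' (by simp) ?_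
        ⟨b, by simp, e, by simp, be, k13.symm, k14⟩ ⟨a, by simp, v, by simp, va, h3.symm, hav⟩
      simp only [List.forall_mem_cons]
      refine ⟨fun _ _ => w Nw1 ?_ ?_ ?_, fun _ _ => w Nw2 ?_ ?_ ?_, fun _ _ => w Na ?_ ?_ ?_,
        fun _ _ => w Nb ?_ ?_ ?_, fun _ _ => w Nc ?_ ?_ ?_, fun _ _ => w Nd ?_ ?_ ?_,
        fun _ _ => w Ne ?_ ?_ ?_, fun hn => absurd rfl hn, fun _ _ => w Nv ?_ ?_ ?_,
        fun _ hn => absurd rfl hn, by simp⟩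
      all_goals simp
  obtain ⟨z1, z2, z3, z4⟩ := key
  have hyw : ¬ G.Adj a' w1 := fun hc => hG.tri _ _ _ h1 h3 hc
  rcases (Nw1 x).1 hx with rfl | rfl | rfl
  · exact hxa rfl
  · rcases (Nb y).1 hxy with rfl | rfl | rfl
    · exact hyw hy
    · rcases (Nd a').1 hy.symm with rfl | rfl | rfl
      · exact h32 rfl
      · exact hG.tri _ _ _ h1 h3 hx.symm
      · exact z2 rfl
    · exact z3 hy
  · rcases (Nc y).1 hxy with rfl | rfl | rfl
    · exact hyw hy
    · rcases (Ne a').1 hy.symm with rfl | rfl | rfl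
      · exact h32 rfl
      · exact hG.tri _ _ _ h1 h3 hx.symm
      · exact z1 rfl
    · exact z4 hy

theorem good_exists {G : SimpleGraph V} (hG : G5 G) (hV : Fintype.card V = 16)
    (hd : ∀ v, dg G Finset.univ v = 3) :
    ∃ w1 a w2, G.Adj w1 a ∧ G.Adj a w2 ∧ w1 ≠ w2 ∧ ¬ BadI G w1 a w2 ∧ ¬ BadII G w1 a w2 := by
  by_contra hcon
  push Not at hcon
  have hall : ∀ w1 a w2, G.Adj w1 a → G.Adj a w2 → w1 ≠ w2 → BadI G w1 a w2 := by
    intro w1 a w2 h1 h2 h12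
    by_contra hI
    have hII := hcon w1 a w2 h1 h2 h12 hI
    obtain ⟨a', p1, p2, p3, -⟩ := third hd h1.symm h2 h12
    by_cases hI' : BadI G w1 a a'
    · obtain ⟨m, b, d, u, v, k1, k2, k3, k4, k5, k6, k7, k8, -⟩ := hI'
      exact hII.pent hG hV hd h1 h2 h12 p3 p1.symm p2.symm k4 k5 k6 k7 k8
    · obtain ⟨b, c, d, e, u, v, k1, k2, k3, k4, k5, k6, k7, k8, k9, k10, k11, -⟩ :=
        hcon w1 a a' h1 p3 p1 hI'
      exact hII.pent hG hV hd h1 h2 h12 p3 p1.symm p2.symm k1 k7 k3 k9 k11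
  obtain ⟨v⟩ : Nonempty V := Fintype.card_pos_iff.1 (by omega)
  obtain ⟨a, b, c, -, -, -, hab, hac, hbc, ha, hb, hc, -⟩ := dg_three (hd v)
  obtain ⟨x, u, a', y, d, h⟩ := (hall a v b ha.symm hb hab).cfg hG hd ha.symm hb hab
  exact h.false hG hV hd hall

end LOneA

section LOneB
open Classical
set_option linter.unusedSectionVars false

variable {V : Type} [Fintype V]

theorem conn_del {G : SimpleGraph V} (hG : G5 G) (hV : Fintype.card V = 16)
    (hd : ∀ v, dg G Finset.univ v = 3) (D : Finset V) (hDne : D.Nonempty)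
    (hD : ∑ v ∈ D, dg G (Finset.univ \ D) v ≤ 5) : Conn G (Finset.univ \ D) := by
  intro X hX hne hcl
  by_contra hXne
  set Y := (Finset.univ \ D) \ X with hY
  have hYne : Y.Nonempty := by
    rw [hY, Finset.sdiff_nonempty]
    intro h
    exact hXne (Finset.Subset.antisymm hX h)
  obtain ⟨w, hw⟩ := hDne
  have hwX : w ∉ X := fun h => (Finset.mem_sdiff.1 (hX h)).2 hw
  have hwY : w ∉ Y := fun h => (Finset.mem_sdiff.1 (Finset.mem_sdiff.1 h).1).2 hw
  have e1 := three_edge hG hV hd hne (by intro h; rw [h] at hwX; simp at hwX)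
  have e2 := three_edge hG hV hd hYne (by intro h; rw [h] at hwY; simp at hwY)
  have f1 : ∑ v ∈ X, dg G (Finset.univ \ X) v ≤ ∑ v ∈ X, dg G D v := by
    apply Finset.sum_le_sum
    intro v hv
    apply Finset.card_le_card
    intro u hu
    rw [mem_nb] at hu ⊢
    refine ⟨?_, hu.2⟩
    have hu1 := Finset.mem_sdiff.1 hu.1
    by_contra huw
    exact hu1.2 (hcl v hv u (Finset.mem_sdiff.2 ⟨hu1.1, huw⟩) hu.2)
  have f2 : ∑ v ∈ Y, dg G (Finset.univ \ Y) v ≤ ∑ v ∈ Y, dg G D v := by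
    apply Finset.sum_le_sum
    intro v hv
    apply Finset.card_le_card
    intro u hu
    rw [mem_nb] at hu ⊢
    refine ⟨?_, hu.2⟩
    have hu1 := Finset.mem_sdiff.1 hu.1
    by_contra huw
    have huw' : u ∈ Finset.univ \ D := Finset.mem_sdiff.2 ⟨hu1.1, huw⟩
    have huX : u ∈ X := by
      by_contra huX
      exact hu1.2 (Finset.mem_sdiff.2 ⟨huw', huX⟩)
    have hv' := Finset.mem_sdiff.1 hv
    exact hv'.2 (hcl u huX v hv'.1 hu.2.symm)
  have g : ∑ v ∈ X, dg G D v + ∑ v ∈ Y, dg G D v = ∑ v ∈ D, dg G (Finset.univ \ D) v := by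
    rw [sum_dg_comm G D, ← Finset.sum_sdiff hX, add_comm]
  omega

theorem good_path {G : SimpleGraph V} (hG : G5 G) (hV : Fintype.card V = 16)
    (hd : ∀ v, dg G Finset.univ v = 3) {w1 a w2 : V} (h1 : G.Adj w1 a) (h2 : G.Adj a w2)
    (h12 : w1 ≠ w2) (hI : ¬ BadI G w1 a w2) (hII : ¬ BadII G w1 a w2) :
    MemF 4 4 (G.induce ((Finset.univ : Finset V) : Set V)) := by
  obtain ⟨a', wa1, wa2, aa', Na⟩ := third hd h1.symm h2 h12
  obtain ⟨b, c, -, -, hab, hac, hbc, w1b, w1c, Nw1⟩ := dg_three' (hd w1) (Finset.mem_univ _) h1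
  obtain ⟨d, e, -, -, had, hae, hde, w2d, w2e, Nw2⟩ := dg_three' (hd w2) (Finset.mem_univ _) h2.symm
  replace Nw1 := fun u => Nw1 u (Finset.mem_univ u)
  replace Nw2 := fun u => Nw2 u (Finset.mem_univ u)
  have nw : ¬ G.Adj w1 w2 := fun h => hG.tri _ _ _ h1 h2 h.symm
  -- facts on `b, c`
  have B : ∀ t, (t = b ∨ t = c) → G.Adj w1 t ∧ t ≠ a := by
    rintro t (rfl | rfl)
    · exact ⟨w1b, hab.symm⟩
    · exact ⟨w1c, hac.symm⟩
  have D : ∀ s, (s = d ∨ s = e) → G.Adj w2 s ∧ s ≠ a := by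
    rintro s (rfl | rfl)
    · exact ⟨w2d, had.symm⟩
    · exact ⟨w2e, hae.symm⟩
  have BD : ∀ t s, (t = b ∨ t = c) → (s = d ∨ s = e) → t ≠ s := by
    rintro t s ht hs rfl
    exact hG.quad _ _ _ _ h1 h2 (D t hs).1 (B t ht).1.symm h12 (B t ht).2.symm
  have Bw2 : ∀ t, (t = b ∨ t = c) → ¬ G.Adj w2 t := by
    intro t ht h
    exact hG.quad _ _ _ _ h1 h2 h (B t ht).1.symm h12 (B t ht).2.symm
  have Dw1 : ∀ s, (s = d ∨ s = e) → ¬ G.Adj w1 s := by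
    intro s hs h
    exact hG.quad _ _ _ _ h1 h2 (D s hs).1 h.symm h12 (D s hs).2.symm
  have Ba : ∀ t, (t = b ∨ t = c) → ¬ G.Adj a t := by
    intro t ht h
    exact hG.tri _ _ _ h1 h (B t ht).1.symm
  have Da : ∀ s, (s = d ∨ s = e) → ¬ G.Adj a s := by
    intro s hs h
    exact hG.tri _ _ _ h2 (D s hs).1 h.symm
  have Ba' : ∀ t, (t = b ∨ t = c) → ¬ G.Adj a' t := by
    intro t ht h
    exact hG.quad _ _ _ _ aa' h (B t ht).1.symm h1 (B t ht).2.symm wa1.symm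
  have Da' : ∀ s, (s = d ∨ s = e) → ¬ G.Adj a' s := by
    intro s hs h
    exact hG.quad _ _ _ _ aa' h (D s hs).1.symm h2.symm (D s hs).2.symm wa2.symm
  have a'b : ∀ t, (t = b ∨ t = c) → a' ≠ t := by
    rintro t ht rfl
    exact Ba _ ht aa'
  have a'd : ∀ s, (s = d ∨ s = e) → a' ≠ s := by
    rintro s hs rfl
    exact Da _ hs aa'
  have BB : ∀ s t, (s = b ∨ s = c) → (t = b ∨ t = c) → ¬ G.Adj s t := by
    intro s t hs ht h
    exact hG.tri _ _ _ (B s hs).1 h (B t ht).1.symm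
  have Tabc : ∀ t, (t = a ∨ t = b ∨ t = c) → G.Adj w1 t := by
    rintro t (rfl | rfl | rfl) <;> assumption
  -- stage one
  have cD1 : Conn G (Finset.univ.erase w1) := by
    rw [← Finset.sdiff_singleton_eq_erase]
    apply conn_del hG hV hd {w1} ⟨w1, by simp⟩
    rw [Finset.sum_singleton]
    have := dg_mono G (Finset.subset_univ (Finset.univ \ {w1})) w1
    have := hd w1
    omega
  obtain ⟨K, KA, K3, -, KM⟩ := claw (j := 3) (by norm_num) (K := G) (S := Finset.univ)
    (w := w1) (a := a) (b := b) (c := c) (by simp) (by simp) (by simp) (by simp) hab hac hbc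
    (fun x _ => Nw1 x) (Ba b (by simp)) (Ba c (by simp)) (BB b c (by simp) (by simp))
    (fun v _ => hd v)
    (fun t _ x _ y _ _ _ hx hy hxy => hG.tri _ _ _ hx hxy hy.symm)
    (fun s t _ _ hst x _ y _ _ _ hxy h1 h2 h3 h4 => hG.quad _ _ _ _ h1 h3.symm h4 h2.symm hst hxy)
    cD1
  set S := (((Finset.univ.erase w1).erase c).erase b).erase a with hS
  have mS : ∀ x, x ∈ S ↔ x ≠ a ∧ x ≠ b ∧ x ≠ c ∧ x ≠ w1 := by
    intro x
    simp [hS]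
  have w2S : w2 ∈ S := (mS _).2 ⟨h2.ne', fun h => nw (h ▸ w1b), fun h => nw (h ▸ w1c), h12.symm⟩
  have a'S : a' ∈ S := (mS _).2 ⟨aa'.ne', a'b b (by simp), a'b c (by simp), wa1.symm⟩
  have sS : ∀ s, (s = d ∨ s = e) → s ∈ S := by
    intro s hs
    refine (mS _).2 ⟨(D s hs).2, (BD b s (by simp) hs).symm, (BD c s (by simp) hs).symm, ?_⟩
    rintro rfl
    exact nw (D _ hs).1.symm
  -- adjacencies in `K`
  have Ka' : ∀ x ∈ S, x ≠ w2 → K.Adj a' x → G.Adj a' x := by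
    intro x hx hxw h
    rcases ((KA a' a'S x hx).1 h).2 with h | ⟨t, rfl | ht, h3, h4⟩
    · exact h
    · rcases (Na x).1 h4 with rfl | rfl | rfl
      · simp [mS] at hx
      · exact absurd rfl hxw
      · exact absurd h (K.loopless.irrefl _)
    · exact absurd h3 (Ba' t ht)
  have Ks : ∀ s, (s = d ∨ s = e) → ∀ x ∈ S, K.Adj s x →
      G.Adj s x ∨ ∃ t, (t = b ∨ t = c) ∧ G.Adj s t ∧ G.Adj t x := by
    intro s hs x hx h
    rcases ((KA s (sS s hs) x hx).1 h).2 with h | ⟨t, rfl | ht, h3, h4⟩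
    · exact Or.inl h
    · exact absurd h3.symm (Da s hs)
    · exact Or.inr ⟨t, ht, h3, h4⟩
  have viavia : ∀ s, (s = d ∨ s = e) → ∀ x ∈ S, ∀ y ∈ S, x ≠ y → K.Adj s x → K.Adj s y →
      ∀ t t', (t = b ∨ t = c) → (t' = b ∨ t' = c) → G.Adj s t → G.Adj t x →
      G.Adj s t' → G.Adj t' y → False := by
    intro s hs x hx y hy hxy kx ky t t' ht ht' h3 h4 h5 h6
    by_cases htt : t = t'
    · subst htt
      have hw1s : w1 ≠ s := by
        rintro rfl
        exact nw (D _ hs).1.symm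
      rw [mS] at hx hy
      have N := three_iff hd (B t ht).1.symm h3.symm h4 hw1s hx.2.2.2.symm kx.ne
      rcases (N y).1 h6 with h | h | h
      · exact hy.2.2.2 h
      · exact ky.ne h.symm
      · exact hxy h.symm
    · have hw1s : s ≠ w1 := by
        rintro rfl
        exact nw (D _ hs).1.symm
      exact hG.quad _ _ _ _ h3 (B t ht).1.symm (B t' ht').1 h5.symm hw1s htt
  have trimix : ∀ s, (s = d ∨ s = e) → ∀ x ∈ S, ∀ y ∈ S, x ≠ w2 → K.Adj s y → K.Adj x y →
      G.Adj s x → ∀ t, (t = b ∨ t = c) → G.Adj s t → G.Adj t y → False := by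
    intro s hs x hx y hy hxw ky kxy hsx t ht h3 h4
    have hx' := (mS x).1 hx
    have hy' := (mS y).1 hy
    have hxt : x ≠ t := by rcases ht with rfl | rfl; exacts [hx'.2.1, hx'.2.2.1]
    rcases ((KA x hx y hy).1 kxy).2 with h | ⟨r, rfl | hr, h5, h6⟩
    · exact hG.quad _ _ _ _ hsx h h4.symm h3.symm ky.ne hxt
    · rcases (Na x).1 h5.symm with rfl | rfl | rfl
      · exact hx'.2.2.2 rfl
      · exact hxw rfl
      · exact Da' s hs hsx.symm
    · by_cases hrt : r = t
      · subst hrt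
        exact hG.tri _ _ _ hsx h5 h3.symm
      · exact hG.quad _ _ _ _ h4.symm (B t ht).1.symm (B r hr).1 h6 hy'.2.2.2 (Ne.symm hrt)
  have triK : ∀ t, (t = a' ∨ t = d ∨ t = e) → ∀ x ∈ S, ∀ y ∈ S, x ≠ w2 → y ≠ w2 → K.Adj t x →
      K.Adj t y → ¬ K.Adj x y := by
    intro s hs x hx y hy hxw hyw kx ky kxy
    have GG : G.Adj s x → G.Adj s y → s ∈ S → False := by
      intro h3 h4 hsS
      rcases ((KA x hx y hy).1 kxy).2 with h | ⟨r, hr, h5, h6⟩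
      · exact hG.tri _ _ _ h3 h h4.symm
      · have hs' := (mS s).1 hsS
        have hsr : s ≠ r := by
          rcases hr with rfl | rfl | rfl
          exacts [hs'.1, hs'.2.1, hs'.2.2.1]
        exact hG.quad _ _ _ _ h3 h5 h6 h4.symm hsr kxy.ne
    rcases hs with rfl | hs
    · exact GG (Ka' x hx hxw kx) (Ka' y hy hyw ky) a'S
    · rcases Ks s hs x hx kx with gx | ⟨t, ht, h3, h4⟩ <;>
        rcases Ks s hs y hy ky with gy | ⟨t', ht', h3', h4'⟩
      · exact GG gx gy (sS s hs)
      · exact trimix s hs x hx y hy hxw ky kxy gx t' ht' h3' h4'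
      · exact trimix s hs y hy x hx hyw kx kxy.symm gy t ht h3 h4
      · exact viavia s hs x hx y hy kxy.ne kx ky t t' ht ht' h3 h4 h3' h4'
  have quadA : ∀ s, (s = d ∨ s = e) → ∀ x ∈ S, ∀ y ∈ S, x ≠ w2 → y ≠ w2 → x ≠ y → K.Adj a' x →
      K.Adj a' y → K.Adj s x → K.Adj s y → False := by
    intro s hs x hx y hy hxw hyw hxy kx ky sx sy
    have gx := Ka' x hx hxw kx
    have gy := Ka' y hy hyw ky
    rcases Ks s hs x hx sx with g | ⟨t, ht, h3, h4⟩ <;>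
      rcases Ks s hs y hy sy with g' | ⟨t', ht', h3', h4'⟩
    · exact hG.quad _ _ _ _ gx g.symm g' gy.symm (a'd s hs) hxy
    · exact hI ⟨a', t', s, y, x, aa', wa1.symm, wa2.symm, (B t' ht').1, (B t' ht').2, (D s hs).1,
        (D s hs).2, h3'.symm, h4', gy.symm, g, gx.symm⟩
    · exact hI ⟨a', t, s, x, y, aa', wa1.symm, wa2.symm, (B t ht).1, (B t ht).2, (D s hs).1,
        (D s hs).2, h3.symm, h4, gx.symm, g', gy.symm⟩
    · exact viavia s hs x hx y hy hxy sx sy t t' ht ht' h3 h4 h3' h4'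
  have comD : ∀ s1 s2, (s1 = d ∨ s1 = e) → (s2 = d ∨ s2 = e) → s1 ≠ s2 → ∀ x, x ≠ w2 →
      G.Adj s1 x → G.Adj s2 x → False := by
    intro s1 s2 hs1 hs2 h12 x hx h3 h4
    exact hG.quad _ _ _ _ h3.symm (D s1 hs1).1.symm (D s2 hs2).1 h4 hx h12
  have quadB : ∀ s1 s2, (s1 = d ∨ s1 = e) → (s2 = d ∨ s2 = e) → s1 ≠ s2 → ∀ x ∈ S, ∀ y ∈ S,
      x ≠ w2 → y ≠ w2 → x ≠ y → K.Adj s1 x → K.Adj s1 y → K.Adj s2 x → K.Adj s2 y → False := by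
    intro s1 s2 hs1 hs2 hs12 x hx y hy hxw hyw hxy k1x k1y k2x k2y
    have tw : ∀ t, (t = b ∨ t = c) → t ≠ w2 := by
      rintro t ht rfl
      exact nw (B _ ht).1
    have one : ∀ z ∈ S, z ≠ w2 → K.Adj s1 z → K.Adj s2 z →
        ((∃ t, (t = b ∨ t = c) ∧ G.Adj s1 t ∧ G.Adj t z) ∧ G.Adj s2 z) ∨
        (G.Adj s1 z ∧ ∃ t, (t = b ∨ t = c) ∧ G.Adj s2 t ∧ G.Adj t z) := by
      intro z hz hzw k1 k2
      rcases Ks s1 hs1 z hz k1 with g | ⟨t, ht, h3, h4⟩ <;>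
        rcases Ks s2 hs2 z hz k2 with g' | ⟨t', ht', h3', h4'⟩
      · exact (comD s1 s2 hs1 hs2 hs12 z hzw g g').elim
      · exact Or.inr ⟨g, t', ht', h3', h4'⟩
      · exact Or.inl ⟨⟨t, ht, h3, h4⟩, g'⟩
      · exfalso
        by_cases htt : t = t'
        · subst htt
          exact comD s1 s2 hs1 hs2 hs12 t (tw t ht) h3 h3'
        · exact hG.quad _ _ _ _ h4.symm (B t ht).1.symm (B t' ht').1 h4' ((mS z).1 hz).2.2.2 htt
    rcases one x hx hxw k1x k2x with ⟨⟨t, ht, h3, h4⟩, g⟩ | ⟨g, t, ht, h3, h4⟩ <;>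
      rcases one y hy hyw k1y k2y with ⟨⟨t', ht', h3', h4'⟩, g'⟩ | ⟨g', t', ht', h3', h4'⟩
    · exact viavia s1 hs1 x hx y hy hxy k1x k1y t t' ht ht' h3 h4 h3' h4'
    · have htt : t ≠ t' := by
        rintro rfl
        exact comD s1 s2 hs1 hs2 hs12 t (tw t ht) h3 h3'
      exact hII ⟨t, t', s1, s2, x, y, (B t ht).1, (B t' ht').1, (D s1 hs1).1, (D s2 hs2).1, htt, hs12,
        (B t ht).2, (B t' ht').2, (D s1 hs1).2, (D s2 hs2).2, h3.symm, h3'.symm, h4, g.symm, g',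
        h4'.symm⟩
    · have htt : t ≠ t' := by
        rintro rfl
        exact comD s1 s2 hs1 hs2 hs12 t (tw t ht) h3' h3
      exact hII ⟨t, t', s2, s1, x, y, (B t ht).1, (B t' ht').1, (D s2 hs2).1, (D s1 hs1).1, htt,
        hs12.symm, (B t ht).2, (B t' ht').2, (D s2 hs2).2, (D s1 hs1).2, h3.symm, h3'.symm, h4,
        g.symm, g', h4'.symm⟩
    · exact viavia s2 hs2 x hx y hy hxy k2x k2y t t' ht ht' h3 h4 h3' h4'
  have NK : ∀ x ∈ S, K.Adj w2 x ↔ x = a' ∨ x = d ∨ x = e := by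
    intro x hx
    have hx' := (mS x).1 hx
    rw [KA w2 w2S x hx]
    constructor
    · rintro ⟨hne, h | ⟨t, rfl | ht, h3, h4⟩⟩
      · rcases (Nw2 x).1 h with h | h
        · exact absurd h hx'.1
        · exact Or.inr h
      · rcases (Na x).1 h4 with h | h | h
        · exact absurd h hx'.2.2.2
        · exact absurd h.symm hne
        · exact Or.inl h
      · exact absurd h3 (Bw2 t ht)
    · rintro (rfl | hs)
      · exact ⟨wa2, Or.inr ⟨a, by simp, h2.symm, aa'⟩⟩
      · exact ⟨(D x hs).1.ne, Or.inl (D x hs).1⟩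
  have nKa : ∀ s, (s = d ∨ s = e) → ¬ K.Adj a' s := by
    intro s hs h
    exact Da' s hs (Ka' s (sS s hs) (D s hs).1.ne' h)
  have nKde : ¬ K.Adj d e := by
    intro h
    rcases Ks d (by simp) e (sS e (by simp)) h with h | ⟨t, ht, h3, h4⟩
    · exact hG.tri _ _ _ w2d h w2e.symm
    · refine comD d e (by simp) (by simp) hde t ?_ h3 h4.symm
      rintro rfl
      exact nw (B _ ht).1
  have cK : Conn K (S.erase w2) := by
    have cG : Conn G (Finset.univ \ {w1, w2, a}) := by
      apply conn_del hG hV hd _ ⟨w1, by simp⟩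
      have hw2a : w2 ≠ a := h2.ne'
      rw [Finset.sum_insert (by simp [h12, h1.ne]), Finset.sum_pair hw2a]
      have tot : ∀ v, dg G {w1, w2, a} v + dg G (Finset.univ \ {w1, w2, a}) v = 3 := by
        intro v
        rw [← dg_union G Finset.disjoint_sdiff, Finset.union_sdiff_of_subset (Finset.subset_univ _),
          hd v]
      have t1 := tot w1
      have t2 := tot w2
      have t3 := tot a
      have u1 : 1 ≤ dg G {w1, w2, a} w1 := Finset.card_pos.2 ⟨a, mem_nb.2 ⟨by simp, h1⟩⟩
      have u2 : 1 ≤ dg G {w1, w2, a} w2 := Finset.card_pos.2 ⟨a, mem_nb.2 ⟨by simp, h2.symm⟩⟩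
      have u3 : 2 ≤ dg G {w1, w2, a} a := by
        have : ({w1, w2} : Finset V) ⊆ nb G {w1, w2, a} a := by
          intro u hu
          simp only [Finset.mem_insert, Finset.mem_singleton] at hu
          rcases hu with rfl | rfl
          · exact mem_nb.2 ⟨by simp, h1.symm⟩
          · exact mem_nb.2 ⟨by simp, h2⟩
        have := Finset.card_le_card this
        rwa [Finset.card_pair h12] at this
      omega
    intro X hX hne hcl
    have hXS : ∀ x ∈ X, x ≠ w2 ∧ x ∈ S := fun x hx => Finset.mem_erase.1 (hX hx)
    set Z := X ∪ ({b, c} : Finset V).filter (fun t => ∃ z ∈ X, G.Adj t z) with hZ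
    have mZ : ∀ x, x ∈ Z ↔ x ∈ X ∨ ((x = b ∨ x = c) ∧ ∃ z ∈ X, G.Adj x z) := by
      intro x
      simp [hZ]
    have mD : ∀ x, x ∈ Finset.univ \ ({w1, w2, a} : Finset V) ↔ x ≠ w1 ∧ x ≠ w2 ∧ x ≠ a := by
      intro x
      simp
    have hZeq : Z = Finset.univ \ {w1, w2, a} := by
      apply cG
      · intro x hx
        rw [mD]
        rcases (mZ x).1 hx with hx | ⟨hx, -⟩
        · have h3 := hXS x hx
          have h4 := (mS x).1 h3.2
          exact ⟨h4.2.2.2, h3.1, h4.1⟩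
        · refine ⟨(B x hx).1.ne', ?_, (B x hx).2⟩
          rintro rfl
          exact nw (B _ hx).1
      · obtain ⟨x, hx⟩ := hne
        exact ⟨x, (mZ x).2 (Or.inl hx)⟩
      · intro x hx y hy hxy
        rw [mD] at hy
        rw [mZ]
        rcases (mZ x).1 hx with hx | ⟨hx, z, hz, hxz⟩
        · by_cases hyb : y = b ∨ y = c
          · exact Or.inr ⟨hyb, x, hx, hxy.symm⟩
          · left
            push Not at hyb
            have hyS : y ∈ S := (mS y).2 ⟨hy.2.2, hyb.1, hyb.2, hy.1⟩
            exact hcl x hx y (Finset.mem_erase.2 ⟨hy.2.1, hyS⟩)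
              ((KA x (hXS x hx).2 y hyS).2 ⟨hxy.ne, Or.inl hxy⟩)
        · left
          have hyb : ¬ (y = b ∨ y = c) := fun h => BB x y hx h hxy
          push Not at hyb
          have hyS : y ∈ S := (mS y).2 ⟨hy.2.2, hyb.1, hyb.2, hy.1⟩
          by_cases hyz : y = z
          · rw [hyz]; exact hz
          · exact hcl z hz y (Finset.mem_erase.2 ⟨hy.2.1, hyS⟩)
              ((KA z (hXS z hz).2 y hyS).2 ⟨Ne.symm hyz, Or.inr ⟨x, Or.inr hx, hxz.symm, hxy⟩⟩)
    apply Finset.Subset.antisymm hX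
    intro y hy
    have hy1 := Finset.mem_erase.1 hy
    have hy2 := (mS y).1 hy1.2
    have hyZ : y ∈ Z := by
      rw [hZeq, mD]
      exact ⟨hy2.2.2.2, hy1.1, hy2.1⟩
    rcases (mZ y).1 hyZ with h | ⟨rfl | rfl, -⟩
    · exact h
    · exact absurd rfl hy2.2.1
    · exact absurd rfl hy2.2.2.1
  obtain ⟨L, -, L3, LC, LM⟩ := claw (j := 2) (by norm_num) (K := K) (S := S)
    (w := w2) (a := a') (b := d) (c := e) w2S a'S (sS d (by simp)) (sS e (by simp))
    (a'd d (by simp)) (a'd e (by simp)) hde NK (nKa d (by simp)) (nKa e (by simp)) nKde K3 triK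
    (by
      intro s t hs ht hst x hx y hy hxw hyw hxy k1 k2 k3 k4
      rcases hs with rfl | hs <;> rcases ht with rfl | ht
      · exact hst rfl
      · exact quadA t ht x hx y hy hxw hyw hxy k1 k2 k3 k4
      · exact quadA s hs x hx y hy hxw hyw hxy k3 k4 k1 k2
      · exact quadB s t hs ht hst x hx y hy hxw hyw hxy k1 k2 k3 k4)
    cK
  apply KM
  apply LM
  apply F22 _ LC L3
  have hSc : S.card = 12 := by
    rw [hS, card_erase4 (by simp), Finset.card_univ, hV]
    · simp [w1c.ne']
    · simp [w1b.ne', hbc]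
    · simp [h1.ne', hab, hac]
  rw [card_erase4 w2S, hSc]
  · simp only [Finset.mem_erase]
    exact ⟨w2e.ne', sS e (by simp)⟩
  · simp only [Finset.mem_erase]
    exact ⟨hde, w2d.ne', sS d (by simp)⟩
  · simp only [Finset.mem_erase]
    exact ⟨a'd d (by simp), a'd e (by simp), wa2.symm, a'S⟩

theorem recog_L1 {G : SimpleGraph V} (hG : G5 G) (hV : Fintype.card V = 16)
    (hd : ∀ v, dg G Finset.univ v = 3) : MemF 4 4 G := by
  obtain ⟨w1, a, w2, h1, h2, h3, h4, h5⟩ := good_exists hG hV hd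
  have h := good_path hG hV hd h1 h2 h3 h4 h5
  rw [Finset.coe_univ] at h
  exact memF_iso h (induceUnivIso G).symm

end LOneB

section Final
open Classical
set_option linter.unusedSectionVars false

variable {V : Type} [Fintype V]

theorem dg_univ (G : SimpleGraph V) (v : V) :
    dg G Finset.univ v = (G.neighborSet v).ncard := by
  have : G.neighborSet v = ((nb G Finset.univ v : Finset V) : Set V) := by
    ext u
    simp [mem_nb, mem_neighborSet]
  rw [this, Set.ncard_coe_finset]
  rfl

theorem closed_univ {G : SimpleGraph V} (hconn : G.Connected) {J : Finset V}
    (hne : J.Nonempty) (hsub : ∀ v, dg G Finset.univ v ≤ 3) (h3 : ∀ v ∈ J, dg G J v = 3) :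
    J = Finset.univ := by
  have hcl : ∀ u v, u ∈ J → G.Adj u v → v ∈ J := by
    intro u v hu huv
    have hsubset : nb G J u ⊆ nb G Finset.univ u := by
      intro w hw
      rw [mem_nb] at hw ⊢
      exact ⟨Finset.mem_univ _, hw.2⟩
    have heq : nb G J u = nb G Finset.univ u := by
      apply Finset.eq_of_subset_of_card_le hsubset
      have h1 := h3 u hu
      have h2 := hsub u
      unfold dg at h1 h2
      omega
    have : v ∈ nb G J u := by
      rw [heq, mem_nb]
      exact ⟨Finset.mem_univ _, huv⟩
    exact (mem_nb.1 this).1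
  have hw : ∀ u v (_ : G.Walk u v), u ∈ J → v ∈ J := by
    intro u v p
    induction p with
    | nil => exact id
    | cons h _ ih => exact fun hu => ih (hcl _ _ hu h)
  obtain ⟨x, hx⟩ := hne
  ext v
  simp only [Finset.mem_univ, iff_true]
  obtain ⟨p⟩ := hconn.preconnected x v
  exact hw x v p hx

theorem part_deg {G : SimpleGraph V} {P : Finset (Finset V)} (hP : Opt G P Finset.univ)
    {J : Finset V} (hJ : J ∈ P) (hne : ¬ ∃ x, J = {x}) : ∀ v ∈ J, 2 ≤ dg G J v := by
  intro v hv
  have h1 := hP.two_edge hJ (A := {v}) (by simpa using hv) (by simp)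
    (fun h => hne ⟨v, h.symm⟩)
  rw [Finset.sum_singleton] at h1
  exact h1.trans (dg_mono G Finset.sdiff_subset v)

theorem part_delta {G : SimpleGraph V} (hG : G5 G) (hsub : ∀ v, dg G Finset.univ v ≤ 3)
    {P : Finset (Finset V)} (hP : Opt G P Finset.univ) {J : Finset V} (hJ : J ∈ P) :
    5 * wt G J - ec G J ≤ 0 ∨
    ((∀ v ∈ J, 2 ≤ dg G J v) ∧ (∀ v ∈ J, dg G J v ≤ 3) ∧
      ((5 * wt G J - ec G J = 2 ∧ J.card = 12 ∧ ∀ v ∈ J, dg G J v = 3) ∨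
       (5 * wt G J - ec G J = 1 ∧
        ((J.card = 10 ∧ (J.filter (fun v => dg G J v = 2)).card = 2) ∨
         (J.card = 13 ∧ (J.filter (fun v => dg G J v = 2)).card = 1) ∨
         (J.card = 16 ∧ ∀ v ∈ J, dg G J v = 3))))) := by
  by_cases hs : ∃ x, J = {x}
  · obtain ⟨x, rfl⟩ := hs
    left
    rw [wt_singleton, ec_singleton]
    simp
  · have h2 := part_deg hP hJ hs
    have h3 : ∀ v ∈ J, dg G J v ≤ 3 := fun v _ =>
      (dg_mono G (Finset.subset_univ J) v).trans (hsub v)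
    rcases delta_bound hG (hP.1.ne J hJ) h2 h3 with h | h
    · exact Or.inl h
    · exact Or.inr ⟨h2, h3, h⟩

theorem structure_b {G : SimpleGraph V} (hconn : G.Connected) (hgirth : 5 ≤ G.egirth)
    {P : Finset (Finset V)} (hP : Opt G P Finset.univ)
    (hc : (crossE G P Finset.univ).card + 1 ≤ P.card)
    (hall : ∀ J ∈ P, Nonempty (G.induce (J : Set V) ≃g Rgraph) ∨
      MemF 4 3 (G.induce (J : Set V))) :
    ∃ (ι : Type) (Q : V → ι) (H : SimpleGraph V),
      AddCutEdges H G ∧ PartitionedBy H Q ∧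
      ∀ i : ι, Nonempty ((H.induce (Q ⁻¹' {i})) ≃g Rgraph) ∨
        (MemF 4 3 (H.induce (Q ⁻¹' {i})) ∧ 5 ≤ (H.induce (Q ⁻¹' {i})).egirth) := by
  have hcov : ∀ v : V, ∃ J : {J // J ∈ P}, v ∈ J.1 := by
    intro v
    obtain ⟨J, hJ, hv⟩ := hP.1.cov v (Finset.mem_univ v)
    exact ⟨⟨J, hJ⟩, hv⟩
  choose Q hQ using hcov
  have hQeq : ∀ (v : V) (J : {J // J ∈ P}), v ∈ J.1 ↔ Q v = J := by
    intro v J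
    constructor
    · intro h
      exact Subtype.ext (hP.1.uniq _ (Q v).2 _ J.2 v (hQ v) h)
    · rintro rfl
      exact hQ v
  let H : SimpleGraph V :=
    { Adj := fun u v => G.Adj u v ∧ Q u = Q v
      symm := ⟨fun u v h => ⟨h.1.symm, h.2.symm⟩⟩
      loopless := ⟨fun u h => G.loopless.irrefl u h.1⟩ }
  have hHG : H ≤ G := fun u v h => h.1
  refine ⟨{J // J ∈ P}, Q, H, ⟨hHG, ?_⟩, fun u v h => h.2, ?_⟩
  · intro e he
    apply cross_bridge hconn hP.1 hc
    induction e with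
    | _ u v =>
      obtain ⟨h1, h2⟩ := he
      rw [mem_edgeSet] at h1 h2
      unfold crossE
      rw [Finset.mem_filter, mem_inE]
      refine ⟨⟨h1, fun _ _ => Finset.mem_univ _⟩, ?_⟩
      intro J hJ hall'
      apply h2
      refine ⟨h1, ?_⟩
      have hu := (hQeq u ⟨J, hJ⟩).1 (hall' u (by simp))
      have hv := (hQeq v ⟨J, hJ⟩).1 (hall' v (by simp))
      rw [hu, hv]
  · intro i
    have hset : ∀ v, v ∈ Q ⁻¹' {i} ↔ v ∈ (i.1 : Set V) := by
      intro v
      rw [Set.mem_preimage, Set.mem_singleton_iff, Finset.mem_coe, hQeq]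
    let f : H.induce (Q ⁻¹' {i}) ≃g G.induce (i.1 : Set V) :=
      { toEquiv := Equiv.subtypeEquivRight hset
        map_rel_iff' := by
          intro a b
          have ha : Q a.1 = i := a.2
          have hb : Q b.1 = i := b.2
          show G.Adj a.1 b.1 ↔ (G.Adj a.1 b.1 ∧ Q a.1 = Q b.1)
          rw [ha, hb]
          simp }
    rcases hall i.1 i.2 with ⟨⟨g⟩⟩ | h
    · exact Or.inl ⟨f.trans g⟩
    · refine Or.inr ⟨memF_iso h f, ?_⟩
      rw [f.egirth_eq]
      refine hgirth.trans (IsContained.egirth_le ?_)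
      exact ⟨(Embedding.induce (G := G) (i.1 : Set V)).toCopy⟩

theorem final_main (G : SimpleGraph V)
    (hconn : G.Connected) (hsub : Subcubic G) (hgirth : 5 ≤ G.egirth) :
    ((Cubic G ∧ Nat.card V = 12) ∧
      (fvs G : ℝ) = 1 / 5 * G.edgeSet.ncard + 2 / 5) ∨
    ((MemF 4 4 G ∨
        ∃ (ι : Type) (P : V → ι) (H : SimpleGraph V),
          AddCutEdges H G ∧ PartitionedBy H P ∧
          ∀ i : ι, Nonempty ((H.induce (P ⁻¹' {i})) ≃g Rgraph) ∨
            (MemF 4 3 (H.induce (P ⁻¹' {i})) ∧ 5 ≤ (H.induce (P ⁻¹' {i})).egirth)) ∧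
      (fvs G : ℝ) ≤ 1 / 5 * G.edgeSet.ncard + 1 / 5) ∨
    (fvs G : ℝ) ≤ 1 / 5 * G.edgeSet.ncard := by
  have hG := g5_of_egirth hgirth
  have hd : ∀ v, dg G Finset.univ v ≤ 3 := fun v => (dg_univ G v).le.trans (hsub v)
  obtain ⟨P, hP⟩ := exists_opt G Finset.univ
  have hmain := main_bound G hP
  have hge := cross_ge hconn hP.1
  by_cases hc0 : 5 * fvs G ≤ G.edgeSet.ncard
  · right; right
    have : (5 * fvs G : ℝ) ≤ G.edgeSet.ncard := by exact_mod_cast hc0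
    linarith
  push Not at hc0
  by_cases h12 : ∃ J ∈ P, 5 * wt G J - ec G J = 2 ∧ J.card = 12 ∧ ∀ v ∈ J, dg G J v = 3
  · left
    obtain ⟨J, hJ, hδ, hcard, h3⟩ := h12
    have hJu := closed_univ hconn (hP.1.ne J hJ) hd h3
    subst hJu
    have hPs : P = {Finset.univ} := by
      ext K
      rw [Finset.mem_singleton]
      constructor
      · intro hK
        obtain ⟨x, hx⟩ := hP.1.ne K hK
        exact hP.1.uniq K hK _ hJ x hx (Finset.mem_univ x)
      · rintro rfl
        exact hJ
    have hm : G.edgeSet.ncard = 18 := by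
      have h := handshake G Finset.univ
      rw [Finset.sum_congr rfl h3, Finset.sum_const, hcard, smul_eq_mul] at h
      rw [edgeSet_ncard]
      omega
    rw [hm, hPs, Finset.sum_singleton, hδ] at hmain
    rw [hm] at hc0
    have hf : fvs G = 4 := by omega
    refine ⟨⟨fun v => ?_, ?_⟩, ?_⟩
    · rw [← dg_univ]
      exact h3 v (Finset.mem_univ v)
    · rw [Nat.card_eq_fintype_card]
      exact hcard
    · rw [hf, hm]
      norm_num
  push Not at h12
  have hle1 : ∀ J ∈ P, 5 * wt G J - ec G J ≤ 1 := by
    intro J hJ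
    rcases part_delta hG hd hP hJ with h | ⟨_, _, ⟨h, h', h''⟩ | ⟨h, _⟩⟩
    · omega
    · obtain ⟨v, hv, hv'⟩ := h12 J hJ h h'
      exact absurd (h'' v hv) hv'
    · omega
  have hsum : ∑ J ∈ P, (5 * wt G J - ec G J) ≤ P.card := by
    have := Finset.sum_le_sum hle1
    simpa using this
  right; left
  have hfm : 5 * fvs G ≤ G.edgeSet.ncard + 1 := by omega
  have hreal : (fvs G : ℝ) ≤ 1 / 5 * G.edgeSet.ncard + 1 / 5 := by
    have : (5 * fvs G : ℝ) ≤ G.edgeSet.ncard + 1 := by exact_mod_cast hfm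
    linarith
  refine ⟨?_, hreal⟩
  have heq1 : ∀ J ∈ P, 5 * wt G J - ec G J = 1 := by
    intro J hJ
    by_contra hne
    have hlt : ∑ J ∈ P, (5 * wt G J - ec G J) < ∑ J ∈ P, (1 : ℤ) :=
      Finset.sum_lt_sum hle1 ⟨J, hJ, lt_of_le_of_ne (hle1 J hJ) hne⟩
    rw [Finset.sum_const, nsmul_eq_mul, mul_one] at hlt
    omega
  have hcr : (crossE G P Finset.univ).card + 1 ≤ P.card := by omega
  by_cases h16 : ∃ J ∈ P, J.card = 16 ∧ ∀ v ∈ J, dg G J v = 3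
  · left
    obtain ⟨J, hJ, hcard, h3⟩ := h16
    have hJu := closed_univ hconn (hP.1.ne J hJ) hd h3
    subst hJu
    exact recog_L1 hG hcard (fun v => h3 v (Finset.mem_univ v))
  · right
    refine structure_b hconn hgirth hP hcr ?_
    intro J hJ
    have h1 := heq1 J hJ
    rcases part_delta hG hd hP hJ with h | ⟨h2, h3, h | ⟨_, h | h | h⟩⟩
    · omega
    · omega
    · exact Or.inl (recog_R hG h.1 h2 h3 h.2)
    · exact Or.inr (recog_L2 hG h.1 h2 h3 h.2
        (fun A hA hne hneq => hP.two_edge hJ hA hne hneq))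
    · exact absurd ⟨J, hJ, h.1, h.2⟩ h16

end Final
/-- girth ≥ 5 case of the explicit main theorem.  Here "G is isomorphic to
`R_1` or `R_2`" is expressed by saying that `G` is a connected cubic graph on 12 vertices
with girth at least 5 (which characterizes `R_1` and `R_2` up to isomorphism). -/
theorem statement1 {V : Type} [Fintype V] (G : SimpleGraph V)
    (hconn : G.Connected) (hsub : Subcubic G) (hgirth : 5 ≤ G.egirth) :
    ((Cubic G ∧ Nat.card V = 12) ∧
      (fvs G : ℝ) = 1 / 5 * G.edgeSet.ncard + 2 / 5) ∨
    ((MemF 4 4 G ∨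
        ∃ (ι : Type) (P : V → ι) (H : SimpleGraph V),
          AddCutEdges H G ∧ PartitionedBy H P ∧
          ∀ i : ι, Nonempty ((H.induce (P ⁻¹' {i})) ≃g Rgraph) ∨
            (MemF 4 3 (H.induce (P ⁻¹' {i})) ∧ 5 ≤ (H.induce (P ⁻¹' {i})).egirth)) ∧
      (fvs G : ℝ) ≤ 1 / 5 * G.edgeSet.ncard + 1 / 5) ∨
    (fvs G : ℝ) ≤ 1 / 5 * G.edgeSet.ncard := by
  exact final_main G hconn hsub hgirth

end InducedForest
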